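/- Let ε > 0 and let s be a complex number with Re(s) ≥ 1/2 and |s−1| > ε. Then ∑*_{(m,2)=1, N(m) ≤ X} |L(s, χ_m)|² ≪ (X|s|)^{1+ε}, where the sum ∑* runs over square-free elements m of O_K coprime to 2. -/

import Mathlib

open Complex Real Filter Topology
open scoped BigOperators Classical

noncomputable section

/-- The norm `N(n)` of a Gaussian integer, as a real number. -/
def Nm (n : GaussianInt) : ℝ := ((Zsqrtd.norm n : ℤ) : ℝ)

/-- The element `1 + i` of `ℤ[i]`. -/
def ωg : GaussianInt := ⟨1, 1⟩

/-- The element `i` of `ℤ[i]`. -/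
def ig : GaussianInt := ⟨0, 1⟩

/-- `n` is primary: `n ≡ 1 mod (1+i)³`. -/
def IsPrimary (n : GaussianInt) : Prop := ωg ^ 3 ∣ (n - 1)

/-- `ẽ(z) = exp(2πi(z/(2i) − z̄/(2i)))`. -/
def eT (z : ℂ) : ℂ :=
  Complex.exp (2 * (Real.pi : ℂ) * Complex.I *
    (z / (2 * Complex.I) - (starRingEnd ℂ) z / (2 * Complex.I)))

/-- `χ a n = (a/n)` is the quadratic residue symbol of `ℤ[i]`: on odd primes `ϖ` it is
the `±1` (or `0`) value determined by `(a/ϖ) ≡ a^((N(ϖ)-1)/2) mod ϖ`, it is extended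
multiplicatively in the denominator over odd elements, and equals `1` on units. -/
structure IsQuadSym (χ : GaussianInt → GaussianInt → ℤ) : Prop where
  val_prime : ∀ ϖ a : GaussianInt, Prime ϖ → ¬ ωg ∣ ϖ → ¬ ϖ ∣ a →
    (χ a ϖ = 1 ∨ χ a ϖ = -1) ∧
      ϖ ∣ (a ^ (((Zsqrtd.norm ϖ).toNat - 1) / 2) - (χ a ϖ : GaussianInt))
  zero_of_dvd : ∀ ϖ a : GaussianInt, Prime ϖ → ϖ ∣ a → χ a ϖ = 0
  mul_den : ∀ a m n : GaussianInt, ¬ ωg ∣ m → ¬ ωg ∣ n → χ a (m * n) = χ a m * χ a n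
  unit_den : ∀ a u : GaussianInt, IsUnit u → χ a u = 1

/-- `L s m = L(s, χ_m)`: the Hecke `L`-function attached to the quadratic symbol `(m/·)`,
given by its Dirichlet series over primary elements (= odd ideals) for `Re s > 1`,
and analytic away from `s = 1`. -/
def IsHeckeL (χ : GaussianInt → GaussianInt → ℤ) (L : ℂ → GaussianInt → ℂ) : Prop :=
  (∀ (m : GaussianInt) (s : ℂ), 1 < s.re →
      L s m = ∑' n : {n : GaussianInt // IsPrimary n}, (χ m n.1 : ℂ) / (Nm n.1 : ℂ) ^ s) ∧
    ∀ m : GaussianInt, DifferentiableOn ℂ (fun s => L s m) {s : ℂ | s ≠ 1}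

/-- The generalized Riemann hypothesis for the family of quadratic Hecke `L`-functions. -/
def GRHfor (L : ℂ → GaussianInt → ℂ) : Prop :=
  ∀ m : GaussianInt, m ≠ 0 → ∀ s : ℂ, 0 < s.re → s.re < 1 → L s m = 0 → s.re = 1 / 2

/-- The absolute norm of an ideal of `ℤ[i]`, as a complex number. -/
def idN (I : Ideal GaussianInt) : ℂ := (Nat.card (GaussianInt ⧸ I) : ℂ)

/-- The Dedekind zeta function of `ℚ(i)`. -/
def IsDedekindZetaK (Z : ℂ → ℂ) : Prop :=
  (∀ s : ℂ, 1 < s.re → Z s = ∑' I : {I : Ideal GaussianInt // I ≠ ⊥}, idN I.1 ^ (-s)) ∧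
    DifferentiableOn ℂ Z {s : ℂ | s ≠ 1}

/-- `ζ_K^{(2)}`: the Euler product of `ζ_K` with the factor at the prime `(1+i)` omitted. -/
def zeta2 (Z : ℂ → ℂ) (s : ℂ) : ℂ := Z s * (1 - (2 : ℂ) ^ (-s))

/-- `P(z) = ∏_ϖ (1 + ((N(ϖ)^{z-1/2} − 1)(N(ϖ) + 1))⁻¹)`, over all primes of `ℤ[i]`. -/
def Pfun (z : ℂ) : ℂ :=
  ∏' I : {I : Ideal GaussianInt // I ≠ ⊥ ∧ I.IsPrime},
    (1 + 1 / ((idN I.1 ^ (z - 1 / 2) - 1) * (idN I.1 + 1)))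

/-- The Euler product over odd primes appearing in the ratios-conjecture main term. -/
def ratioEuler (α β : ℂ) : ℂ :=
  ∏' I : {I : Ideal GaussianInt // I ≠ ⊥ ∧ I.IsPrime ∧ (2 : GaussianInt) ∉ I},
    (1 + (idN I.1 ^ (α - β) - 1) / (idN I.1 ^ (1 + α - β) * (idN I.1 ^ (1 + α + β) - 1)))

/-- `g r n` is the quadratic Gauss sum `g(r,n) = ∑_{x mod n} (x/n) ẽ(rx/n)`:
for any complete residue system `S` modulo `n` it is given by the indicated finite sum. -/
def IsGaussSum (χ : GaussianInt → GaussianInt → ℤ) (g : GaussianInt → GaussianInt → ℂ) : Prop :=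
  ∀ r n : GaussianInt, n ≠ 0 → ∀ S : Finset GaussianInt,
    (∀ z : GaussianInt, ∃! x, x ∈ S ∧ n ∣ (z - x)) →
    g r n = ∑ x ∈ S, (χ x n : ℂ) * eT (GaussianInt.toComplex (r * x) / GaussianInt.toComplex n)

/-- A Dirichlet character modulo `q` on `ℤ[i]` (extended by zero). -/
def IsDirichletChar (q : GaussianInt) (χ : GaussianInt → ℂ) : Prop :=
  χ 1 = 1 ∧ (∀ a b : GaussianInt, χ (a * b) = χ a * χ b) ∧
    (∀ a b : GaussianInt, q ∣ (a - b) → χ a = χ b) ∧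
    (∀ a : GaussianInt, IsCoprime a q → ‖χ a‖ = 1) ∧
    (∀ a : GaussianInt, ¬ IsCoprime a q → χ a = 0)

/-- The Gauss sum `g(r,χ) = ∑_{x mod q} χ(x) ẽ(rx/q)` of a Dirichlet character modulo `q`. -/
def IsGaussSumChar (q : GaussianInt) (χ : GaussianInt → ℂ) (g : GaussianInt → ℂ) : Prop :=
  ∀ r : GaussianInt, ∀ S : Finset GaussianInt,
    (∀ z : GaussianInt, ∃! x, x ∈ S ∧ q ∣ (z - x)) →
    g r = ∑ x ∈ S, χ x * eT (GaussianInt.toComplex (r * x) / GaussianInt.toComplex q)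

/-- A primary `n = a + bi` is of type 1 if `a ≡ 1, b ≡ 0 (mod 4)` (else it is of type 2). -/
def IsTypeOne (n : GaussianInt) : Prop := n.re % 4 = 1 ∧ n.im % 4 = 0

/-- `ψ₁`, the principal character modulo `2` on `ℤ[i]`. -/
def psi1 (m : GaussianInt) : ℂ := if IsCoprime m 2 then 1 else 0

/-- `ψ₂`, the primitive quadratic character modulo `2` on `ℤ[i]`:
`ψ₂(m) = 1` for `m ≡ 1 (mod 2)`, `ψ₂(m) = −1` for `m ≡ i (mod 2)`, and `0` otherwise. -/
def psi2 (m : GaussianInt) : ℂ :=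
  if (2 : GaussianInt) ∣ (m - 1) then 1 else if (2 : GaussianInt) ∣ (m - ig) then -1 else 0

/-- `χ̃_n = ψ_j · (·/n)`, where `j` is the type of the primary element `n`. -/
def tchi (χ : GaussianInt → GaussianInt → ℤ) (n m : GaussianInt) : ℂ :=
  (if IsTypeOne n then psi1 m else psi2 m) * (χ m n : ℂ)

namespace SMQ

local notation "O" => GaussianInt

/-! ### Part A: basic facts on Gaussian integers and their norms -/

theorem Nm_eq (n : O) : Nm n = (n.re : ℝ) ^ 2 + (n.im : ℝ) ^ 2 := by
  unfold Nm; rw [Zsqrtd.norm_def]; push_cast; ring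

theorem Nm_nonneg (n : O) : 0 ≤ Nm n := by rw [Nm_eq]; positivity

theorem Nm_mul (a b : O) : Nm (a * b) = Nm a * Nm b := by
  unfold Nm; rw [Zsqrtd.norm_mul]; push_cast; ring

@[simp] theorem Nm_zero : Nm 0 = 0 := by simp [Nm_eq]
@[simp] theorem Nm_one : Nm 1 = 1 := by simp [Nm_eq]

theorem Nm_pow (a : O) (k : ℕ) : Nm (a ^ k) = Nm a ^ k := by
  induction k with
  | zero => simp
  | succ k ih => rw [pow_succ, Nm_mul, ih, pow_succ]

theorem Nm_star (a : O) : Nm (star a) = Nm a := by simp [Nm_eq]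

theorem one_le_Nm {n : O} (h : n ≠ 0) : 1 ≤ Nm n := by
  have : (0:ℤ) < Zsqrtd.norm n := GaussianInt.norm_pos.2 h
  unfold Nm; exact_mod_cast this

theorem Nm_pos {n : O} (h : n ≠ 0) : 0 < Nm n := lt_of_lt_of_le one_pos (one_le_Nm h)

theorem Nm_eq_zero {n : O} : Nm n = 0 ↔ n = 0 := by
  constructor
  · intro h; by_contra h'; exact (Nm_pos h').ne' h
  · rintro rfl; simp

theorem Nm_eq_normSq (n : O) : Nm n = Complex.normSq (GaussianInt.toComplex n) := by
  unfold Nm; exact GaussianInt.intCast_real_norm n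

theorem Nm_unit {u : O} (h : IsUnit u) : Nm u = 1 := by
  have h1 := Zsqrtd.norm_eq_one_iff.2 h
  have h2 := GaussianInt.norm_nonneg u
  unfold Nm; norm_cast; omega

theorem isUnit_of_Nm {u : O} (h : Nm u = 1) : IsUnit u := by
  apply Zsqrtd.norm_eq_one_iff.1
  unfold Nm at h; have : Zsqrtd.norm u = 1 := by exact_mod_cast h
  rw [this]; rfl

theorem Nm_le_of_dvd {a b : O} (hb : b ≠ 0) (h : a ∣ b) : Nm a ≤ Nm b := by
  obtain ⟨c, rfl⟩ := h
  rw [Nm_mul]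
  have : c ≠ 0 := by rintro rfl; simp at hb
  nlinarith [one_le_Nm this, Nm_nonneg a]

@[simp] theorem Nm_omega : Nm ωg = 2 := by simp [Nm_eq, ωg]; norm_num
@[simp] theorem Nm_ig : Nm ig = 1 := by simp [Nm_eq, ig]

theorem isUnit_ig : IsUnit ig := isUnit_of_Nm Nm_ig

theorem ig_sq : ig * ig = -1 := by
  ext <;> simp [ig]

theorem omega_ne_zero : ωg ≠ 0 := by
  intro h; have := Nm_omega; rw [h] at this; simp at this

theorem omega_sq : ωg * ωg = 2 * ig := by
  ext <;> simp [ωg, ig] <;> norm_num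

theorem omega_dvd_iff (n : O) : ωg ∣ n ↔ (2:ℤ) ∣ n.re + n.im := by
  constructor
  · rintro ⟨c, rfl⟩
    simp [ωg]; exact ⟨c.re, by ring⟩
  · rintro ⟨k, hk⟩
    refine ⟨⟨k, k - n.re⟩, ?_⟩
    ext <;> simp [ωg] <;> linarith

theorem two_dvd_iff (n : O) : (2:O) ∣ n ↔ (2:ℤ) ∣ n.re ∧ (2:ℤ) ∣ n.im := by
  have : (2:O) = ((2:ℤ) : O) := by norm_cast
  rw [this, Zsqrtd.intCast_dvd]

theorem four_dvd_iff (n : O) : (4:O) ∣ n ↔ (4:ℤ) ∣ n.re ∧ (4:ℤ) ∣ n.im := by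
  have : (4:O) = ((4:ℤ) : O) := by norm_cast
  rw [this, Zsqrtd.intCast_dvd]

theorem omega_not_dvd_mul {a b : O} (ha : ¬ ωg ∣ a) (hb : ¬ ωg ∣ b) : ¬ ωg ∣ a * b := by
  rw [omega_dvd_iff] at *
  simp only [Zsqrtd.re_mul, Zsqrtd.im_mul]
  intro h
  have e : a.re * b.re + -1 * a.im * b.im + (a.re * b.im + a.im * b.re)
    = (a.re + a.im) * (b.re + b.im) - 2 * (a.im * b.im) := by ring
  rw [e] at h
  have h2 : (2:ℤ) ∣ (a.re + a.im) * (b.re + b.im) := by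
    have := dvd_add h (dvd_mul_right (2:ℤ) (a.im * b.im)); simpa using this
  rcases Int.prime_two.dvd_mul.1 h2 with h | h <;> contradiction

theorem omega_not_dvd_of_mul_left {a b : O} (h : ¬ ωg ∣ a * b) : ¬ ωg ∣ a :=
  fun h' => h (Dvd.dvd.mul_right h' b)
theorem omega_not_dvd_of_mul_right {a b : O} (h : ¬ ωg ∣ a * b) : ¬ ωg ∣ b :=
  fun h' => h (Dvd.dvd.mul_left h' a)

theorem omega_not_dvd_unit {u : O} (h : IsUnit u) : ¬ ωg ∣ u := by
  intro h'
  have := Nm_le_of_dvd h.ne_zero h'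
  rw [Nm_unit h, Nm_omega] at this; norm_num at this

theorem odd_iff_coprime_two (m : O) : IsCoprime m 2 ↔ ¬ ωg ∣ m := by
  have h2 : (2:O) = ωg * (ωg * (-ig)) := by
    ext <;> simp [ωg, ig]
  constructor
  · rintro h h'
    have hw : IsUnit ωg := h.isUnit_of_dvd' h' ⟨_, h2⟩
    have := Nm_unit hw; rw [Nm_omega] at this; norm_num at this
  · intro h
    have hp : Irreducible ωg := by
      constructor
      · intro h; have := Nm_unit h; rw [Nm_omega] at this; norm_num at this
      · intro a b hab
        have h1 : Zsqrtd.norm a * Zsqrtd.norm b = 2 := by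
          rw [← Zsqrtd.norm_mul, ← hab]; rfl
        have ha := GaussianInt.norm_nonneg a
        have hb := GaussianInt.norm_nonneg b
        have hd : Zsqrtd.norm a ∣ 2 := ⟨_, h1.symm⟩
        have hle := Int.le_of_dvd (by norm_num) hd
        have : Zsqrtd.norm a = 1 ∨ Zsqrtd.norm b = 1 := by
          interval_cases h : Zsqrtd.norm a <;> omega
        rcases this with h | h
        · left; apply isUnit_of_Nm; unfold Nm; rw [h]; norm_num
        · right; apply isUnit_of_Nm; unfold Nm; rw [h]; norm_num
    have hc : IsCoprime ωg m := (hp.coprime_iff_not_dvd).2 h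
    rw [h2]
    refine IsCoprime.mul_right hc.symm (IsCoprime.mul_right hc.symm ?_)
    exact ⟨0, ig, by simp [ig_sq]⟩

/-- semi-primary: `n ≡ 1 mod 2` -/
def Sp (n : O) : Prop := (2:O) ∣ n - 1

theorem Sp_iff (n : O) : Sp n ↔ (2:ℤ) ∣ n.re - 1 ∧ (2:ℤ) ∣ n.im := by
  unfold Sp; rw [two_dvd_iff]; simp

theorem Sp.odd {n : O} (h : Sp n) : ¬ ωg ∣ n := by
  rw [Sp_iff] at h; rw [omega_dvd_iff]; omega

theorem Sp.ne_zero {n : O} (h : Sp n) : n ≠ 0 := by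
  rintro rfl; exact h.odd (dvd_zero _)

theorem Sp_one : Sp 1 := by unfold Sp; simp
theorem Sp.mul {a b : O} (ha : Sp a) (hb : Sp b) : Sp (a * b) := by
  unfold Sp at *
  have : a * b - 1 = a * (b - 1) + (a - 1) := by ring
  rw [this]; exact dvd_add (Dvd.dvd.mul_left hb _) ha
theorem Sp.neg {a : O} (ha : Sp a) : Sp (-a) := by
  rw [Sp_iff] at *; simp; omega
theorem Sp.of_mul_left {a b : O} (ha : Sp a) (hab : Sp (a * b)) : Sp b := by
  unfold Sp at *
  have : b - 1 = (a * b - 1) - (a - 1) * b := by ring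
  rw [this]; exact dvd_sub hab (Dvd.dvd.mul_right ha _)
theorem Sp_or (n : O) (h : ¬ ωg ∣ n) : Sp n ∨ Sp (ig * n) := by
  rw [omega_dvd_iff] at h; simp only [Sp_iff]; simp [ig]; omega
theorem Sp_sq (n : O) (h : ¬ ωg ∣ n) : Sp (n * n) := by
  rcases Sp_or n h with h | h
  · exact h.mul h
  · have := (h.mul h).neg
    have e : -(ig * n * (ig * n)) = n * n := by
      have := ig_sq; linear_combination (-(n*n)) * this
    rwa [e] at this
theorem not_Sp_ig_mul {n : O} (h : Sp n) : ¬ Sp (ig * n) := by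
  rw [Sp_iff] at *; simp [ig]; omega
theorem Sp_of_primary {n : O} (h : IsPrimary n) : Sp n := by
  unfold IsPrimary at h; unfold Sp
  refine dvd_trans ⟨ig * ωg, ?_⟩ h
  have := omega_sq; linear_combination ωg * this

theorem primary_iff (n : O) : IsPrimary n ↔ (2:ℤ) ∣ n.im ∧ (4:ℤ) ∣ n.re - 1 + n.im := by
  unfold IsPrimary
  have h3 : ωg ^ 3 = ⟨-2, 2⟩ := by ext <;> simp [ωg, pow_succ] 
  rw [h3]
  constructor
  · rintro ⟨c, hc⟩
    have h1 := congrArg Zsqrtd.re hc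
    have h2 := congrArg Zsqrtd.im hc
    simp at h1 h2
    omega
  · rintro ⟨⟨a, ha⟩, ⟨b, hb⟩⟩
    refine ⟨⟨a - b, -b⟩, ?_⟩
    ext <;> simp <;> omega

theorem unit_cases {u : O} (h : IsUnit u) : u = 1 ∨ u = -1 ∨ u = ig ∨ u = -ig := by
  have h1 : u.re * u.re + u.im * u.im = 1 := by
    have h1 := Zsqrtd.norm_eq_one_iff.2 h
    have h2 := GaussianInt.norm_nonneg u
    have e : u.norm = u.re * u.re + u.im * u.im := by rw [Zsqrtd.norm_def]; ring
    rw [e] at h1 h2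
    omega
  have a1 : u.re ≤ 1 := by nlinarith
  have a2 : -1 ≤ u.re := by nlinarith
  have b1 : u.im ≤ 1 := by nlinarith
  have b2 : -1 ≤ u.im := by nlinarith
  obtain ⟨x, y⟩ := u
  simp only at *
  interval_cases x <;> interval_cases y <;> simp at h1 <;> simp [ig, Zsqrtd.ext_iff]

theorem finite_ball (Y : ℝ) : {n : O | Nm n ≤ Y}.Finite := by
  have h : {n : O | Nm n ≤ Y} ⊆ (fun p : ℤ × ℤ => (⟨p.1, p.2⟩ : O)) ''
      ((Set.Icc (-⌊Real.sqrt Y⌋) ⌊Real.sqrt Y⌋) ×ˢ (Set.Icc (-⌊Real.sqrt Y⌋) ⌊Real.sqrt Y⌋)) := by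
    intro n hn
    simp only [Set.mem_ofPred_eq, Nm_eq] at hn
    refine ⟨(n.re, n.im), ?_, by ext <;> rfl⟩
    have h1 : |(n.re:ℝ)| ≤ Real.sqrt Y := Real.abs_le_sqrt (by nlinarith [sq_nonneg (n.im:ℝ)])
    have h2 : |(n.im:ℝ)| ≤ Real.sqrt Y := Real.abs_le_sqrt (by nlinarith [sq_nonneg (n.re:ℝ)])
    have h1' : |n.re| ≤ ⌊Real.sqrt Y⌋ := Int.le_floor.2 (by push_cast; exact h1)
    have h2' : |n.im| ≤ ⌊Real.sqrt Y⌋ := Int.le_floor.2 (by push_cast; exact h2)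
    exact ⟨abs_le.1 h1', abs_le.1 h2'⟩
  exact Set.Finite.subset (((Set.finite_Icc _ _).prod (Set.finite_Icc _ _)).image _) h

/-- the finite set of Gaussian integers of norm at most `Y` -/
def Bl (Y : ℝ) : Finset O := (finite_ball Y).toFinset

@[simp] theorem mem_Bl {Y : ℝ} {n : O} : n ∈ Bl Y ↔ Nm n ≤ Y := by simp [Bl]

theorem card_Bl {Y : ℝ} (hY : 1 ≤ Y) : ((Bl Y).card : ℝ) ≤ 9 * Y := by
  have hsub : Bl Y ⊆ ((Finset.Icc (-⌊Real.sqrt Y⌋) ⌊Real.sqrt Y⌋) ×ˢ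
      (Finset.Icc (-⌊Real.sqrt Y⌋) ⌊Real.sqrt Y⌋)).image (fun p : ℤ × ℤ => (⟨p.1, p.2⟩ : O)) := by
    intro n hn
    rw [mem_Bl, Nm_eq] at hn
    rw [Finset.mem_image]
    refine ⟨(n.re, n.im), ?_, by ext <;> rfl⟩
    have h1 : |(n.re:ℝ)| ≤ Real.sqrt Y := Real.abs_le_sqrt (by nlinarith [sq_nonneg (n.im:ℝ)])
    have h2 : |(n.im:ℝ)| ≤ Real.sqrt Y := Real.abs_le_sqrt (by nlinarith [sq_nonneg (n.re:ℝ)])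
    have h1' : |n.re| ≤ ⌊Real.sqrt Y⌋ := Int.le_floor.2 (by push_cast; exact h1)
    have h2' : |n.im| ≤ ⌊Real.sqrt Y⌋ := Int.le_floor.2 (by push_cast; exact h2)
    rw [Finset.mem_product, Finset.mem_Icc, Finset.mem_Icc]
    exact ⟨abs_le.1 h1', abs_le.1 h2'⟩
  have h0 : (0:ℤ) ≤ ⌊Real.sqrt Y⌋ := Int.floor_nonneg.2 (Real.sqrt_nonneg _)
  have hc := (Finset.card_le_card hsub).trans Finset.card_image_le
  rw [Finset.card_product, Int.card_Icc] at hc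
  have e : (((⌊Real.sqrt Y⌋ + 1 - -⌊Real.sqrt Y⌋).toNat : ℕ) : ℝ) = 2 * (⌊Real.sqrt Y⌋ : ℝ) + 1 := by
    have : ((⌊Real.sqrt Y⌋ + 1 - -⌊Real.sqrt Y⌋).toNat : ℤ) = 2 * ⌊Real.sqrt Y⌋ + 1 := by omega
    exact_mod_cast this
  have hc' : ((Bl Y).card : ℝ) ≤ (2 * (⌊Real.sqrt Y⌋ : ℝ) + 1) * (2 * (⌊Real.sqrt Y⌋ : ℝ) + 1) := by
    rw [← e]; exact_mod_cast hc
  have hf : (⌊Real.sqrt Y⌋ : ℝ) ≤ Real.sqrt Y := Int.floor_le _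
  have hs : 1 ≤ Real.sqrt Y := Real.one_le_sqrt.2 hY
  have hsq : Real.sqrt Y * Real.sqrt Y = Y := Real.mul_self_sqrt (by linarith)
  have h0' : (0:ℝ) ≤ ⌊Real.sqrt Y⌋ := by exact_mod_cast h0
  nlinarith

/-- `ℤ[i] ≃ ℤ × ℤ` -/
def eqvZ : O ≃ ℤ × ℤ where
  toFun n := (n.re, n.im)
  invFun p := ⟨p.1, p.2⟩
  left_inv n := by ext <;> rfl
  right_inv p := rfl

theorem summable_Nm_rpow {σ : ℝ} (hσ : 1 < σ) : Summable (fun n : O => Nm n ^ (-σ)) := by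
  have h := EisensteinSeries.summable_one_div_norm_rpow (k := 2 * σ) (by linarith)
  let e : O ≃ (Fin 2 → ℤ) := eqvZ.trans (finTwoArrowEquiv ℤ).symm
  have h2 := (e.summable_iff).2 h
  refine Summable.of_nonneg_of_le (fun n => Real.rpow_nonneg (Nm_nonneg _) _) (fun n => ?_) h2
  by_cases hn : n = 0
  · subst hn
    simp only [Nm_zero]
    rw [Real.zero_rpow (by linarith)]
    exact Real.rpow_nonneg (norm_nonneg _) _
  · simp only [Function.comp]
    have h3 : ‖e n‖ ^ 2 ≤ Nm n := by
      have : ‖e n‖ = max (n.re.natAbs:ℝ) n.im.natAbs := by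
        rw [EisensteinSeries.norm_eq_max_natAbs]; simp [e, eqvZ]
      rw [this, Nm_eq]
      rcases max_cases (n.re.natAbs:ℝ) (n.im.natAbs:ℝ) with ⟨h, _⟩ | ⟨h, _⟩ <;> rw [h] <;>
        rw [Nat.cast_natAbs] <;> push_cast <;> rw [sq_abs] <;>
        nlinarith [sq_nonneg (n.re:ℝ), sq_nonneg (n.im:ℝ)]
    have hpos : 0 < ‖e n‖ := by
      rw [norm_pos_iff]; intro h
      apply hn; apply e.injective; rw [h]; ext i; fin_cases i <;> simp [e, eqvZ]
    rw [Real.rpow_neg (Nm_nonneg _), Real.rpow_neg hpos.le]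
    apply inv_anti₀ (Real.rpow_pos_of_pos hpos _)
    rw [Real.rpow_mul hpos.le]
    apply Real.rpow_le_rpow (by positivity) _ (by linarith)
    simpa using h3


/-! ### Part B: residue classes and the quadratic symbol -/

/-- the standard basis of `ℤ[i]` -/
def zbasis : Module.Basis (Fin 2) ℤ O := Module.Basis.ofEquivFun
  { toFun := fun n => ![n.re, n.im]
    invFun := fun v => ⟨v 0, v 1⟩
    left_inv := fun n => by ext <;> rfl
    right_inv := fun v => by ext i; fin_cases i <;> rfl
    map_add' := fun a b => by ext i; fin_cases i <;> simp
    map_smul' := fun a b => by ext i; fin_cases i <;> simp }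

instance : Module.Free ℤ O := Module.Free.of_basis zbasis
instance : Module.Finite ℤ O := Module.Finite.of_basis zbasis

theorem algnorm_eq (q : O) : Algebra.norm ℤ q = Zsqrtd.norm q := by
  rw [Algebra.norm_eq_matrix_det zbasis, Matrix.det_fin_two, Zsqrtd.norm_def]
  simp [Algebra.leftMulMatrix_eq_repr_mul, zbasis]

theorem card_quot (q : O) : (Nat.card (O ⧸ Ideal.span {q}) : ℝ) = Nm q := by
  have h := Ideal.absNorm_span_singleton q
  rw [algnorm_eq, Ideal.absNorm_apply] at h
  have h2 : (Nat.card (O ⧸ Ideal.span {q})) = (Zsqrtd.norm q).natAbs := h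
  rw [h2, Nm]
  have := GaussianInt.norm_nonneg q
  have e : ((Zsqrtd.norm q).natAbs : ℤ) = Zsqrtd.norm q := Int.natAbs_of_nonneg this
  calc (((Zsqrtd.norm q).natAbs : ℕ) : ℝ) = (((Zsqrtd.norm q).natAbs : ℤ) : ℝ) := by
        rw [Int.cast_natCast]
    _ = _ := by rw [e]

theorem card_quot_nat (q : O) : Nat.card (O ⧸ Ideal.span {q}) = (Zsqrtd.norm q).toNat := by
  have h := card_quot q
  unfold Nm at h
  have : ((Nat.card (O ⧸ Ideal.span {q}) : ℕ) : ℤ) = Zsqrtd.norm q := by exact_mod_cast h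
  omega

theorem finite_quot {q : O} (hq : q ≠ 0) : Finite (O ⧸ Ideal.span {q}) := by
  apply Nat.finite_of_card_ne_zero
  intro h
  have := card_quot q; rw [h] at this
  have := Nm_pos hq; simp_all

theorem odd_induction {P : O → Prop} (hu : ∀ u, IsUnit u → P u)
    (hm : ∀ p n, Prime p → ¬ ωg ∣ p → ¬ ωg ∣ n → P n → P (p * n)) : ∀ n, ¬ ωg ∣ n → P n := by
  intro n
  induction n using UniqueFactorizationMonoid.induction_on_prime with
  | h₁ => intro h; exact absurd (dvd_zero _) h
  | h₂ u h => intro _; exact hu u h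
  | h₃ a p _ hp ih =>
    intro h
    exact hm p a hp (omega_not_dvd_of_mul_left h) (omega_not_dvd_of_mul_right h)
      (ih (omega_not_dvd_of_mul_right h))

theorem not_dvd_two {p : O} (hp : Prime p) (ho : ¬ ωg ∣ p) : ¬ p ∣ 2 := by
  intro h
  exact hp.not_unit (((odd_iff_coprime_two p).2 ho).isUnit_of_dvd' dvd_rfl h)

section symbol

theorem chi_prime_unique {χ : O → O → ℤ} (hχ : IsQuadSym χ) {p a : O} (hp : Prime p)
    (ho : ¬ ωg ∣ p) (ha : ¬ p ∣ a) {c : ℤ} (hc : c = 1 ∨ c = -1)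
    (h : p ∣ a ^ (((Zsqrtd.norm p).toNat - 1) / 2) - (c : O)) : χ a p = c := by
  obtain ⟨h1, h2⟩ := hχ.val_prime p a hp ho ha
  have h3 : p ∣ (c : O) - (χ a p : O) := by
    have := dvd_sub h2 h; simpa using this
  have n2 := not_dvd_two hp ho
  rcases h1 with h1 | h1 <;> rcases hc with hc | hc <;> rw [h1, hc] at h3 ⊢
  · exfalso; apply n2; rw [← dvd_neg]; convert h3 using 1; norm_num
  · exfalso; apply n2; convert h3 using 1; norm_num

theorem chi_prime_mul {χ : O → O → ℤ} (hχ : IsQuadSym χ) {p : O} (hp : Prime p)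
    (ho : ¬ ωg ∣ p) (a b : O) : χ (a * b) p = χ a p * χ b p := by
  by_cases ha : p ∣ a
  · rw [hχ.zero_of_dvd p a hp ha, hχ.zero_of_dvd p _ hp (Dvd.dvd.mul_right ha b), zero_mul]
  by_cases hb : p ∣ b
  · rw [hχ.zero_of_dvd p b hp hb, hχ.zero_of_dvd p _ hp (Dvd.dvd.mul_left hb a), mul_zero]
  obtain ⟨h1, h2⟩ := hχ.val_prime p a hp ho ha
  obtain ⟨h3, h4⟩ := hχ.val_prime p b hp ho hb
  apply chi_prime_unique hχ hp ho (fun h => (hp.dvd_or_dvd h).elim ha hb)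
  · rcases h1 with h1 | h1 <;> rcases h3 with h3 | h3 <;> rw [h1, h3] <;> norm_num
  · rw [mul_pow]; push_cast
    have := dvd_add (Dvd.dvd.mul_right h2 (b ^ (((Zsqrtd.norm p).toNat - 1) / 2)))
      (Dvd.dvd.mul_left h4 (χ a p : O))
    convert this using 1; ring

theorem chi_prime_congr {χ : O → O → ℤ} (hχ : IsQuadSym χ) {p : O} (hp : Prime p)
    (ho : ¬ ωg ∣ p) {a b : O} (h : p ∣ a - b) : χ a p = χ b p := by
  by_cases ha : p ∣ a
  · have hb : p ∣ b := by have := dvd_sub ha h; simpa using this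
    rw [hχ.zero_of_dvd p a hp ha, hχ.zero_of_dvd p _ hp hb]
  · have hb : ¬ p ∣ b := fun hb => ha (by have := dvd_add h hb; simpa using this)
    obtain ⟨h1, h2⟩ := hχ.val_prime p b hp ho hb
    apply chi_prime_unique hχ hp ho ha h1
    have h3 : p ∣ a ^ (((Zsqrtd.norm p).toNat - 1) / 2) - b ^ (((Zsqrtd.norm p).toNat - 1) / 2) :=
      h.trans (sub_dvd_pow_sub_pow _ _ _)
    have := dvd_add h3 h2; simpa using this

theorem chi_mul {χ : O → O → ℤ} (hχ : IsQuadSym χ) {n : O} (ho : ¬ ωg ∣ n) (a b : O) :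
    χ (a * b) n = χ a n * χ b n := by
  refine odd_induction (P := fun n => χ (a * b) n = χ a n * χ b n) ?_ ?_ n ho
  · intro u hu; simp [hχ.unit_den _ u hu]
  · intro p n hp hpo hno ih
    rw [hχ.mul_den _ _ _ hpo hno, hχ.mul_den _ _ _ hpo hno, hχ.mul_den _ _ _ hpo hno, ih,
      chi_prime_mul hχ hp hpo]; ring

theorem chi_congr {χ : O → O → ℤ} (hχ : IsQuadSym χ) {n : O} (ho : ¬ ωg ∣ n) {a b : O}
    (h : n ∣ a - b) : χ a n = χ b n := by
  refine odd_induction (P := fun n => n ∣ a - b → χ a n = χ b n) ?_ ?_ n ho h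
  · intro u hu; simp [hχ.unit_den _ u hu]
  · intro p n hp hpo hno ih h
    rw [hχ.mul_den _ _ _ hpo hno, hχ.mul_den _ _ _ hpo hno, ih ((dvd_mul_left _ _).trans h),
      chi_prime_congr hχ hp hpo ((dvd_mul_right _ _).trans h)]

theorem chi_vals {χ : O → O → ℤ} (hχ : IsQuadSym χ) {n : O} (ho : ¬ ωg ∣ n) (a : O) :
    (IsCoprime a n → χ a n = 1 ∨ χ a n = -1) ∧ (¬ IsCoprime a n → χ a n = 0) := by
  refine odd_induction (P := fun n => (IsCoprime a n → χ a n = 1 ∨ χ a n = -1) ∧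
    (¬ IsCoprime a n → χ a n = 0)) ?_ ?_ n ho
  · intro u hu
    refine ⟨fun _ => Or.inl (hχ.unit_den _ u hu), fun h => absurd ?_ h⟩
    exact IsCoprime.of_isCoprime_of_dvd_left (isCoprime_zero_left.2 hu) (dvd_zero _)
  · intro p n hp hpo hno ih
    rw [hχ.mul_den _ _ _ hpo hno]
    rw [IsCoprime.mul_right_iff]
    by_cases hpa : p ∣ a
    · have : ¬ IsCoprime a p := fun h => hp.not_unit (h.isUnit_of_dvd' hpa dvd_rfl)
      simp [hχ.zero_of_dvd p a hp hpa, this]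
    · have hc : IsCoprime a p := ((hp.irreducible.coprime_iff_not_dvd).2 hpa).symm
      simp only [hc, true_and]
      obtain ⟨h1, h2⟩ := hχ.val_prime p a hp hpo hpa
      refine ⟨fun h => ?_, fun h => by rw [ih.2 h, mul_zero]⟩
      rcases h1 with h1 | h1 <;> rcases ih.1 h with h3 | h3 <;> rw [h1, h3] <;> norm_num

theorem chi_abs_le {χ : O → O → ℤ} (hχ : IsQuadSym χ) {n : O} (ho : ¬ ωg ∣ n) (a : O) :
    |χ a n| ≤ 1 := by
  by_cases h : IsCoprime a n
  · rcases (chi_vals hχ ho a).1 h with h | h <;> rw [h] <;> norm_num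
  · rw [(chi_vals hχ ho a).2 h]; norm_num

theorem chi_norm_le {χ : O → O → ℤ} (hχ : IsQuadSym χ) {n : O} (ho : ¬ ωg ∣ n) (a : O) :
    ‖(χ a n : ℂ)‖ ≤ 1 := by
  rw [Complex.norm_intCast]; exact_mod_cast chi_abs_le hχ ho a

theorem chi_sq {χ : O → O → ℤ} (hχ : IsQuadSym χ) {n : O} (ho : ¬ ωg ∣ n) {a : O}
    (h : IsCoprime a n) : χ a n * χ a n = 1 := by
  rcases (chi_vals hχ ho a).1 h with h | h <;> rw [h] <;> norm_num

theorem chi_ne_zero_iff {χ : O → O → ℤ} (hχ : IsQuadSym χ) {n : O} (ho : ¬ ωg ∣ n) {a : O} :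
    χ a n ≠ 0 ↔ IsCoprime a n := by
  constructor
  · intro h; by_contra h'; exact h ((chi_vals hχ ho a).2 h')
  · intro h; rcases (chi_vals hχ ho a).1 h with h | h <;> rw [h] <;> norm_num

theorem chi_one {χ : O → O → ℤ} (hχ : IsQuadSym χ) {n : O} (ho : ¬ ωg ∣ n) : χ 1 n = 1 := by
  have h := chi_mul hχ ho 1 1
  have h2 : χ 1 n ≠ 0 := (chi_ne_zero_iff hχ ho).2 isCoprime_one_left
  rw [mul_one] at h
  have : χ 1 n * (χ 1 n - 1) = 0 := by linarith
  rcases mul_eq_zero.1 this with h | h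
  · exact absurd h h2
  · linarith

theorem chi_unit_mul_den {χ : O → O → ℤ} (hχ : IsQuadSym χ) {n u : O} (ho : ¬ ωg ∣ n)
    (hu : IsUnit u) (a : O) : χ a (u * n) = χ a n := by
  rw [hχ.mul_den _ _ _ (omega_not_dvd_unit hu) ho, hχ.unit_den _ _ hu, one_mul]

/-- every odd prime has a non-residue -/
theorem exists_nonresidue {χ : O → O → ℤ} (hχ : IsQuadSym χ) {p : O} (hp : Prime p)
    (ho : ¬ ωg ∣ p) : ∃ a, χ a p = -1 := by
  by_contra hcon
  push Not at hcon
  have hall : ∀ a, ¬ p ∣ a → p ∣ a ^ (((Zsqrtd.norm p).toNat - 1) / 2) - 1 := by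
    intro a ha
    obtain ⟨h1, h2⟩ := hχ.val_prime p a hp ho ha
    rcases h1 with h1 | h1
    · rw [h1] at h2; simpa using h2
    · exact absurd h1 (hcon a)
  haveI hprime : (Ideal.span {p}).IsPrime := (Ideal.span_singleton_prime hp.ne_zero).2 hp
  haveI := finite_quot hp.ne_zero
  haveI : Fintype (O ⧸ Ideal.span {p}) := Fintype.ofFinite _
  haveI : IsDomain (O ⧸ Ideal.span {p}) := Ideal.Quotient.isDomain _
  set N := (Zsqrtd.norm p).toNat with hN
  have hcard : Fintype.card (O ⧸ Ideal.span {p}) = N := by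
    rw [← Nat.card_eq_fintype_card, card_quot_nat]
  have hN3 : 3 ≤ N := by
    have h1 : N ≠ 1 := by
      intro h; apply hp.not_unit; apply isUnit_of_Nm
      unfold Nm
      have : Zsqrtd.norm p = 1 := by omega
      rw [this]; norm_num
    have h0 : N ≠ 0 := by
      rw [← hcard]; exact Fintype.card_ne_zero
    have h2 : N ≠ 2 := by
      intro h
      have h3 : Zsqrtd.norm p = 2 := by omega
      rw [Zsqrtd.norm_def] at h3
      rw [omega_dvd_iff] at ho
      apply ho
      have h4 : (p.re + p.im) * (p.re + p.im) = 2 * (1 + p.re * p.im) := by linarith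
      have : (2:ℤ) ∣ (p.re + p.im) * (p.re + p.im) := ⟨_, h4⟩
      rcases Int.prime_two.dvd_mul.1 this with h | h <;> exact h
    omega
  have hroots : ∀ x : (O ⧸ Ideal.span {p}), x ≠ 0 → x ^ ((N - 1) / 2) = 1 := by
    intro x hx
    obtain ⟨a, rfl⟩ := Ideal.Quotient.mk_surjective x
    have ha : ¬ p ∣ a := by
      intro h; apply hx; rw [Ideal.Quotient.eq_zero_iff_mem, Ideal.mem_span_singleton]; exact h
    have := hall a ha
    rw [← Ideal.mem_span_singleton, ← Ideal.Quotient.eq_zero_iff_mem] at this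
    simp only [map_sub, map_pow, map_one] at this
    exact sub_eq_zero.1 this
  have hle : (Finset.univ.filter (fun x : (O ⧸ Ideal.span {p}) => x ≠ 0)).card ≤ (N - 1) / 2 := by
    have hk : 0 < (N - 1) / 2 := by omega
    calc _ ≤ (Polynomial.nthRoots ((N - 1) / 2) (1 : O ⧸ Ideal.span {p})).toFinset.card := by
          apply Finset.card_le_card
          intro x hx
          rw [Multiset.mem_toFinset, Polynomial.mem_nthRoots hk]
          exact hroots x (by simpa using hx)
      _ ≤ _ := (Multiset.toFinset_card_le _).trans (Polynomial.card_nthRoots _ _)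
  have heq : (Finset.univ.filter (fun x : (O ⧸ Ideal.span {p}) => x ≠ 0)).card = N - 1 := by
    rw [Finset.filter_ne', Finset.card_erase_of_mem (Finset.mem_univ _), Finset.card_univ, hcard]
  omega

end symbol


/-! ### Part B2: quadratic reciprocity in `ℤ[i]` -/

theorem jac_sum_sq (x y : ℤ) (N : ℕ) (hN : (N : ℤ) = x ^ 2 + y ^ 2) (hx : x % 2 = 1)
    (hy : y % 2 = 0) (hg : Int.gcd x y = 1) :
    jacobiSym y N = if (4:ℤ) ∣ y then 1 else -1 := by
  have hx8 : (x ^ 2) % 8 = 1 := by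
    have : x % 8 = 1 ∨ x % 8 = 3 ∨ x % 8 = 5 ∨ x % 8 = 7 := by omega
    rcases this with h | h | h | h <;> simp [pow_two, Int.mul_emod, h]
  have hy8 : (y ^ 2) % 8 = if (4:ℤ) ∣ y then 0 else 4 := by
    have : y % 8 = 0 ∨ y % 8 = 2 ∨ y % 8 = 4 ∨ y % 8 = 6 := by omega
    rcases this with h | h | h | h
    · rw [if_pos (by omega)]; simp [pow_two, Int.mul_emod, h]
    · rw [if_neg (by omega)]; simp [pow_two, Int.mul_emod, h]
    · rw [if_pos (by omega)]; simp [pow_two, Int.mul_emod, h]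
    · rw [if_neg (by omega)]; simp [pow_two, Int.mul_emod, h]
  have hN4 : N % 4 = 1 := by split_ifs at hy8 <;> omega
  have hNo : Odd N := Nat.odd_iff.2 (by omega)
  by_cases hy0 : y = 0
  · subst hy0
    have : x.natAbs = 1 := by simpa using hg
    have hN1 : N = 1 := by
      rcases Int.natAbs_eq x with h | h <;> rw [this] at h <;> rw [h] at hN <;> norm_num at hN <;>
        exact_mod_cast hN
    subst hN1; simp
  have hodd : ∀ w : ℕ, Odd w → (w : ℤ) ∣ y → jacobiSym (w : ℤ) N = 1 := by
    intro w hw hwy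
    rw [jacobiSym.quadratic_reciprocity_one_mod_four' hw hN4]
    have e : jacobiSym (N : ℤ) w = jacobiSym (x ^ 2) w := by
      apply jacobiSym.mod_left'
      rw [hN]
      apply Int.emod_emod_of_dvd _ (dvd_refl _) |>.symm.trans
      rw [Int.emod_emod_of_dvd _ (dvd_refl _)]
      apply Int.emod_eq_emod_iff_emod_sub_eq_zero.2
      apply Int.emod_eq_zero_of_dvd
      have : x ^ 2 + y ^ 2 - x ^ 2 = y * y := by ring
      rw [this]; exact Dvd.dvd.mul_right hwy y
    rw [e]
    apply jacobiSym.sq_one'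
    have h1 : Int.gcd x (w:ℤ) ∣ Int.gcd x y := Int.gcd_dvd_gcd_of_dvd_right _ hwy
    rw [hg] at h1
    exact Nat.dvd_one.1 h1
  have h2 : jacobiSym 2 N = if (4:ℤ) ∣ y then 1 else -1 := by
    rw [jacobiSym.at_two hNo, ZMod.χ₈_nat_eq_if_mod_eight]
    split_ifs at hy8 ⊢ <;> first | rfl | omega
  have hneg : ∀ z : ℤ, jacobiSym (-z) N = jacobiSym z N := by
    intro z; rw [jacobiSym.neg _ hNo, ZMod.χ₄_nat_one_mod_four hN4, one_mul]
  obtain ⟨k, w, hw, hkw⟩ := Nat.exists_eq_two_pow_mul_odd (n := y.natAbs) (by simpa using hy0)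
  have hwy : (w:ℤ) ∣ y := by
    rw [← Int.natAbs_dvd_natAbs]; simp [hkw]
  have e : jacobiSym y N = jacobiSym ((2:ℤ) ^ k * w) N := by
    have : ((2:ℤ) ^ k * w) = (y.natAbs : ℤ) := by rw [hkw]; push_cast; ring
    rw [this]
    rcases Int.natAbs_eq y with h | h
    · rw [← h]
    · conv_lhs => rw [h, hneg]
  rw [e, jacobiSym.mul_left, hodd w hw hwy, mul_one, jacobiSym.pow_left, h2]
  have hk : k ≠ 0 := by
    rintro rfl
    have : Odd y.natAbs := by rw [hkw]; simpa using hw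
    rw [Nat.odd_iff] at this; omega
  split_ifs with h4
  · simp
  · have : k = 1 := by
      by_contra hk1
      apply h4
      rw [← Int.natAbs_dvd_natAbs, hkw]
      have : (2:ℕ) ^ 2 ∣ 2 ^ k := pow_dvd_pow _ (by omega)
      exact Dvd.dvd.mul_right (by simpa using this) w
    rw [this]; norm_num

theorem norm_eq' (n : O) : Zsqrtd.norm n = n.re ^ 2 + n.im ^ 2 := by
  rw [Zsqrtd.norm_def]; ring

theorem dvd_norm_self (n : O) : n ∣ ((Zsqrtd.norm n : ℤ) : O) := by
  rw [Zsqrtd.norm_eq_mul_conj]; exact dvd_mul_right _ _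

theorem dvd_intCast_split {l : O} {q : ℕ} (hq : q.Prime) (hl : Zsqrtd.norm l = q) (z : ℤ) :
    l ∣ (z : O) ↔ (q : ℤ) ∣ z := by
  constructor
  · rintro ⟨c, hc⟩
    have := congrArg Zsqrtd.norm hc
    rw [Zsqrtd.norm_mul, hl, Zsqrtd.norm_intCast] at this
    have h : (q:ℤ) ∣ z * z := ⟨_, this⟩
    rcases (Nat.prime_iff_prime_int.1 hq).dvd_mul.1 h with h | h <;> exact h
  · intro h
    have h1 := dvd_norm_self l
    rw [hl] at h1
    refine h1.trans ?_
    obtain ⟨c, rfl⟩ := h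
    push_cast; exact dvd_mul_right _ _

theorem chi_int_split {χ : O → O → ℤ} (hχ : IsQuadSym χ) {l : O} {q : ℕ} (hq : q.Prime)
    (hl : Zsqrtd.norm l = q) (hp : Prime l) (ho : ¬ ωg ∣ l) (hq2 : q % 2 = 1) (z : ℤ) :
    χ (z : O) l = jacobiSym z q := by
  haveI : Fact q.Prime := ⟨hq⟩
  rw [← jacobiSym.legendreSym.to_jacobiSym]
  by_cases hz : (q:ℤ) ∣ z
  · rw [hχ.zero_of_dvd l _ hp ((dvd_intCast_split hq hl z).2 hz)]
    rw [(legendreSym.eq_zero_iff q z).2 ((ZMod.intCast_zmod_eq_zero_iff_dvd _ _).2 hz)]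
  · have hz' : ¬ l ∣ (z:O) := fun h => hz ((dvd_intCast_split hq hl z).1 h)
    apply chi_prime_unique hχ hp ho hz'
    · apply legendreSym.eq_one_or_neg_one
      intro h; exact hz ((ZMod.intCast_zmod_eq_zero_iff_dvd _ _).1 h)
    · have h := legendreSym.eq_pow q z
      have h2 : (((legendreSym q z : ℤ)) : ZMod q) = ((z ^ (q/2) : ℤ) : ZMod q) := by
        rw [h]; push_cast; rfl
      rw [ZMod.intCast_eq_intCast_iff_dvd_sub] at h2
      have h3 := (dvd_intCast_split hq hl _).2 h2
      rw [hl, Int.toNat_natCast]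
      have : (q - 1) / 2 = q / 2 := by omega
      rw [this]; push_cast at h3; exact h3

theorem chi_inert {χ : O → O → ℤ} (hχ : IsQuadSym χ) {l : ℕ} (hl : l.Prime) (h3 : l % 4 = 3)
    (hp : Prime (l : O)) (ho : ¬ ωg ∣ (l : O)) (a : O) :
    χ a (l : O) = jacobiSym (Zsqrtd.norm a) l := by
  haveI : Fact l.Prime := ⟨hl⟩
  rw [← jacobiSym.legendreSym.to_jacobiSym]
  have hdvd : ∀ z : ℤ, (l:O) ∣ (z:O) ↔ (l:ℤ) ∣ z := by
    intro z
    have : (l:O) = ((l:ℤ):O) := by push_cast; rfl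
    rw [this, Zsqrtd.intCast_dvd]; simp
  by_cases hz : (l:O) ∣ a
  · rw [hχ.zero_of_dvd _ _ hp hz]
    symm
    rw [legendreSym.eq_zero_iff, ZMod.intCast_zmod_eq_zero_iff_dvd, ← hdvd]
    exact hz.trans (dvd_norm_self a)
  · have hn : ¬ (l:ℤ) ∣ Zsqrtd.norm a := by
      intro h
      rw [← hdvd, Zsqrtd.norm_eq_mul_conj] at h
      rcases hp.dvd_or_dvd h with h | h
      · exact hz h
      · apply hz
        obtain ⟨c, hc⟩ := h
        refine ⟨star c, ?_⟩
        have := congrArg star hc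
        rw [star_star, star_mul] at this
        rw [this, mul_comm]
        congr 1
    apply chi_prime_unique hχ hp ho hz
    · apply legendreSym.eq_one_or_neg_one
      intro h; exact hn ((ZMod.intCast_zmod_eq_zero_iff_dvd _ _).1 h)
    · have hnl : (Zsqrtd.norm (l:O)).toNat = l * l := by
        rw [Zsqrtd.norm_natCast]; norm_cast
      rw [hnl]
      -- Frobenius
      have hfrob : (l:O) ∣ a ^ l - star a := by
        obtain ⟨r, hr⟩ := exists_add_pow_prime_eq hl (a.re : O) ((a.im:O) * ig)
        have ha : (a.re:O) + (a.im:O) * ig = a := by ext <;> simp [ig]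
        have hs : star a = (a.re:O) - (a.im:O) * ig := by ext <;> simp [ig]
        rw [ha] at hr
        have hfl : ∀ z : ℤ, (l:O) ∣ (z:O) ^ l - (z:O) := by
          intro z
          have : ((z ^ l - z : ℤ) : ZMod l) = 0 := by push_cast; rw [ZMod.pow_card, sub_self]
          have := (hdvd _).2 ((ZMod.intCast_zmod_eq_zero_iff_dvd _ _).1 this)
          push_cast at this; exact this
        have hig : ig ^ l = - ig := by
          have : l = 4 * (l/4) + 3 := by omega
          rw [this, pow_add, pow_mul]
          have e1 : ig ^ 4 = 1 := by
            have := ig_sq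
            linear_combination (ig * ig - 1) * this
          have e2 : ig ^ 3 = - ig := by
            have := ig_sq
            linear_combination ig * this
          rw [e1, one_pow, one_mul, e2]
        rw [hr, hs, mul_pow, hig]
        have := dvd_add (dvd_sub (hfl a.re) (Dvd.dvd.mul_right (hfl a.im) ig))
          (dvd_mul_right (l:O) ((a.re:O) * ((a.im:O) * ig) * r))
        convert this using 1; ring
      have e : (l * l - 1) / 2 = (l + 1) * (l / 2) := by
        obtain ⟨k, hk⟩ : ∃ k, l = 2 * k + 1 := ⟨l/2, by omega⟩
        have h1 : l / 2 = k := by omega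
        rw [h1, hk]
        have : (2 * k + 1) * (2 * k + 1) - 1 = 2 * ((2 * k + 1 + 1) * k) := by
          zify [show 1 ≤ (2 * k + 1) * (2 * k + 1) by nlinarith]; ring
        rw [this]; simp
      rw [e, pow_mul]
      have h1 : (l:O) ∣ a ^ (l + 1) - (Zsqrtd.norm a : ℤ) := by
        rw [Zsqrtd.norm_eq_mul_conj, pow_succ]
        have := Dvd.dvd.mul_left hfrob a
        convert this using 1; ring
      have h2 : (l:O) ∣ (a ^ (l + 1)) ^ (l/2) - ((Zsqrtd.norm a : ℤ):O) ^ (l/2) :=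
        h1.trans (sub_dvd_pow_sub_pow _ _ _)
      have h := legendreSym.eq_pow l (Zsqrtd.norm a)
      have h4 : (((legendreSym l (Zsqrtd.norm a) : ℤ)) : ZMod l)
          = (((Zsqrtd.norm a) ^ (l/2) : ℤ) : ZMod l) := by
        rw [h]; push_cast; rfl
      rw [ZMod.intCast_eq_intCast_iff_dvd_sub, ← hdvd] at h4
      push_cast at h4
      have := dvd_add h2 h4
      simpa using this

/-- classification of odd primes -/
theorem prime_class {p : O} (hp : Prime p) (ho : ¬ ωg ∣ p) :
    (∃ q : ℕ, q.Prime ∧ Zsqrtd.norm p = q ∧ q % 2 = 1) ∨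
    (∃ l : ℕ, l.Prime ∧ l % 4 = 3 ∧ Prime (l : O) ∧ ¬ ωg ∣ (l:O) ∧ ∃ u : O, IsUnit u ∧ p = u * l) := by
  have hpn : p ∣ ((Zsqrtd.norm p).toNat : O) := by
    have h := dvd_norm_self p
    have h0 := GaussianInt.norm_nonneg p
    have : ((Zsqrtd.norm p).toNat : O) = ((Zsqrtd.norm p : ℤ) : O) := by
      rw [← Int.cast_natCast, Int.toNat_of_nonneg h0]
    rw [this]; exact h
  have hex : ∀ n : ℕ, n ≠ 0 → p ∣ (n : O) → ∃ l : ℕ, l.Prime ∧ p ∣ (l : O) := by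
    intro n
    induction n using Nat.recOnMul with
    | zero => intro h; exact absurd rfl h
    | one => intro _ h; exact absurd (isUnit_of_dvd_one (by simpa using h)) hp.not_unit
    | prime q hq => intro _ h; exact ⟨q, hq, h⟩
    | mul a b ha hb =>
      intro h0 h
      push_cast at h
      rcases hp.dvd_or_dvd h with h | h
      · exact ha (by rintro rfl; simp at h0) h
      · exact hb (by rintro rfl; simp at h0) h
  have hn0 : (Zsqrtd.norm p).toNat ≠ 0 := by
    have := GaussianInt.norm_pos.2 hp.ne_zero; omega
  obtain ⟨l, hl, hpl⟩ := hex _ hn0 hpn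
  obtain ⟨c, hc⟩ := hpl
  have hN := congrArg Zsqrtd.norm hc
  rw [Zsqrtd.norm_natCast, Zsqrtd.norm_mul] at hN
  have hpo : (Zsqrtd.norm p) % 2 = 1 := by
    rw [omega_dvd_iff] at ho
    rw [norm_eq']
    have : p.re % 2 = 0 ∧ p.im % 2 = 1 ∨ p.re % 2 = 1 ∧ p.im % 2 = 0 := by omega
    rcases this with ⟨h1, h2⟩ | ⟨h1, h2⟩ <;> simp [pow_two, Int.add_emod, Int.mul_emod, h1, h2]
  have hp0 := GaussianInt.norm_nonneg p
  have hc0 := GaussianInt.norm_nonneg c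
  obtain ⟨P, hP⟩ : ∃ P : ℕ, Zsqrtd.norm p = P := ⟨_, (Int.toNat_of_nonneg hp0).symm⟩
  obtain ⟨D, hD⟩ : ∃ D : ℕ, Zsqrtd.norm c = D := ⟨_, (Int.toNat_of_nonneg hc0).symm⟩
  rw [hP, hD] at hN
  have hN' : P * D = l ^ 2 := by rw [pow_two]; exact_mod_cast hN.symm
  have hdiv : P ∣ l ^ 2 := ⟨_, hN'.symm⟩
  rcases (Nat.dvd_prime_pow hl).1 hdiv with ⟨k, hk, hPk⟩
  interval_cases k
  · exfalso; apply hp.not_unit; apply isUnit_of_Nm; unfold Nm; rw [hP, hPk]; norm_num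
  · left
    refine ⟨P, ?_, hP, ?_⟩
    · rw [hPk, pow_one]; exact hl
    · rw [hP] at hpo; omega
  · right
    have hD1 : D = 1 := by
      rw [hPk] at hN'
      have : 0 < l ^ 2 := pow_pos hl.pos 2
      exact Nat.eq_of_mul_eq_mul_left this (by linarith)
    have hcu : IsUnit c := by apply isUnit_of_Nm; unfold Nm; rw [hD, hD1]; norm_num
    have hass : Associated p (l:O) := by
      obtain ⟨u, rfl⟩ := hcu
      exact ⟨u, hc.symm⟩
    have hlp : Prime (l:O) := hass.prime hp
    haveI : Fact l.Prime := ⟨hl⟩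
    refine ⟨l, hl, GaussianInt.mod_four_eq_three_of_nat_prime_of_prime l hlp, hlp, ?_, ?_⟩
    · rw [hc]; exact omega_not_dvd_mul ho (omega_not_dvd_unit hcu)
    · obtain ⟨u, rfl⟩ := hcu
      refine ⟨(u⁻¹ : (O)ˣ), Units.isUnit _, ?_⟩
      rw [hc, mul_comm, mul_assoc, Units.mul_inv, mul_one]

theorem chi_neg_one {χ : O → O → ℤ} (hχ : IsQuadSym χ) {n : O} (ho : ¬ ωg ∣ n) : χ (-1) n = 1 := by
  rw [← ig_sq, chi_mul hχ ho]
  apply chi_sq hχ ho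
  exact IsCoprime.of_isCoprime_of_dvd_right (isCoprime_zero_right.2 isUnit_ig) (dvd_zero _)

theorem chi_neg {χ : O → O → ℤ} (hχ : IsQuadSym χ) {n : O} (ho : ¬ ωg ∣ n) (a : O) :
    χ (-a) n = χ a n := by
  have := chi_mul hχ ho (-1) a
  rw [chi_neg_one hχ ho] at this; simpa using this

/-- split-split reciprocity, half formula -/
theorem chi_split_formula {χ : O → O → ℤ} (hχ : IsQuadSym χ) {l : O} {q : ℕ} (hq : q.Prime)
    (hl : Zsqrtd.norm l = q) (hp : Prime l) (ho : ¬ ωg ∣ l) (hq2 : q % 2 = 1) (a : O) :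
    jacobiSym l.im q * χ a l = jacobiSym (a.re * l.im - a.im * l.re) q := by
  rw [← chi_int_split hχ hq hl hp ho hq2, ← chi_int_split hχ hq hl hp ho hq2, ← chi_mul hχ ho]
  apply chi_congr hχ ho
  refine ⟨(a.im : O), ?_⟩
  ext
  · simp; ring
  · simp

theorem gcd_of_prime_norm {l : O} {q : ℕ} (hq : q.Prime) (hl : Zsqrtd.norm l = q) :
    Int.gcd l.re l.im = 1 := by
  by_contra h
  have h1 : ((Int.gcd l.re l.im : ℕ) : ℤ) ∣ l.re := Int.gcd_dvd_left ..
  have h2 : ((Int.gcd l.re l.im : ℕ) : ℤ) ∣ l.im := Int.gcd_dvd_right ..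
  set g := Int.gcd l.re l.im
  have h3 : ((g ^ 2 : ℕ) : ℤ) ∣ (q : ℤ) := by
    rw [← hl, norm_eq']; push_cast
    exact dvd_add (pow_dvd_pow_of_dvd h1 2) (pow_dvd_pow_of_dvd h2 2)
  have h4 : g ^ 2 ∣ q := by exact_mod_cast h3
  rcases (Nat.dvd_prime hq).1 h4 with h5 | h5
  · apply h; nlinarith [Nat.pow_eq_one.1 h5]
  · rw [← h5] at hq; exact Nat.Prime.not_prime_pow (le_refl 2) hq

theorem recip_prime {χ : O → O → ℤ} (hχ : IsQuadSym χ) {a b : O} (ha : Prime a) (hb : Prime b)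
    (sa : Sp a) (sb : Sp b) : χ a b = χ b a := by
  have oa := sa.odd
  have ob := sb.odd
  by_cases hcop : IsCoprime a b
  swap
  · rw [(chi_vals hχ ob a).2 hcop, (chi_vals hχ oa b).2 (fun h => hcop h.symm)]
  have sa' := (Sp_iff a).1 sa
  have sb' := (Sp_iff b).1 sb
  have hinert : ∀ {p : O}, Sp p → ∀ {l : ℕ}, ¬ ωg ∣ (l:O) → ∀ {u : O}, IsUnit u → p = u * l → l % 4 = 3 →
      ∀ n, ¬ ωg ∣ n → χ p n = χ (l:O) n := by
    intro p sp l hlo u hu hpe hl4 n hn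
    have spl : Sp (l:O) := by rw [Sp_iff]; simp; omega
    rcases unit_cases hu with rfl | rfl | rfl | rfl
    · rw [hpe, one_mul]
    · rw [hpe, neg_mul, one_mul, chi_neg hχ hn]
    · rw [hpe] at sp; exact absurd sp (not_Sp_ig_mul spl)
    · rw [hpe] at sp; exact absurd (by simpa using sp.neg) (not_Sp_ig_mul spl)
  have mixed : ∀ {a b : O}, Prime a → Sp a → Sp b → (∃ q : ℕ, q.Prime ∧ Zsqrtd.norm a = q ∧ q % 2 = 1) →
      (∃ l : ℕ, l.Prime ∧ l % 4 = 3 ∧ Prime (l : O) ∧ ¬ ωg ∣ (l:O) ∧ ∃ u : O, IsUnit u ∧ b = u * l) →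
      χ a b = χ b a := by
    rintro a b ha sa sb ⟨q, hq, hqn, hq2⟩ ⟨l, hl, hl4, hlp, hlo, u, hu, hbu⟩
    rw [hinert sb hlo hu hbu hl4 a sa.odd]
    rw [hbu, chi_unit_mul_den hχ hlo hu, chi_inert hχ hl hl4 hlp hlo, hqn]
    have := chi_int_split hχ hq hqn ha sa.odd hq2 (l:ℤ)
    rw [Int.cast_natCast] at this
    rw [this]
    have hq4 : q % 4 = 1 := by
      have sa' := (Sp_iff a).1 sa
      have h1 : (q:ℤ) = a.re ^ 2 + a.im ^ 2 := by rw [← hqn, norm_eq']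
      obtain ⟨⟨c, hc⟩, ⟨d, hd⟩⟩ := sa'
      have : (q:ℤ) = 4 * (c * c + c + d * d) + 1 := by
        rw [h1, hd, show a.re = 2 * c + 1 by linarith]; ring
      omega
    exact jacobiSym.quadratic_reciprocity_one_mod_four hq4 (Nat.odd_iff.2 (by omega))
  rcases prime_class ha oa with hA | hA <;> rcases prime_class hb ob with hB | hB
  · obtain ⟨p, hpp, hpn, hp2⟩ := hA
    obtain ⟨q, hqp, hqn, hq2⟩ := hB
    have f1 := chi_split_formula hχ hqp hqn hb ob hq2 a
    have f2 := chi_split_formula hχ hpp hpn ha oa hp2 b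
    have hpe : (p:ℤ) = a.re ^ 2 + a.im ^ 2 := by rw [← hpn, norm_eq']
    have hqe : (q:ℤ) = b.re ^ 2 + b.im ^ 2 := by rw [← hqn, norm_eq']
    have hp4 : p % 4 = 1 := by
      obtain ⟨⟨c, hc⟩, ⟨d, hd⟩⟩ := sa'
      have : (p:ℤ) = 4 * (c * c + c + d * d) + 1 := by
        rw [hpe, hd, show a.re = 2 * c + 1 by linarith]; ring
      omega
    have g1 := jac_sum_sq b.re b.im q hqe (by omega) (by omega) (gcd_of_prime_norm hqp hqn)
    have g2 := jac_sum_sq a.re a.im p hpe (by omega) (by omega) (gcd_of_prime_norm hpp hpn)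
    set y := a.re * b.im - a.im * b.re with hy
    set x := a.re * b.re + a.im * b.im with hx
    have hyneg : b.re * a.im - b.im * a.re = -y := by rw [hy]; ring
    rw [hyneg, jacobiSym.neg _ (Nat.odd_iff.2 hp2), ZMod.χ₄_nat_one_mod_four hp4, one_mul] at f2
    have hpq : ((p * q : ℕ) : ℤ) = x ^ 2 + y ^ 2 := by
      push_cast; rw [hpe, hqe, hx, hy]; ring
    have c1 : χ a b ≠ 0 := (chi_ne_zero_iff hχ ob).2 hcop
    have c2 : χ b a ≠ 0 := (chi_ne_zero_iff hχ oa).2 hcop.symm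
    have hyodd : x % 2 = 1 ∧ y % 2 = 0 := by
      obtain ⟨⟨c, hc⟩, ⟨d, hd⟩⟩ := sa'
      obtain ⟨⟨c', hc'⟩, ⟨d', hd'⟩⟩ := sb'
      constructor
      · have : x = 2 * (2 * c * c' + c + c' + 2 * d * d') + 1 := by
          rw [hx, hd, hd', show a.re = 2 * c + 1 by linarith, show b.re = 2 * c' + 1 by linarith]; ring
        omega
      · have : y = 2 * (a.re * d' - d * b.re) := by rw [hy, hd, hd']; ring
        omega
    have hy4 : ((4:ℤ) ∣ y) ↔ ((4:ℤ) ∣ a.im ↔ (4:ℤ) ∣ b.im) := by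
      obtain ⟨⟨c, hc⟩, ⟨d, hd⟩⟩ := sa'
      obtain ⟨⟨c', hc'⟩, ⟨d', hd'⟩⟩ := sb'
      have : y = 2 * (d' - d) + 4 * (c * d' - d * c') := by
        rw [hy, hd, hd', show a.re = 2 * c + 1 by linarith, show b.re = 2 * c' + 1 by linarith]; ring
      rw [this, hd, hd']
      omega
    have s1 : jacobiSym b.im q = 1 ∨ jacobiSym b.im q = -1 := by rw [g1]; split_ifs <;> simp
    have s2 : jacobiSym a.im p = 1 ∨ jacobiSym a.im p = -1 := by rw [g2]; split_ifs <;> simp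
    have d1 : jacobiSym y q ≠ 0 := by
      rw [← f1]; rcases s1 with h | h <;> rw [h] <;> simpa using c1
    have d2 : jacobiSym y p ≠ 0 := by
      rw [← f2]; rcases s2 with h | h <;> rw [h] <;> simpa using c2
    have hgy : Int.gcd y ((p * q : ℕ):ℤ) = 1 := by
      have hz : jacobiSym y (p * q) ≠ 0 := by
        rw [jacobiSym.mul_right' _ hpp.ne_zero hqp.ne_zero]; exact mul_ne_zero d2 d1
      by_contra h
      exact hz (jacobiSym.eq_zero_iff.2 ⟨mul_ne_zero hpp.ne_zero hqp.ne_zero, h⟩)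
    have hgxy : Int.gcd x y = 1 := by
      have h1 : ((Int.gcd x y : ℕ) : ℤ) ∣ x := Int.gcd_dvd_left ..
      have h2 : ((Int.gcd x y : ℕ) : ℤ) ∣ y := Int.gcd_dvd_right ..
      have h3 : ((Int.gcd x y : ℕ) : ℤ) ∣ ((p * q : ℕ):ℤ) := by
        rw [hpq, pow_two, pow_two]; exact dvd_add (Dvd.dvd.mul_right h1 _) (Dvd.dvd.mul_right h2 _)
      have h4 := Int.dvd_coe_gcd h2 h3
      rw [hgy] at h4
      exact Nat.dvd_one.1 (by exact_mod_cast h4)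
    have g3 := jac_sum_sq x y (p * q) hpq hyodd.1 hyodd.2 hgxy
    rw [jacobiSym.mul_right' _ hpp.ne_zero hqp.ne_zero, ← f1, ← f2, g1, g2] at g3
    have hprod : χ a b * χ b a = 1 := by
      by_cases e1 : (4:ℤ) ∣ a.im <;> by_cases e2 : (4:ℤ) ∣ b.im <;> simp [hy4, e1, e2] at g3 <;> linarith
    rcases (chi_vals hχ ob a).1 hcop with h | h <;> rw [h] at hprod ⊢ <;> linarith
  · exact mixed ha sa sb hA hB
  · exact (mixed hb sb sa hB hA).symm
  · obtain ⟨l, hl, hl4, hlp, hlo, u, hu, hau⟩ := hA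
    obtain ⟨k, hk, hk4, hkp, hko, v, hv, hbv⟩ := hB
    rw [hinert sa hlo hu hau hl4 b ob, hinert sb hko hv hbv hk4 a oa]
    rw [hau, hbv, chi_unit_mul_den hχ hlo hu, chi_unit_mul_den hχ hko hv,
      chi_inert hχ hk hk4 hkp hko, chi_inert hχ hl hl4 hlp hlo, Zsqrtd.norm_natCast,
      Zsqrtd.norm_natCast]
    have hne : l ≠ k := by
      rintro rfl
      rw [hau, hbv] at hcop
      exact hlp.not_unit (hcop.isUnit_of_dvd' (dvd_mul_left _ _) (dvd_mul_left _ _))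
    have hg1 : Int.gcd (l:ℤ) (k:ℤ) = 1 := by
      rw [Int.gcd_natCast_natCast]; exact (Nat.coprime_primes hl hk).2 hne
    have hg2 : Int.gcd (k:ℤ) (l:ℤ) = 1 := by rw [Int.gcd_comm]; exact hg1
    rw [← pow_two, ← pow_two, jacobiSym.sq_one' hg1, jacobiSym.sq_one' hg2]


theorem Sp_unit {u : O} (hu : IsUnit u) (h : Sp u) : u = 1 ∨ u = -1 := by
  rcases unit_cases hu with rfl | rfl | rfl | rfl
  · left; rfl
  · right; rfl
  · exfalso; have := not_Sp_ig_mul Sp_one; simp at this; exact this h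
  · exfalso; have := not_Sp_ig_mul Sp_one.neg; simp at this; exact this h

theorem exists_unit_Sp {n : O} (h : ¬ ωg ∣ n) : ∃ u, IsUnit u ∧ Sp (u * n) := by
  rcases Sp_or n h with h | h
  · exact ⟨1, isUnit_one, by simpa using h⟩
  · exact ⟨ig, isUnit_ig, h⟩

theorem Sp_induction {P : O → Prop} (h1 : P 1) (hn1 : P (-1))
    (hm : ∀ p n, Prime p → Sp p → Sp n → P n → P (p * n)) : ∀ n, Sp n → P n := by
  have key : ∀ n, ¬ ωg ∣ n → ∀ u, IsUnit u → Sp (u * n) → P (u * n) := by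
    refine odd_induction (P := fun n => ∀ u, IsUnit u → Sp (u * n) → P (u * n)) ?_ ?_
    · intro v hv u hu hs
      rcases Sp_unit (hu.mul hv) hs with h | h <;> rw [h] <;> assumption
    · intro p n hp hpo hno ih u hu hs
      obtain ⟨v, hv, hvs⟩ := exists_unit_Sp hpo
      obtain ⟨v, rfl⟩ := hv
      have e : u * (p * n) = (v * p) * ((u * ((v⁻¹ : (O)ˣ) : O)) * n) := by
        have : (v:O) * ((v⁻¹ : (O)ˣ) : O) = 1 := Units.mul_inv v
        linear_combination (-(u * p * n)) * this
      rw [e] at hs ⊢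
      have h2 := Sp.of_mul_left hvs hs
      refine hm _ _ ?_ hvs h2 (ih _ (hu.mul (Units.isUnit _)) h2)
      exact (associated_unit_mul_right p _ v.isUnit).prime hp
  intro n hn
  have := key n hn.odd 1 isUnit_one (by simpa using hn)
  simpa using this

theorem recip {χ : O → O → ℤ} (hχ : IsQuadSym χ) {a b : O} (sa : Sp a) (sb : Sp b) :
    χ a b = χ b a := by
  have key : ∀ a, Prime a → Sp a → ∀ b, Sp b → χ a b = χ b a := by
    intro a ha sa
    apply Sp_induction
    · rw [hχ.unit_den _ _ isUnit_one, chi_one hχ sa.odd]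
    · rw [hχ.unit_den _ _ isUnit_one.neg, chi_neg_one hχ sa.odd]
    · intro p n hp sp sn ih
      rw [hχ.mul_den _ _ _ sp.odd sn.odd, chi_mul hχ sa.odd, ih, recip_prime hχ ha hp sa sp]
  revert b
  refine Sp_induction (P := fun a => ∀ {b : O}, Sp b → χ a b = χ b a) ?_ ?_ ?_ a sa
  · intro b sb; rw [hχ.unit_den _ _ isUnit_one, chi_one hχ sb.odd]
  · intro b sb; rw [hχ.unit_den _ _ isUnit_one.neg, chi_neg_one hχ sb.odd]
  · intro p n hp sp sn ih b sb
    rw [hχ.mul_den _ _ _ sp.odd sn.odd, chi_mul hχ sb.odd, ih sb, key p hp sp b sb]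

theorem norm_odd_mod {n : O} (h : ¬ ωg ∣ n) : (Zsqrtd.norm n) % 4 = 1 := by
  rw [omega_dvd_iff] at h
  rw [norm_eq']
  have : (n.re % 4 = 0 ∨ n.re % 4 = 2) ∧ (n.im % 4 = 1 ∨ n.im % 4 = 3) ∨
    (n.re % 4 = 1 ∨ n.re % 4 = 3) ∧ (n.im % 4 = 0 ∨ n.im % 4 = 2) := by omega
  rcases this with ⟨h1 | h1, h2 | h2⟩ | ⟨h1 | h1, h2 | h2⟩ <;>
    simp [pow_two, Int.add_emod, Int.mul_emod, h1, h2]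

theorem chi_ig {χ : O → O → ℤ} (hχ : IsQuadSym χ) {n : O} (ho : ¬ ωg ∣ n) :
    χ ig n = if (Zsqrtd.norm n) % 8 = 1 then 1 else -1 := by
  refine odd_induction (P := fun n => χ ig n = if (Zsqrtd.norm n) % 8 = 1 then 1 else -1) ?_ ?_ n ho
  · intro u hu
    have h1 := Nm_unit hu
    unfold Nm at h1
    have h2 : Zsqrtd.norm u = 1 := by exact_mod_cast h1
    rw [hχ.unit_den _ _ hu, h2]; norm_num
  · intro p n hp hpo hno ih
    have hpi : χ ig p = if (Zsqrtd.norm p) % 8 = 1 then 1 else -1 := by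
      have h4 := norm_odd_mod hpo
      have h0 := GaussianInt.norm_nonneg p
      have hnd : ¬ p ∣ ig := fun h => hp.not_unit (isUnit_of_dvd_unit h isUnit_ig)
      apply chi_prime_unique hχ hp hpo hnd
      · split_ifs <;> simp
      · obtain ⟨k, hk⟩ : ∃ k : ℕ, Zsqrtd.norm p = 4 * k + 1 :=
          ⟨((Zsqrtd.norm p) / 4).toNat, by omega⟩
        have e1 : ((Zsqrtd.norm p).toNat - 1) / 2 = 2 * k := by omega
        rw [e1, pow_mul, pow_two, ig_sq]
        have : (-1 : O) ^ k = ((if (Zsqrtd.norm p) % 8 = 1 then 1 else -1 : ℤ) : O) := by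
          rcases Nat.even_or_odd k with h | h
          · rw [h.neg_one_pow, if_pos (by obtain ⟨j, hj⟩ := h; omega)]; simp
          · rw [h.neg_one_pow, if_neg (by obtain ⟨j, hj⟩ := h; omega)]; simp
        rw [this, sub_self]; exact dvd_zero _
    rw [hχ.mul_den _ _ _ hpo hno, ih, hpi, Zsqrtd.norm_mul]
    have h1 := norm_odd_mod hpo
    have h2 := norm_odd_mod hno
    have a1 : (Zsqrtd.norm p) % 8 = 1 ∨ (Zsqrtd.norm p) % 8 = 5 := by omega
    have a2 : (Zsqrtd.norm n) % 8 = 1 ∨ (Zsqrtd.norm n) % 8 = 5 := by omega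
    rcases a1 with a1 | a1 <;> rcases a2 with a2 | a2 <;> simp [Int.mul_emod, a1, a2]

theorem norm_mod8_congr {a b : O} (h : (4:O) ∣ a - b) : (Zsqrtd.norm a) % 8 = (Zsqrtd.norm b) % 8 := by
  obtain ⟨c, hc⟩ := h
  have ha : a = b + 4 * c := by linear_combination hc
  have h4 : ((4:O).re = 4) ∧ ((4:O).im = 0) := ⟨rfl, rfl⟩
  have : Zsqrtd.norm a = Zsqrtd.norm b + 8 * (b.re * c.re + b.im * c.im + 2 * c.re^2 + 2 * c.im ^ 2) := by
    rw [ha, norm_eq', norm_eq']; simp [h4.1, h4.2]; ring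
  omega

theorem chi_ig_congr {χ : O → O → ℤ} (hχ : IsQuadSym χ) {a b : O} (ha : ¬ ωg ∣ a) (hb : ¬ ωg ∣ b)
    (h : (4:O) ∣ a - b) : χ ig a = χ ig b := by
  rw [chi_ig hχ ha, chi_ig hχ hb, norm_mod8_congr h]


/-! ### Part C: finite Fourier analysis modulo `q` -/

/-- residue ring -/
abbrev RQ (q : O) := O ⧸ Ideal.span {q}

instance instFintypeRQ (q : O) [h : NeZero q] : Fintype (RQ q) :=
  haveI := finite_quot h.out
  Fintype.ofFinite _

/-- quotient map -/
def mkq (q : O) (x : O) : RQ q := Ideal.Quotient.mk (Ideal.span {q}) x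

/-- representative -/
def ot {q : O} (x : RQ q) : O := Quotient.out x

theorem mkq_ot {q : O} (x : RQ q) : mkq q (ot x) = x := Quotient.out_eq x

theorem mkq_eq {q : O} {a b : O} : mkq q a = mkq q b ↔ q ∣ a - b := by
  unfold mkq; rw [Ideal.Quotient.eq, Ideal.mem_span_singleton]

/-- periodicity mod `q` -/
def Per (q : O) (G : O → ℂ) : Prop := ∀ a b, q ∣ a - b → G a = G b

theorem Per.ot {q : O} {G : O → ℂ} (h : Per q G) (x : O) : G (SMQ.ot (mkq q x)) = G x := by
  apply h; rw [← mkq_eq, mkq_ot]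

theorem Per.mul {q : O} {G H : O → ℂ} (h : Per q G) (h' : Per q H) : Per q (fun x => G x * H x) :=
  fun a b hab => by simp only [h a b hab, h' a b hab]

theorem Per.comp_mul {q : O} {G : O → ℂ} (h : Per q G) (u : O) : Per q (fun x => G (u * x)) :=
  fun a b hab => h _ _ (by rw [← mul_sub]; exact Dvd.dvd.mul_left hab u)

theorem Per.of_dvd {q q' : O} {G : O → ℂ} (h : Per q G) (hd : q ∣ q') : Per q' G :=
  fun a b hab => h _ _ (hd.trans hab)

theorem card_RQ (q : O) [NeZero q] : (Fintype.card (RQ q) : ℝ) = Nm q := by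
  rw [← card_quot, Nat.card_eq_fintype_card]

/-- `e(z) = exp(2πi Re z)` -/
def ef (z : ℂ) : ℂ := Complex.exp (2 * π * I * (z.re : ℂ))

theorem ef_add (a b : ℂ) : ef (a + b) = ef a * ef b := by
  unfold ef; rw [← Complex.exp_add]; congr 1; simp; ring

theorem norm_ef (a : ℂ) : ‖ef a‖ = 1 := by
  unfold ef
  rw [show (2 * π * I * (a.re : ℂ) : ℂ) = ((2 * π * a.re : ℝ) : ℂ) * I by push_cast; ring]
  exact Complex.norm_exp_ofReal_mul_I _

theorem ef_ne_zero (a : ℂ) : ef a ≠ 0 := by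
  intro h; have := norm_ef a; rw [h] at this; simp at this

theorem ef_int (n : O) : ef (GaussianInt.toComplex n) = 1 := by
  unfold ef
  rw [← GaussianInt.intCast_re]
  rw [show (2 * π * I * ((n.re : ℝ) : ℂ) : ℂ) = (n.re : ℂ) * (2 * π * I) by push_cast; ring]
  exact Complex.exp_int_mul_two_pi_mul_I _

theorem ef_eq_one {z : ℂ} (h : ef z = 1) : ∃ n : ℤ, z.re = n := by
  unfold ef at h
  rw [Complex.exp_eq_one_iff] at h
  obtain ⟨n, hn⟩ := h
  refine ⟨n, ?_⟩
  have h2 : (2 * π * I : ℂ) ≠ 0 := Complex.two_pi_I_ne_zero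
  have : (z.re : ℂ) = n := by
    apply mul_left_cancel₀ h2; rw [hn]; ring
  exact_mod_cast this

theorem ef_conj (z : ℂ) : (starRingEnd ℂ) (ef z) = ef (-z) := by
  unfold ef; rw [← Complex.exp_conj]; congr 1; simp [Complex.conj_ofNat]

theorem toC_ne_zero {q : O} (hq : q ≠ 0) : GaussianInt.toComplex q ≠ 0 := by
  rwa [Ne, GaussianInt.toComplex_eq_zero]

/-- additive character `x ↦ e(kx/q)` -/
def psi (q k x : O) : ℂ := ef (GaussianInt.toComplex (k * x) / GaussianInt.toComplex q)

theorem psi_add (q k x y : O) : psi q k (x + y) = psi q k x * psi q k y := by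
  unfold psi; rw [← ef_add]; congr 1; rw [mul_add, map_add, add_div]

theorem psi_symm (q k x : O) : psi q k x = psi q x k := by
  unfold psi; rw [mul_comm]

theorem psi_mul (q k u x : O) : psi q k (u * x) = psi q (k * u) x := by
  unfold psi; rw [mul_assoc]

theorem norm_psi (q k x : O) : ‖psi q k x‖ = 1 := norm_ef _

theorem psi_zero_of_dvd {q k x : O} (hq : q ≠ 0) (h : q ∣ k * x) : psi q k x = 1 := by
  obtain ⟨c, hc⟩ := h
  unfold psi
  rw [hc, map_mul, mul_div_cancel_left₀ _ (toC_ne_zero hq), ef_int]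

theorem psi_per {q : O} (hq : q ≠ 0) (k : O) : Per q (psi q k) := by
  intro a b h
  have : a = b + (a - b) := by ring
  rw [this, psi_add, psi_zero_of_dvd hq (Dvd.dvd.mul_left h k), mul_one]

theorem psi_conj (q k x : O) : (starRingEnd ℂ) (psi q k x) = psi q k (-x) := by
  unfold psi; rw [ef_conj]; congr 1; rw [mul_neg, map_neg, neg_div]

theorem exists_psi_ne_one {q k : O} (hq : q ≠ 0) (h : ¬ q ∣ k) : ∃ y, psi q k y ≠ 1 := by
  by_contra hcon
  push Not at hcon
  apply h
  obtain ⟨a, ha⟩ := ef_eq_one (hcon 1)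
  obtain ⟨b, hb⟩ := ef_eq_one (hcon (-ig))
  refine ⟨⟨a, b⟩, ?_⟩
  rw [← GaussianInt.toComplex_inj]
  rw [map_mul]
  have hq' := toC_ne_zero hq
  have key : GaussianInt.toComplex k / GaussianInt.toComplex q = GaussianInt.toComplex ⟨a, b⟩ := by
    apply Complex.ext
    · rw [mul_one] at ha; rw [ha]; simp
    · have e : GaussianInt.toComplex (k * -ig) / GaussianInt.toComplex q
          = -I * (GaussianInt.toComplex k / GaussianInt.toComplex q) := by
        have : GaussianInt.toComplex (-ig) = -I := by
          rw [map_neg]; simp [ig, GaussianInt.toComplex_def']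
        rw [map_mul, this]; ring
      rw [e] at hb
      simp only [neg_mul, neg_re, Complex.mul_re, I_re, I_im] at hb
      have : (GaussianInt.toComplex (⟨a, b⟩ : O)).im = b := by simp
      rw [this]; linarith
  rw [← key, mul_div_cancel₀ _ hq']

/-- summation of a periodic function is translation invariant -/
theorem sum_translate {q : O} [NeZero q] {G : O → ℂ} (hG : Per q G) (y : O) :
    ∑ x : RQ q, G (ot x + y) = ∑ x : RQ q, G (ot x) := by
  rw [← Equiv.sum_comp (Equiv.addRight (mkq q y)) (fun x => G (ot x))]
  apply Finset.sum_congr rfl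
  intro x _
  apply hG
  rw [← mkq_eq]
  simp only [Equiv.coe_addRight, mkq_ot]
  conv_rhs => rw [← mkq_ot x]
  unfold mkq; rw [map_add]

theorem sum_dilate {q : O} [NeZero q] {G : O → ℂ} (hG : Per q G) {u : O} (hu : IsCoprime u q) :
    ∑ x : RQ q, G (u * ot x) = ∑ x : RQ q, G (ot x) := by
  obtain ⟨v, w, hv⟩ := hu
  have hvu : mkq q u * mkq q v = 1 := by
    have : mkq q u * mkq q v = mkq q (u * v) := by unfold mkq; rw [map_mul]
    rw [this]; have h1 : (1 : RQ q) = mkq q 1 := by unfold mkq; rw [map_one]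
    rw [h1, mkq_eq]; exact ⟨-w, by linear_combination hv⟩
  let U : (RQ q)ˣ := ⟨mkq q u, mkq q v, hvu, by rw [mul_comm]; exact hvu⟩
  rw [← Equiv.sum_comp (Units.mulLeft U) (fun x => G (ot x))]
  apply Finset.sum_congr rfl
  intro x _
  apply hG
  rw [← mkq_eq]
  simp only [Units.mulLeft_apply, mkq_ot]
  conv_rhs => rw [← mkq_ot x]
  show _ = mkq q u * _
  unfold mkq; rw [map_mul]

theorem sum_psi {q : O} [NeZero q] (k : O) :
    ∑ x : RQ q, psi q k (ot x) = if q ∣ k then (Nm q : ℂ) else 0 := by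
  have hq : q ≠ 0 := NeZero.ne q
  split_ifs with h
  · rw [Finset.sum_congr rfl (fun x _ => psi_zero_of_dvd hq (Dvd.dvd.mul_right h _))]
    rw [Finset.sum_const, Finset.card_univ, nsmul_eq_mul, mul_one, ← card_RQ q]; push_cast; rfl
  · obtain ⟨y, hy⟩ := exists_psi_ne_one hq h
    have h1 := sum_translate (psi_per hq k) y
    simp_rw [psi_add] at h1
    rw [← Finset.sum_mul] at h1
    have : (∑ x : RQ q, psi q k (ot x)) * (psi q k y - 1) = 0 := by linear_combination h1
    rcases mul_eq_zero.1 this with h | h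
    · exact h
    · exact absurd (sub_eq_zero.1 h) hy

/-- finite Fourier transform -/
def ft (q : O) [NeZero q] (F : O → ℂ) (k : O) : ℂ := ∑ x : RQ q, F (ot x) * psi q k (ot x)

theorem ft_per (q : O) [NeZero q] (F : O → ℂ) : Per q (ft q F) := by
  intro a b h
  unfold ft
  apply Finset.sum_congr rfl
  intro x _
  rw [psi_symm q a, psi_symm q b, psi_per (NeZero.ne q) (ot x) a b h]

theorem parseval (q : O) [NeZero q] (F : O → ℂ) :
    ∑ k : RQ q, ft q F (ot k) * (starRingEnd ℂ) (ft q F (ot k)) =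
      (Nm q : ℂ) * ∑ x : RQ q, F (ot x) * (starRingEnd ℂ) (F (ot x)) := by
  have e : ∀ k : RQ q, ft q F (ot k) * (starRingEnd ℂ) (ft q F (ot k)) =
      ∑ x : RQ q, ∑ y : RQ q, F (ot x) * (starRingEnd ℂ) (F (ot y)) * psi q (ot x - ot y) (ot k) := by
    intro k
    unfold ft
    rw [map_sum, Finset.sum_mul_sum]
    apply Finset.sum_congr rfl; intro x _
    apply Finset.sum_congr rfl; intro y _
    rw [map_mul, psi_conj, psi_symm q (ot x - ot y), sub_eq_add_neg, psi_add]; ring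
  rw [Finset.sum_congr rfl (fun k _ => e k), Finset.sum_comm, Finset.mul_sum]
  apply Finset.sum_congr rfl; intro x _
  rw [Finset.sum_comm]
  simp_rw [← Finset.mul_sum, sum_psi]
  rw [Finset.sum_eq_single x]
  · rw [sub_self, if_pos (dvd_zero _)]; ring
  · intro y _ hy
    rw [if_neg, mul_zero]
    intro h; apply hy; rw [← mkq_eq, mkq_ot, mkq_ot] at h; exact h.symm
  · intro h; exact absurd (Finset.mem_univ _) h

theorem chi_per {χ : O → O → ℤ} (hχ : IsQuadSym χ) {q : O} (ho : ¬ ωg ∣ q) :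
    Per q (fun x => (χ x q : ℂ)) := fun a b h => by simp only [chi_congr hχ ho h]

/-- the quadratic Gauss sum -/
def gs (χ : O → O → ℤ) (q : O) [NeZero q] : ℂ := ft q (fun x => (χ x q : ℂ)) 1

theorem ft_chi {χ : O → O → ℤ} (hχ : IsQuadSym χ) {q : O} [NeZero q] (ho : ¬ ωg ∣ q)
    (hsf : Squarefree q) (k : O) : ft q (fun x => (χ x q : ℂ)) k = gs χ q * (χ k q : ℂ) := by
  have hq : q ≠ 0 := NeZero.ne q
  have main : ∀ u k' : O, IsCoprime u q → q ∣ k * u - k' →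
      ft q (fun x => (χ x q : ℂ)) k = (χ u q : ℂ) * ft q (fun x => (χ x q : ℂ)) k' := by
    intro u k' hu hk
    unfold ft
    rw [← sum_dilate ((chi_per hχ ho).mul (psi_per hq k)) hu, Finset.mul_sum]
    apply Finset.sum_congr rfl; intro x _
    rw [chi_mul hχ ho, psi_mul, psi_symm q (k * u), psi_symm q k', psi_per hq (ot x) _ _ hk]
    push_cast; ring
  by_cases hk : IsCoprime k q
  · obtain ⟨v, w, hv⟩ := hk
    have hvc : IsCoprime v q := ⟨k, w, by linear_combination hv⟩
    have h1 := main v 1 hvc ⟨-w, by linear_combination hv⟩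
    have h2 : χ v q = χ k q := by
      have h3 : χ (v * k) q = 1 := by
        refine Eq.trans ?_ (chi_one hχ ho); apply chi_congr hχ ho; exact ⟨-w, by linear_combination hv⟩
      rw [chi_mul hχ ho] at h3
      rcases (chi_vals hχ ho k).1 ⟨v, w, hv⟩ with h | h <;> rw [h] at h3 ⊢ <;> linarith
    rw [h1, h2, gs, mul_comm]
  · rw [(chi_vals hχ ho k).2 hk]
    obtain ⟨p, hp, hpk, hpq⟩ : ∃ p, Prime p ∧ p ∣ k ∧ p ∣ q := by
      by_contra hcon
      push Not at hcon
      exact hk (isCoprime_of_prime_dvd (fun h => hq h.2) (fun p hp h1 h2 => hcon p hp h1 h2))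
    obtain ⟨q', rfl⟩ := hpq
    have hpo := omega_not_dvd_of_mul_left ho
    have hqo := omega_not_dvd_of_mul_right ho
    have hcop : IsCoprime p q' := by
      rw [hp.irreducible.coprime_iff_not_dvd]
      rintro ⟨c, rfl⟩
      exact hp.not_unit (hsf p ⟨c, by ring⟩)
    obtain ⟨a, ha⟩ := exists_nonresidue hχ hp hpo
    obtain ⟨r, s, hrs⟩ := hcop
    -- r p + s q' = 1 ; x0 = a s q' + r p
    set x0 := a * (s * q') + r * p with hx0
    have e1 : χ x0 p = -1 := by
      rw [← ha]; apply chi_congr hχ hpo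
      exact ⟨r - a * r, by rw [hx0]; linear_combination a * hrs⟩
    have e2 : χ x0 q' = 1 := by
      refine Eq.trans ?_ (chi_one hχ hqo); apply chi_congr hχ hqo
      exact ⟨a * s - s, by rw [hx0]; linear_combination hrs⟩
    have e3 : χ x0 (p * q') = -1 := by rw [hχ.mul_den _ _ _ hpo hqo, e1, e2]; norm_num
    have hx0c : IsCoprime x0 (p * q') := by
      rw [← chi_ne_zero_iff hχ ho, e3]; norm_num
    obtain ⟨k1, rfl⟩ := hpk
    have h1 := main x0 (p * k1) hx0c ⟨k1 * (a * s - s), by rw [hx0]; linear_combination (p * k1) * hrs⟩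
    rw [e3] at h1
    push_cast at h1 ⊢
    rw [mul_zero]
    have : (2:ℂ) * ft (p * q') (fun x => (χ x (p * q') : ℂ)) (p * k1) = 0 := by
      linear_combination h1
    simpa using this

theorem norm_gs {χ : O → O → ℤ} (hχ : IsQuadSym χ) {q : O} [NeZero q] (ho : ¬ ωg ∣ q)
    (hsf : Squarefree q) : ‖gs χ q‖ ^ 2 = Nm q := by
  have h := parseval q (fun x => (χ x q : ℂ))
  simp_rw [ft_chi hχ ho hsf, map_mul] at h
  have e : ∀ k : RQ q, gs χ q * (χ (ot k) q : ℂ) * ((starRingEnd ℂ) (gs χ q) *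
      (starRingEnd ℂ) (χ (ot k) q : ℂ)) = (gs χ q * (starRingEnd ℂ) (gs χ q)) *
      ((χ (ot k) q : ℂ) * (starRingEnd ℂ) (χ (ot k) q : ℂ)) := by intro k; ring
  rw [Finset.sum_congr rfl (fun k _ => e k), ← Finset.mul_sum] at h
  have hne : ∑ x : RQ q, (χ (ot x) q : ℂ) * (starRingEnd ℂ) (χ (ot x) q : ℂ) ≠ 0 := by
    have e2 : ∑ x : RQ q, (χ (ot x) q : ℂ) * (starRingEnd ℂ) (χ (ot x) q : ℂ)
        = ((∑ x : RQ q, (χ (ot x) q) ^ 2 : ℤ) : ℂ) := by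
      push_cast
      apply Finset.sum_congr rfl; intro x _
      rw [map_intCast]; ring
    rw [e2]
    have : 0 < ∑ x : RQ q, (χ (ot x) q) ^ 2 := by
      apply Finset.sum_pos' (fun x _ => sq_nonneg _)
      refine ⟨mkq q 1, Finset.mem_univ _, ?_⟩
      have : χ (ot (mkq q 1)) q = 1 := by
        refine Eq.trans ?_ (chi_one hχ ho); apply chi_congr hχ ho; rw [← mkq_eq, mkq_ot]
      rw [this]; norm_num
    exact_mod_cast this.ne'
  have h2 := mul_right_cancel₀ hne h
  rw [Complex.mul_conj, Complex.normSq_eq_norm_sq] at h2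
  exact_mod_cast h2


instance instNeZeroFour : NeZero (4:O) := ⟨by
  intro h; have := congrArg Zsqrtd.re h; revert this; decide⟩

instance instNeZeroMul (a b : O) [NeZero a] [NeZero b] : NeZero (a * b) :=
  ⟨mul_ne_zero (NeZero.ne a) (NeZero.ne b)⟩

theorem ft_crt {χ : O → O → ℤ} (hχ : IsQuadSym χ) {m0 : O} [NeZero m0] (ho : ¬ ωg ∣ m0)
    (hsf : Squarefree m0) {h : O → ℂ} (hh : Per 4 h) (k : O) :
    ft (4 * m0) (fun x => h x * (χ x m0 : ℂ)) k =
      (∑ b : RQ (4:O), h (m0 * ot b) * psi 4 k (ot b)) * (gs χ m0 * (χ k m0 : ℂ)) := by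
  have hm0 : m0 ≠ 0 := NeZero.ne m0
  have h40 : (4:O) ≠ 0 := NeZero.ne _
  have hq : (4 * m0 : O) ≠ 0 := NeZero.ne _
  have c2 : IsCoprime m0 2 := (odd_iff_coprime_two m0).2 ho
  have c4 : IsCoprime m0 4 := by
    have : (4:O) = 2 * 2 := by norm_num
    rw [this]; exact c2.mul_right c2
  rw [← ft_chi hχ ho hsf]
  unfold ft
  let f : RQ (4:O) × RQ m0 → RQ (4 * m0) := fun p => mkq _ (m0 * ot p.1 + 4 * ot p.2)
  have hf : Function.Bijective f := by
    rw [Fintype.bijective_iff_injective_and_card]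
    constructor
    · rintro ⟨a, b⟩ ⟨a', b'⟩ hab
      have hab' := mkq_eq.1 hab
      simp only at hab'
      have e : m0 * ot a + 4 * ot b - (m0 * ot a' + 4 * ot b') =
        m0 * (ot a - ot a') + 4 * (ot b - ot b') := by ring
      rw [e] at hab'
      have h1 : (4:O) ∣ ot a - ot a' := by
        apply c4.symm.dvd_of_dvd_mul_left
        have := dvd_sub ((dvd_mul_right (4:O) m0).trans hab') (dvd_mul_right (4:O) (ot b - ot b'))
        simpa using this
      have h2 : m0 ∣ ot b - ot b' := by
        apply c4.dvd_of_dvd_mul_left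
        have := dvd_sub ((dvd_mul_left m0 (4:O)).trans hab') (dvd_mul_right m0 (ot a - ot a'))
        simpa using this
      rw [← mkq_eq, mkq_ot, mkq_ot] at h1 h2
      rw [h1, h2]
    · have h1 := card_RQ (4:O)
      have h2 := card_RQ m0
      have h3 := card_RQ (4 * m0)
      rw [Nm_mul, ← h1, ← h2] at h3
      rw [Fintype.card_prod]
      exact_mod_cast h3.symm
  have hper : Per (4 * m0) (fun x => h x * (χ x m0 : ℂ) * psi (4 * m0) k x) :=
    ((hh.of_dvd (dvd_mul_right _ _)).mul ((chi_per hχ ho).of_dvd (dvd_mul_left _ _))).mul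
      (psi_per hq k)
  rw [← Function.Bijective.sum_comp hf (fun x => h (ot x) * (χ (ot x) m0 : ℂ) * psi (4 * m0) k (ot x)),
    Fintype.sum_prod_type, Finset.sum_mul_sum]
  apply Finset.sum_congr rfl; intro b _
  apply Finset.sum_congr rfl; intro a _
  have := hper.ot (m0 * ot b + 4 * ot a)
  rw [this]
  have e1 : h (m0 * ot b + 4 * ot a) = h (m0 * ot b) := hh _ _ ⟨ot a, by ring⟩
  have e2 : χ (m0 * ot b + 4 * ot a) m0 = χ (ot a) m0 := by
    rw [chi_congr hχ ho (b := 4 * ot a) ⟨ot b, by ring⟩, chi_mul hχ ho]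
    have : (4:O) = 2 * 2 := by norm_num
    rw [this, chi_mul hχ ho, chi_sq hχ ho c2.symm, one_mul]
  have e3 : psi (4 * m0) k (m0 * ot b + 4 * ot a) = psi 4 k (ot b) * psi m0 k (ot a) := by
    rw [psi_add]
    have t1 := toC_ne_zero hm0
    have t2 := toC_ne_zero h40
    unfold psi
    congr 2
    · simp only [map_mul]; field_simp
    · simp only [map_mul]; field_simp
  rw [e1, e2, e3]; ring

/-! ### Part D: Poisson summation -/

theorem summable_gauss {c : ℝ} (hc : 0 < c) : Summable (fun n : O => Real.exp (-c * Nm n)) := by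
  have h := (summable_Nm_rpow (σ := 2) (by norm_num)).mul_left (2 / c ^ 2)
  refine Summable.of_norm_bounded_eventually h ?_
  have : ({0} : Set O).Finite := Set.finite_singleton 0
  filter_upwards [this.compl_mem_cofinite] with n hn
  have hn0 : n ≠ 0 := by simpa using hn
  have hN := Nm_pos hn0
  rw [Real.norm_of_nonneg (Real.exp_pos _).le]
  have h1 : (c * Nm n) ^ 2 / 2 ≤ Real.exp (c * Nm n) := by
    have := Real.quadratic_le_exp_of_nonneg (x := c * Nm n) (by positivity)
    nlinarith [mul_pos hc hN]
  rw [neg_mul, Real.exp_neg, Real.rpow_neg hN.le]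
  have h2 : (0:ℝ) < (c * Nm n) ^ 2 / 2 := by positivity
  calc (Real.exp (c * Nm n))⁻¹ ≤ ((c * Nm n) ^ 2 / 2)⁻¹ := inv_anti₀ h2 h1
    _ = 2 / c ^ 2 * (Nm n ^ (2:ℝ))⁻¹ := by
      rw [Real.rpow_two]; field_simp

theorem poisson_one {Y : ℝ} (hY : 0 < Y) (u : ℝ) :
    ∑' n : ℤ, Complex.exp (-π * Y * ((n:ℂ) + u) ^ 2) =
      1 / (Y : ℂ) ^ (1/2 : ℂ) * ∑' k : ℤ, Complex.exp (-π / Y * (k:ℂ) ^ 2 - 2 * π * I * k * u) := by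
  have ha : 0 < ((1 / Y : ℝ) : ℂ).re := by rw [Complex.ofReal_re]; positivity
  have h := Complex.tsum_exp_neg_quadratic ha (-I * u)
  have hYc : (Y:ℂ) ≠ 0 := by exact_mod_cast hY.ne'
  have e1 : ∀ n : ℤ, Complex.exp (-π / ((1/Y:ℝ):ℂ) * ((n:ℂ) + I * (-I * u)) ^ 2) =
      Complex.exp (-π * Y * ((n:ℂ) + u) ^ 2) := by
    intro n; congr 1
    have : I * (-I * (u:ℂ)) = u := by rw [← mul_assoc]; simp
    rw [this]; push_cast; field_simp
  have e2 : ∀ n : ℤ, Complex.exp (-π * ((1/Y:ℝ):ℂ) * (n:ℂ) ^ 2 + 2 * π * (-I * u) * n) =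
      Complex.exp (-π / Y * (n:ℂ) ^ 2 - 2 * π * I * n * u) := by
    intro n; congr 1; push_cast; field_simp; ring
  simp_rw [e1, e2] at h
  rw [h]
  have hp : (Y:ℂ) ^ (1/2:ℂ) ≠ 0 := by rw [Complex.cpow_ne_zero_iff]; left; exact hYc
  have e3 : (((1/Y:ℝ):ℂ)) ^ (1/2:ℂ) = 1 / (Y:ℂ) ^ (1/2:ℂ) := by
    rw [one_div, one_div, Complex.ofReal_inv, Complex.inv_cpow]
    · rw [one_div]
    · rw [Complex.arg_ofReal_of_nonneg hY.le]; exact Real.pi_pos.ne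
  rw [e3]; field_simp

theorem summable_one {Y : ℝ} (hY : 0 < Y) (u : ℝ) :
    Summable (fun n : ℤ => Complex.exp (-π * Y * ((n:ℂ) + u) ^ 2)) := by
  have h := (summable_jacobiTheta₂_term_iff (I * Y * u) (I * Y)).2 (by simpa using hY)
  refine (h.mul_left (Complex.exp (-π * Y * u ^ 2))).congr ?_
  intro n
  rw [jacobiTheta₂_term, ← Complex.exp_add]
  congr 1
  ring_nf
  rw [I_sq]; ring

theorem summable_one_dual {Y : ℝ} (hY : 0 < Y) (u : ℝ) :
    Summable (fun k : ℤ => Complex.exp (-π / Y * (k:ℂ) ^ 2 - 2 * π * I * k * u)) := by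
  have hYc : (Y:ℂ) ≠ 0 := by exact_mod_cast hY.ne'
  have h := (summable_jacobiTheta₂_term_iff (-(u:ℂ)) (I * ((1 / Y : ℝ) : ℂ))).2 (by
    rw [Complex.I_mul_im, Complex.ofReal_re]; positivity)
  refine h.congr ?_
  intro n
  rw [jacobiTheta₂_term]
  congr 1
  push_cast
  ring_nf
  rw [I_sq]; ring

theorem poisson_two {Y : ℝ} (hY : 0 < Y) (w : ℂ) :
    ∑' n : O, ((Real.exp (-π * Y * Complex.normSq (GaussianInt.toComplex n + w)) : ℝ) : ℂ) =
      1 / (Y : ℂ) * ∑' k : O, ((Real.exp (-π * Nm k / Y) : ℝ) : ℂ) * ef (GaussianInt.toComplex k * w) := by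
  have hYc : (Y:ℂ) ≠ 0 := by exact_mod_cast hY.ne'
  have h1 := summable_one hY w.re
  have h2 := summable_one hY w.im
  have h3 := summable_one_dual hY w.re
  have h4 := summable_one_dual hY w.im
  have L := tsum_mul_tsum_of_summable_norm h1.norm h2.norm
  have R := tsum_mul_tsum_of_summable_norm h3.norm h4.norm
  rw [poisson_one hY, poisson_one hY] at L
  have hsq : (Y:ℂ) ^ (1/2:ℂ) * (Y:ℂ) ^ (1/2:ℂ) = Y := by
    rw [← Complex.cpow_add _ _ hYc]; norm_num
  rw [← eqvZ.symm.tsum_eq (fun n : O => ((Real.exp (-π * Y * Complex.normSq (GaussianInt.toComplex n + w)) : ℝ) : ℂ))]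
  rw [← (((Equiv.neg ℤ).prodCongr (Equiv.refl ℤ)).trans eqvZ.symm).tsum_eq (fun k : O => ((Real.exp (-π * Nm k / Y) : ℝ) : ℂ) * ef (GaussianInt.toComplex k * w))]
  have eL : ∀ p : ℤ × ℤ, ((Real.exp (-π * Y * Complex.normSq (GaussianInt.toComplex (eqvZ.symm p) + w)) : ℝ) : ℂ)
      = Complex.exp (-π * Y * ((p.1:ℂ) + w.re) ^ 2) * Complex.exp (-π * Y * ((p.2:ℂ) + w.im) ^ 2) := by
    rintro ⟨a, b⟩
    rw [← Complex.exp_add, Complex.ofReal_exp]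
    congr 1
    have : Complex.normSq (GaussianInt.toComplex (eqvZ.symm (a, b)) + w) = (a + w.re) ^ 2 + (b + w.im) ^ 2 := by
      rw [Complex.normSq_apply]
      have e : eqvZ.symm (a, b) = (⟨a, b⟩ : O) := rfl
      rw [e, GaussianInt.toComplex_def']
      simp; ring
    rw [this]; push_cast; ring
  have eR : ∀ p : ℤ × ℤ, ((Real.exp (-π * Nm ((((Equiv.neg ℤ).prodCongr (Equiv.refl ℤ)).trans eqvZ.symm) p) / Y) : ℝ) : ℂ) *
        ef (GaussianInt.toComplex ((((Equiv.neg ℤ).prodCongr (Equiv.refl ℤ)).trans eqvZ.symm) p) * w)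
      = Complex.exp (-π / Y * (p.1:ℂ) ^ 2 - 2 * π * I * p.1 * w.re) *
        Complex.exp (-π / Y * (p.2:ℂ) ^ 2 - 2 * π * I * p.2 * w.im) := by
    rintro ⟨a, b⟩
    have e : (((Equiv.neg ℤ).prodCongr (Equiv.refl ℤ)).trans eqvZ.symm) (a, b) = (⟨-a, b⟩ : O) := rfl
    rw [e, ef, Complex.ofReal_exp, ← Complex.exp_add, ← Complex.exp_add]
    congr 1
    have e1 : Nm (⟨-a, b⟩ : O) = a ^ 2 + b ^ 2 := by rw [Nm_eq]; push_cast; ring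
    have e2 : (GaussianInt.toComplex (⟨-a, b⟩ : O) * w).re = - a * w.re - b * w.im := by
      rw [GaussianInt.toComplex_def']; simp
    rw [e1, e2]; push_cast; field_simp; ring
  simp_rw [eL, eR]
  rw [← L, ← R]
  have e : 1 / (Y:ℂ) = 1 / (Y:ℂ) ^ (1/2:ℂ) * (1 / (Y:ℂ) ^ (1/2:ℂ)) := by
    rw [one_div_mul_one_div, hsq]
  rw [e]; ring

/-- the equivalence `(r, n) ↦ r + q n` -/
def eqvRQ (q : O) [NeZero q] : RQ q × O ≃ O :=
  Equiv.ofBijective (fun p => ot p.1 + q * p.2) <| by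
    have hq : q ≠ 0 := NeZero.ne q
    constructor
    · rintro ⟨a, n⟩ ⟨b, m⟩ h
      simp only at h
      have h1 : mkq q (ot a) = mkq q (ot b) := by
        rw [mkq_eq]; exact ⟨m - n, by linear_combination h⟩
      rw [mkq_ot, mkq_ot] at h1
      subst h1
      have : q * n = q * m := by linear_combination h
      rw [mul_left_cancel₀ hq this]
    · intro x
      have h1 : mkq q x = mkq q (ot (mkq q x)) := by rw [mkq_ot]
      rw [mkq_eq] at h1
      obtain ⟨n, hn⟩ := h1
      exact ⟨(mkq q x, n), by simp only; linear_combination -hn⟩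

theorem Per.bdd {q : O} [NeZero q] {F : O → ℂ} (hF : Per q F) : ∃ M : ℝ, 0 ≤ M ∧ ∀ n, ‖F n‖ ≤ M := by
  refine ⟨∑ x : RQ q, ‖F (SMQ.ot x)‖, Finset.sum_nonneg (fun _ _ => norm_nonneg _), fun n => ?_⟩
  rw [← hF.ot n]
  exact Finset.single_le_sum (f := fun x : RQ q => ‖F (SMQ.ot x)‖) (fun _ _ => norm_nonneg _) (Finset.mem_univ _)

theorem summable_bdd_gauss {F : O → ℂ} {M : ℝ} (hF : ∀ n, ‖F n‖ ≤ M) {c : ℝ} (hc : 0 < c) :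
    Summable (fun n : O => F n * ((Real.exp (-c * Nm n) : ℝ) : ℂ)) := by
  refine Summable.of_norm_bounded ((summable_gauss hc).mul_left M) (fun n => ?_)
  rw [norm_mul, Complex.norm_real, Real.norm_of_nonneg (Real.exp_pos _).le]
  exact mul_le_mul_of_nonneg_right (hF n) (Real.exp_pos _).le

theorem theta_poisson {q : O} [NeZero q] {F : O → ℂ} (hF : Per q F) {y : ℝ} (hy : 0 < y) :
    ∑' n : O, F n * ((Real.exp (-π * y * Nm n) : ℝ) : ℂ) =
      1 / ((Nm q * y : ℝ) : ℂ) *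
        ∑' k : O, ft q F k * ((Real.exp (-π / (Nm q * y) * Nm k) : ℝ) : ℂ) := by
  have hq : q ≠ 0 := NeZero.ne q
  have hNq := Nm_pos hq
  have hY : 0 < Nm q * y := by positivity
  obtain ⟨M, hM0, hM⟩ := hF.bdd
  have hs : Summable (fun n : O => F n * ((Real.exp (-π * y * Nm n) : ℝ) : ℂ)) := by
    have := summable_bdd_gauss hM (c := π * y) (by positivity)
    simpa [neg_mul] using this
  rw [← (eqvRQ q).tsum_eq]
  have hs' := (eqvRQ q).summable_iff.2 hs
  simp only [Function.comp_def] at hs'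
  rw [Summable.tsum_prod hs', tsum_fintype]
  have e1 : ∀ (r : RQ q) (n : O), F (eqvRQ q (r, n)) * ((Real.exp (-π * y * Nm (eqvRQ q (r, n))) : ℝ) : ℂ) =
      F (ot r) * ((Real.exp (-π * (Nm q * y) * Complex.normSq (GaussianInt.toComplex n +
        GaussianInt.toComplex (ot r) / GaussianInt.toComplex q)) : ℝ) : ℂ) := by
    intro r n
    have e : eqvRQ q (r, n) = ot r + q * n := rfl
    rw [e, hF (ot r + q * n) (ot r) ⟨n, by ring⟩]
    congr 3
    have : GaussianInt.toComplex n + GaussianInt.toComplex (ot r) / GaussianInt.toComplex q =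
      GaussianInt.toComplex (ot r + q * n) / GaussianInt.toComplex q := by
      have := toC_ne_zero hq
      rw [map_add, map_mul]; field_simp; ring
    rw [this, Complex.normSq_div, ← Nm_eq_normSq, ← Nm_eq_normSq]
    field_simp
  simp_rw [e1, tsum_mul_left, poisson_two hY]
  have hs2 : ∀ r : RQ q, Summable (fun k : O => F (ot r) * (((Real.exp (-π / (Nm q * y) * Nm k) : ℝ) : ℂ) *
      psi q k (ot r))) := by
    intro r
    have := (summable_bdd_gauss (F := fun k => psi q k (ot r)) (M := 1) (fun n => (norm_psi _ _ _).le)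
      (c := π / (Nm q * y)) (by positivity)).mul_left (F (ot r))
    refine this.congr (fun k => ?_)
    rw [mul_comm (psi q k (ot r)), neg_div]
  have e2 : ∀ k : O, ft q F k * ((Real.exp (-π / (Nm q * y) * Nm k) : ℝ) : ℂ) =
      ∑ r : RQ q, F (ot r) * (((Real.exp (-π / (Nm q * y) * Nm k) : ℝ) : ℂ) * psi q k (ot r)) := by
    intro k
    unfold ft; rw [Finset.sum_mul]
    apply Finset.sum_congr rfl; intro r _; ring
  simp_rw [e2]
  rw [Summable.tsum_finsetSum (fun r _ => hs2 r), Finset.mul_sum]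
  apply Finset.sum_congr rfl; intro r _
  rw [tsum_mul_left]
  have e3 : ∀ k : O, ((Real.exp (-π * Nm k / (Nm q * y)) : ℝ) : ℂ) *
      ef (GaussianInt.toComplex k * (GaussianInt.toComplex (ot r) / GaussianInt.toComplex q)) =
      ((Real.exp (-π / (Nm q * y) * Nm k) : ℝ) : ℂ) * psi q k (ot r) := by
    intro k
    unfold psi
    rw [map_mul, ← mul_div_assoc, div_mul_eq_mul_div]
  simp_rw [e3]
  ring


/-! ### Part E: the sums `W` -/

/-- Gaussian weighted character sums -/
def W (χ : O → O → ℤ) (X : ℝ) (q : O) : ℂ :=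
  ∑' k : O, (χ k q : ℂ) * ((Real.exp (-π / X * Nm k) : ℝ) : ℂ)

theorem W_summable {χ : O → O → ℤ} (hχ : IsQuadSym χ) {q : O} (ho : ¬ ωg ∣ q) {X : ℝ} (hX : 0 < X) :
    Summable (fun k : O => (χ k q : ℂ) * ((Real.exp (-π / X * Nm k) : ℝ) : ℂ)) := by
  have := summable_bdd_gauss (F := fun k => (χ k q : ℂ)) (M := 1) (chi_norm_le hχ ho)
    (c := π / X) (by positivity)
  simpa [neg_div] using this

theorem norm_ft_le {q : O} [NeZero q] {F : O → ℂ} {M : ℝ} (hF : ∀ n, ‖F n‖ ≤ M) (k : O) :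
    ‖ft q F k‖ ≤ Nm q * M := by
  unfold ft
  refine (norm_sum_le _ _).trans ?_
  have : ∀ x ∈ (Finset.univ : Finset (RQ q)), ‖F (ot x) * psi q k (ot x)‖ ≤ M := by
    intro x _; rw [norm_mul, norm_psi, mul_one]; exact hF _
  refine (Finset.sum_le_card_nsmul _ _ _ this).trans ?_
  rw [nsmul_eq_mul, ← card_RQ]; rfl

instance instNeZeroOne : NeZero (1:O) := ⟨one_ne_zero⟩

theorem odd_ne_zero {q : O} (ho : ¬ ωg ∣ q) : q ≠ 0 := by
  rintro rfl; exact ho (dvd_zero _)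

theorem W_FE {χ : O → O → ℤ} (hχ : IsQuadSym χ) {q : O} (ho : ¬ ωg ∣ q) (hsf : Squarefree q)
    {X : ℝ} (hX : 0 < X) :
    ‖W χ X q‖ = X / Real.sqrt (Nm q) * ‖W χ (Nm q / X) q‖ := by
  have hq := odd_ne_zero ho
  haveI : NeZero q := ⟨hq⟩
  have hN := Nm_pos hq
  have h := theta_poisson (chi_per hχ ho) (q := q) (y := 1 / X) (by positivity)
  have e0 : W χ X q = ∑' n : O, (χ n q : ℂ) * ((Real.exp (-π * (1 / X) * Nm n) : ℝ) : ℂ) := by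
    unfold W; congr 1; ext k; congr 3; ring
  have e1 : W χ X q = ((X / Nm q : ℝ) : ℂ) * (gs χ q * W χ (Nm q / X) q) := by
    rw [e0, h]
    unfold W
    have e2 : (1 : ℂ) / ((Nm q * (1 / X) : ℝ) : ℂ) = ((X / Nm q : ℝ) : ℂ) := by
      rw [← Complex.ofReal_one, ← Complex.ofReal_div]; congr 1; field_simp
    rw [e2]
    congr 1
    rw [← tsum_mul_left]
    apply tsum_congr; intro k
    have e3 : -π / (Nm q * (1 / X)) * Nm k = -π / (Nm q / X) * Nm k := by congr 2; ring
    rw [ft_chi hχ ho hsf, mul_assoc, e3]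
  have h2 := norm_gs hχ ho hsf
  have h3 : ‖gs χ q‖ = Real.sqrt (Nm q) := by rw [← h2, Real.sqrt_sq (norm_nonneg _)]
  rw [e1, norm_mul, norm_mul, h3, Complex.norm_real, Real.norm_of_nonneg (by positivity)]
  have h4 : Real.sqrt (Nm q) * Real.sqrt (Nm q) = Nm q := Real.mul_self_sqrt hN.le
  have h5 : 0 < Real.sqrt (Nm q) := Real.sqrt_pos.2 hN
  rw [← mul_assoc]; congr 1
  rw [div_mul_eq_mul_div, div_eq_div_iff hN.ne' h5.ne', mul_assoc, h4]

theorem exp_neg_le {t : ℝ} (ht : 0 < t) : Real.exp (-t) ≤ 2 / t ^ 2 := by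
  have := Real.quadratic_le_exp_of_nonneg ht.le
  rw [Real.exp_neg, inv_le_comm₀ (Real.exp_pos _) (by positivity), inv_div]
  nlinarith

theorem gauss_bound : ∃ C : ℝ, 0 < C ∧ ∀ X : ℝ, 0 < X →
    ∑' n : O, (if n = 0 then 0 else Real.exp (-π / X * Nm n)) ≤ C * X := by
  set θ1 := ∑' n : O, Real.exp (-π * Nm n)
  set Z2 := ∑' n : O, Nm n ^ (-(2:ℝ))
  have hθ : 0 ≤ θ1 := tsum_nonneg (fun _ => (Real.exp_pos _).le)
  have hZ : 0 ≤ Z2 := tsum_nonneg (fun n => Real.rpow_nonneg (Nm_nonneg _) _)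
  have hsum : ∀ X : ℝ, 0 < X → Summable (fun n : O => Real.exp (-π / X * Nm n)) := by
    intro X hX
    have := summable_gauss (c := π / X) (by positivity)
    simpa [neg_div] using this
  have hle : ∀ (X : ℝ) (n : O), (if n = 0 then 0 else Real.exp (-π / X * Nm n)) ≤ Real.exp (-π / X * Nm n) := by
    intro X n; split_ifs
    · exact (Real.exp_pos _).le
    · exact le_rfl
  have hnn : ∀ (X : ℝ) (n : O), 0 ≤ (if n = 0 then 0 else Real.exp (-π / X * Nm n)) := by
    intro X n; split_ifs
    · exact le_rfl
    · exact (Real.exp_pos _).le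
  refine ⟨θ1 + Z2 + 1, by positivity, fun X hX => ?_⟩
  have hs1 : Summable (fun n : O => (if n = 0 then 0 else Real.exp (-π / X * Nm n))) :=
    Summable.of_nonneg_of_le (hnn X) (hle X) (hsum X hX)
  rcases le_total 1 X with h1 | h1
  · have h := theta_poisson (q := 1) (F := fun _ => 1) (fun _ _ _ => rfl) (y := 1 / X) (by positivity)
    have e0 : (∑' n : O, Real.exp (-π / X * Nm n)) ≤ X * θ1 := by
      have e1 : ((∑' n : O, Real.exp (-π / X * Nm n) : ℝ) : ℂ) =
          ∑' n : O, (1:ℂ) * ((Real.exp (-π * (1 / X) * Nm n) : ℝ) : ℂ) := by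
        push_cast
        apply tsum_congr; intro n; rw [one_mul]; congr 1; ring
      have e2 : (∑' n : O, Real.exp (-π / X * Nm n)) = ‖((∑' n : O, Real.exp (-π / X * Nm n) : ℝ) : ℂ)‖ := by
        rw [Complex.norm_real, Real.norm_of_nonneg]
        exact tsum_nonneg (fun _ => (Real.exp_pos _).le)
      rw [e2, e1, h, norm_mul, Nm_one]
      have hsθ : Summable (fun n : O => Real.exp (-π * Nm n)) := summable_gauss Real.pi_pos
      gcongr
      · rw [norm_div, Complex.norm_real]
        simp [abs_of_pos hX]
      · refine tsum_of_norm_bounded hsθ.hasSum (fun k => ?_)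
        rw [norm_mul, Complex.norm_real, Real.norm_of_nonneg (Real.exp_pos _).le]
        have hf := norm_ft_le (q := 1) (F := fun _ => 1) (M := 1) (by simp) k
        rw [Nm_one, one_mul] at hf
        calc _ ≤ 1 * Real.exp (-π / (1 * (1 / X)) * Nm k) := by gcongr
          _ ≤ Real.exp (-π * Nm k) := by
            rw [one_mul]; apply Real.exp_le_exp.2
            have := Nm_nonneg k
            have e : -π / (1 * (1 / X)) * Nm k = -π * (X * Nm k) := by field_simp
            rw [e]
            have : Nm k ≤ X * Nm k := by nlinarith
            nlinarith [Real.pi_pos]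
    calc _ ≤ _ := (hs1.tsum_le_tsum (hle X) (hsum X hX))
      _ ≤ _ := e0
      _ ≤ _ := by nlinarith
  · have h2 : ∑' n : O, (if n = 0 then 0 else Real.exp (-π / X * Nm n)) ≤ ∑' n : O, X * Nm n ^ (-(2:ℝ)) := by
      refine hs1.tsum_le_tsum (fun n => ?_) ((summable_Nm_rpow (by norm_num)).mul_left X)
      split_ifs with hn
      · exact mul_nonneg hX.le (Real.rpow_nonneg (Nm_nonneg _) _)
      · have hN := Nm_pos hn
        have e : -π / X * Nm n = -(π / X * Nm n) := by ring
        rw [e]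
        refine (exp_neg_le (by positivity)).trans ?_
        rw [Real.rpow_neg hN.le, Real.rpow_two]
        have hpi := Real.pi_gt_three
        have e2 : 2 / (π / X * Nm n) ^ 2 = (2 * X ^ 2 / π ^ 2) * (Nm n ^ 2)⁻¹ := by field_simp
        rw [e2]
        apply mul_le_mul_of_nonneg_right _ (by positivity)
        rw [div_le_iff₀ (by positivity)]
        nlinarith [mul_pos hX hX, mul_pos hX Real.pi_pos, mul_nonneg hX.le (sub_nonneg.2 h1)]
    rw [tsum_mul_left] at h2
    nlinarith

/-- the constant in `gauss_bound` -/
def Cg : ℝ := gauss_bound.choose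

theorem Cg_pos : 0 < Cg := gauss_bound.choose_spec.1

theorem Cg_spec {X : ℝ} (hX : 0 < X) :
    ∑' n : O, (if n = 0 then 0 else Real.exp (-π / X * Nm n)) ≤ Cg * X :=
  gauss_bound.choose_spec.2 X hX

theorem gauss_nz_summable {X : ℝ} (hX : 0 < X) :
    Summable (fun n : O => (if n = 0 then 0 else Real.exp (-π / X * Nm n))) := by
  have := summable_gauss (c := π / X) (by positivity)
  refine Summable.of_nonneg_of_le (fun n => ?_) (fun n => ?_) this
  · split_ifs
    · exact le_rfl
    · exact (Real.exp_pos _).le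
  · split_ifs
    · exact (Real.exp_pos _).le
    · rw [neg_div]

theorem chi_zero {χ : O → O → ℤ} (hχ : IsQuadSym χ) {q : O} (ho : ¬ ωg ∣ q) (hu : ¬ IsUnit q) :
    χ 0 q = 0 := by
  apply (chi_vals hχ ho 0).2
  rwa [isCoprime_zero_left]

theorem W_le {χ : O → O → ℤ} (hχ : IsQuadSym χ) {q : O} (ho : ¬ ωg ∣ q) (hu : ¬ IsUnit q)
    {X : ℝ} (hX : 0 < X) : ‖W χ X q‖ ≤ Cg * X := by
  refine le_trans ?_ (Cg_spec hX)
  refine tsum_of_norm_bounded (gauss_nz_summable hX).hasSum (fun k => ?_)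
  rw [norm_mul, Complex.norm_real, Real.norm_of_nonneg (Real.exp_pos _).le]
  split_ifs with h
  · rw [h, chi_zero hχ ho hu]; simp
  · exact mul_le_of_le_one_left (Real.exp_pos _).le (chi_norm_le hχ ho k)

theorem W_le' {χ : O → O → ℤ} (hχ : IsQuadSym χ) {q : O} (ho : ¬ ωg ∣ q)
    {X : ℝ} (hX : 0 < X) : ‖W χ X q‖ ≤ 1 + Cg * X := by
  have hs := gauss_nz_summable hX
  have h1 : Summable (fun n : O => if n = 0 then (1:ℝ) else 0) := (hasSum_ite_eq (0:O) (1:ℝ)).summable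
  have e1 : ∑' n : O, (if n = 0 then (1:ℝ) else 0) = 1 := tsum_ite_eq _ _
  calc ‖W χ X q‖ ≤ ∑' n : O, ((if n = 0 then (1:ℝ) else 0) + (if n = 0 then 0 else Real.exp (-π / X * Nm n))) := by
        refine tsum_of_norm_bounded (h1.add hs).hasSum (fun k => ?_)
        rw [norm_mul, Complex.norm_real, Real.norm_of_nonneg (Real.exp_pos _).le]
        have := chi_norm_le hχ ho k
        split_ifs with h
        · subst h; simpa using this
        · rw [zero_add]; exact mul_le_of_le_one_left (Real.exp_pos _).le this
    _ = 1 + ∑' n : O, (if n = 0 then 0 else Real.exp (-π / X * Nm n)) := by rw [h1.tsum_add hs, e1]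
    _ ≤ _ := by linarith [Cg_spec hX]

theorem W_PV {χ : O → O → ℤ} (hχ : IsQuadSym χ) {q : O} (ho : ¬ ωg ∣ q) (hsf : Squarefree q)
    (hu : ¬ IsUnit q) {X : ℝ} (hX : 0 < X) : ‖W χ X q‖ ≤ Cg * Real.sqrt (Nm q) := by
  have hN := Nm_pos (odd_ne_zero ho)
  rw [W_FE hχ ho hsf hX]
  have h := W_le hχ ho hu (X := Nm q / X) (by positivity)
  have h4 : Real.sqrt (Nm q) * Real.sqrt (Nm q) = Nm q := Real.mul_self_sqrt hN.le
  have h5 : 0 < Real.sqrt (Nm q) := Real.sqrt_pos.2 hN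
  calc _ ≤ X / Real.sqrt (Nm q) * (Cg * (Nm q / X)) := by gcongr
    _ = Cg * (Nm q / Real.sqrt (Nm q)) := by field_simp
    _ = _ := by rw [Real.div_sqrt]

/-! ### divisors -/

theorem finite_dv {r : O} (hr : r ≠ 0) : {d : O | d ∣ r}.Finite :=
  (finite_ball (Nm r)).subset (fun _ hd => Nm_le_of_dvd hr hd)

/-- all divisors of `r` -/
def dv (r : O) : Finset O := if h : r ≠ 0 then (finite_dv h).toFinset else ∅

theorem mem_dv {r d : O} (hr : r ≠ 0) : d ∈ dv r ↔ d ∣ r := by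
  unfold dv; rw [dif_pos hr]; simp

theorem dv_ne_zero {r d : O} (hr : r ≠ 0) (h : d ∈ dv r) : d ≠ 0 := by
  rintro rfl; exact hr (zero_dvd_iff.1 ((mem_dv hr).1 h))

theorem W_mul_unit {χ : O → O → ℤ} (hχ : IsQuadSym χ) {q u : O} (ho : ¬ ωg ∣ q) (hu : IsUnit u) (X : ℝ) :
    W χ X (u * q) = W χ X q := by
  unfold W; apply tsum_congr; intro k; rw [chi_unit_mul_den hχ ho hu]

theorem W_mul_p {χ : O → O → ℤ} (hχ : IsQuadSym χ) {q p : O} (ho : ¬ ωg ∣ q) (hp : Prime p) (hpo : ¬ ωg ∣ p)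
    {X : ℝ} (hX : 0 < X) : ‖W χ X (p * p * q)‖ ≤ ‖W χ X q‖ + ‖W χ (X / Nm p) q‖ := by
  have hp0 := hp.ne_zero
  have hpp : ¬ ωg ∣ p * p := omega_not_dvd_mul hpo hpo
  have hNp := Nm_pos hp0
  let e : O → O := fun j => p * j
  have he : Function.Injective e := fun a b h => mul_left_cancel₀ hp0 h
  have hs := W_summable hχ ho hX
  have hs2 : Summable (fun k : O => if p ∣ k then (χ k q : ℂ) * ((Real.exp (-π / X * Nm k) : ℝ) : ℂ) else 0) := by
    refine Summable.of_norm_bounded hs.norm (fun k => ?_)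
    split_ifs
    · exact le_rfl
    · simp
  have h2 : ∑' k : O, (if p ∣ k then (χ k q : ℂ) * ((Real.exp (-π / X * Nm k) : ℝ) : ℂ) else 0) =
      (χ p q : ℂ) * W χ (X / Nm p) q := by
    rw [← he.tsum_eq]
    · unfold W; rw [← tsum_mul_left]; apply tsum_congr; intro j
      rw [if_pos (dvd_mul_right p j)]
      simp only [e]
      have e3 : -π / X * Nm (p * j) = -π / (X / Nm p) * Nm j := by rw [Nm_mul]; field_simp
      rw [chi_mul hχ ho, e3, Int.cast_mul, mul_assoc]
    · intro k hk
      by_contra hk'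
      apply hk
      refine if_neg ?_
      rintro ⟨j, rfl⟩; exact hk' ⟨j, rfl⟩
  have h1 : W χ X (p * p * q) = W χ X q -
      ∑' k : O, (if p ∣ k then (χ k q : ℂ) * ((Real.exp (-π / X * Nm k) : ℝ) : ℂ) else 0) := by
    unfold W
    rw [← hs.tsum_sub hs2]; apply tsum_congr; intro k
    rw [hχ.mul_den _ _ _ hpp ho, hχ.mul_den _ _ _ hpo hpo]
    split_ifs with h
    · rw [hχ.zero_of_dvd p k hp h]; simp
    · have : IsCoprime k p := ((hp.irreducible.coprime_iff_not_dvd).2 h).symm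
      rw [chi_sq hχ hpo this]; simp
  rw [h1, h2]
  refine (norm_sub_le _ _).trans ?_
  rw [norm_mul]
  have := chi_norm_le hχ ho p
  gcongr
  exact mul_le_of_le_one_left (norm_nonneg _) this

theorem W_sq_le {χ : O → O → ℤ} (hχ : IsQuadSym χ) {r : O} (hr : ¬ ωg ∣ r) : ∀ {q : O}, ¬ ωg ∣ q →
    ∀ {X : ℝ}, 0 < X → ‖W χ X (r * r * q)‖ ≤ ∑ d ∈ dv r, ‖W χ (X / Nm d) q‖ := by
  refine odd_induction (P := fun r => ∀ {q : O}, ¬ ωg ∣ q →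
    ∀ {X : ℝ}, 0 < X → ‖W χ X (r * r * q)‖ ≤ ∑ d ∈ dv r, ‖W χ (X / Nm d) q‖) ?_ ?_ r hr
  · intro u hu q ho X hX
    rw [W_mul_unit hχ ho (hu.mul hu)]
    have h1 : (1:O) ∈ dv u := (mem_dv hu.ne_zero).2 (one_dvd _)
    have := Finset.single_le_sum (f := fun d => ‖W χ (X / Nm d) q‖) (fun _ _ => norm_nonneg _) h1
    simpa using this
  · intro p r hp hpo hro ih q ho X hX
    have hr0 := odd_ne_zero hro
    have hp0 := hp.ne_zero
    have hpr0 : p * r ≠ 0 := mul_ne_zero hp0 hr0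
    by_cases hd : p ∣ r
    · have e : W χ X (p * r * (p * r) * q) = W χ X (r * r * q) := by
        unfold W; apply tsum_congr; intro k
        congr 2
        have o1 : ¬ ωg ∣ r * r * q := omega_not_dvd_mul (omega_not_dvd_mul hro hro) ho
        have e1 : p * r * (p * r) * q = p * p * (r * r * q) := by ring
        rw [e1, hχ.mul_den _ _ _ (omega_not_dvd_mul hpo hpo) o1, hχ.mul_den _ _ _ hpo hpo]
        by_cases hk : p ∣ k
        · obtain ⟨r', rfl⟩ := hd
          have o2 : ¬ ωg ∣ r' * (p * r') * q := by
            intro h; exact o1 (h.trans ⟨p, by ring⟩)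
          have e2 : p * r' * (p * r') * q = p * (r' * (p * r') * q) := by ring
          rw [e2, hχ.mul_den _ _ _ hpo o2, hχ.zero_of_dvd p k hp hk]; simp
        · have : IsCoprime k p := ((hp.irreducible.coprime_iff_not_dvd).2 hk).symm
          rw [chi_sq hχ hpo this]; simp
      rw [e]
      refine (ih ho hX).trans ?_
      apply Finset.sum_le_sum_of_subset_of_nonneg
      · intro d h; rw [mem_dv hpr0]; rw [mem_dv hr0] at h; exact h.mul_left p
      · intros; exact norm_nonneg _
    · have e1 : p * r * (p * r) * q = p * p * (r * r * q) := by ring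
      have o1 : ¬ ωg ∣ r * r * q := omega_not_dvd_mul (omega_not_dvd_mul hro hro) ho
      rw [e1]
      refine (W_mul_p hχ o1 hp hpo hX).trans ?_
      have hNp := Nm_pos hp0
      have i1 := ih ho hX
      have i2 := ih ho (X := X / Nm p) (by positivity)
      refine (add_le_add i1 i2).trans ?_
      have e2 : ∑ d ∈ dv r, ‖W χ (X / Nm p / Nm d) q‖ = ∑ d ∈ (dv r).image (fun d => p * d), ‖W χ (X / Nm d) q‖ := by
        rw [Finset.sum_image (fun a _ b _ h => mul_left_cancel₀ hp0 h)]
        apply Finset.sum_congr rfl; intro d _; rw [Nm_mul, div_div]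
      have hdisj : Disjoint (dv r) ((dv r).image (fun d => p * d)) := by
        rw [Finset.disjoint_left]
        intro d h1 h2
        rw [Finset.mem_image] at h2
        obtain ⟨d', _, rfl⟩ := h2
        rw [mem_dv hr0] at h1
        exact hd ((dvd_mul_right p d').trans h1)
      rw [e2, ← Finset.sum_union hdisj]
      apply Finset.sum_le_sum_of_subset_of_nonneg
      · intro d h
        rw [mem_dv hpr0]
        rw [Finset.mem_union, Finset.mem_image] at h
        rcases h with h | ⟨d', h, rfl⟩
        · rw [mem_dv hr0] at h; exact h.mul_left p
        · rw [mem_dv hr0] at h; exact mul_dvd_mul_left p h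
      · intros; exact norm_nonneg _


/-! ### Part F: divisor bound -/

/-- divisors up to associates -/
def da (r : O) : Finset (Associates O) := (dv r).image Associates.mk

theorem card_dv_le (r : O) : (dv r).card ≤ 4 * (da r).card := by
  unfold da
  refine Finset.card_le_mul_card_image (f := Associates.mk) (dv r) 4 ?_
  intro b hb
  rw [Finset.mem_image] at hb
  obtain ⟨x, hx, rfl⟩ := hb
  have hsub : (dv r).filter (fun a => Associates.mk a = Associates.mk x) ⊆ ({x, -x, x * ig, -(x * ig)} : Finset O) := by
    intro y hy
    rw [Finset.mem_filter, Associates.mk_eq_mk_iff_associated] at hy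
    obtain ⟨u, hu⟩ := hy.2.symm
    rcases unit_cases u.isUnit with h | h | h | h <;> rw [h] at hu <;> simp [← hu]
  exact (Finset.card_le_card hsub).trans Finset.card_le_four

theorem card_da_mul {a b : O} (ha : a ≠ 0) (hb : b ≠ 0) : (da (a * b)).card ≤ (da a).card * (da b).card := by
  rw [← Finset.card_product]
  have : da (a * b) ⊆ ((da a) ×ˢ (da b)).image (fun p => p.1 * p.2) := by
    intro x hx
    unfold da at hx
    rw [Finset.mem_image] at hx
    obtain ⟨d, hd, rfl⟩ := hx
    rw [mem_dv (mul_ne_zero ha hb)] at hd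
    obtain ⟨d1, d2, h1, h2, rfl⟩ := exists_dvd_and_dvd_of_dvd_mul hd
    rw [Finset.mem_image]
    refine ⟨(Associates.mk d1, Associates.mk d2), ?_, ?_⟩
    · rw [Finset.mem_product]
      exact ⟨Finset.mem_image_of_mem _ ((mem_dv ha).2 h1), Finset.mem_image_of_mem _ ((mem_dv hb).2 h2)⟩
    · rw [Associates.mk_mul_mk]
  exact (Finset.card_le_card this).trans Finset.card_image_le

theorem card_da_unit {u : O} (hu : IsUnit u) : (da u).card ≤ 1 := by
  rw [Finset.card_le_one]
  intro a ha b hb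
  unfold da at ha hb
  rw [Finset.mem_image] at ha hb
  obtain ⟨x, hx, rfl⟩ := ha
  obtain ⟨y, hy, rfl⟩ := hb
  rw [mem_dv hu.ne_zero] at hx hy
  rw [Associates.mk_eq_mk_iff_associated]
  exact (associated_one_iff_isUnit.2 (isUnit_of_dvd_unit hx hu)).trans
    (associated_one_iff_isUnit.2 (isUnit_of_dvd_unit hy hu)).symm

theorem card_da_prime_pow {p : O} (hp : Prime p) (k : ℕ) : (da (p ^ k)).card ≤ k + 1 := by
  have : da (p ^ k) ⊆ (Finset.range (k + 1)).image (fun i => Associates.mk (p ^ i)) := by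
    intro x hx
    unfold da at hx
    rw [Finset.mem_image] at hx
    obtain ⟨d, hd, rfl⟩ := hx
    rw [mem_dv (pow_ne_zero _ hp.ne_zero)] at hd
    obtain ⟨i, hi, h⟩ := (dvd_prime_pow hp k).1 hd
    rw [Finset.mem_image]
    exact ⟨i, by simpa using Nat.lt_succ_of_le hi, (Associates.mk_eq_mk_iff_associated.2 h).symm⟩
  exact (Finset.card_le_card this).trans (Finset.card_image_le.trans (by simp))

theorem two_le_Nm {p : O} (h0 : p ≠ 0) (hu : ¬ IsUnit p) : 2 ≤ Nm p := by
  have h1 := one_le_Nm h0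
  have h2 : Nm p ≠ 1 := fun h => hu (isUnit_of_Nm h)
  unfold Nm at *
  have h3 : (1:ℤ) ≤ Zsqrtd.norm p := by exact_mod_cast h1
  have h4 : Zsqrtd.norm p ≠ 1 := by exact_mod_cast h2
  have : (2:ℤ) ≤ Zsqrtd.norm p := by omega
  exact_mod_cast this

theorem divisor_bound {δ : ℝ} (hδ : 0 < δ) : ∃ C : ℝ, 0 < C ∧ ∀ n : O, n ≠ 0 →
    ((dv n).card : ℝ) ≤ C * Nm n ^ δ := by
  -- large primes
  obtain ⟨B, hB⟩ : ∃ B : ℝ, ∀ x : ℝ, B ≤ x → 2 ≤ x ^ δ := by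
    have := (tendsto_rpow_atTop hδ).eventually_ge_atTop 2
    obtain ⟨B, hB⟩ := Filter.eventually_atTop.1 this
    exact ⟨B, hB⟩
  -- small primes
  have h2δ : 1 < (2:ℝ) ^ δ := Real.one_lt_rpow (by norm_num) hδ
  set b := (2:ℝ) ^ δ - 1 with hb
  have hb0 : 0 < b := by linarith
  set K := 1 + 1 / b with hK
  have hK1 : 1 ≤ K := by rw [hK]; have : 0 < 1 / b := by positivity
                         linarith
  have hKk : ∀ k : ℕ, (k:ℝ) + 1 ≤ K * ((2:ℝ) ^ δ) ^ k := by
    intro k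
    have h1 := one_add_mul_le_pow (a := b) (by linarith) k
    have h2 : (1 + b) = (2:ℝ) ^ δ := by rw [hb]; ring
    rw [h2] at h1
    have h3 : (k:ℝ) + 1 ≤ K * (1 + k * b) := by
      rw [hK]; 
      have : (1 + 1 / b) * (1 + k * b) = 1 + k * b + 1 / b + k := by field_simp; ring
      rw [this]
      have : 0 ≤ (k:ℝ) * b := by positivity
      have : 0 < 1 / b := by positivity
      linarith
    exact h3.trans (mul_le_mul_of_nonneg_left h1 (by linarith))
  let S := Bl B
  let c : O → ℕ := fun n => (S.filter (fun p => Prime p ∧ p ∣ n)).card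
  have main : ∀ n : O, n ≠ 0 → ((da n).card : ℝ) ≤ K ^ (c n) * Nm n ^ δ := by
    intro n
    refine UniqueFactorizationMonoid.induction_on_coprime n ?_ ?_ ?_ ?_
    · intro h; exact absurd rfl h
    · intro u hu _
      rw [Nm_unit hu, Real.one_rpow, mul_one]
      have h1 : ((da u).card : ℝ) ≤ 1 := by exact_mod_cast card_da_unit hu
      exact h1.trans (one_le_pow₀ hK1)
    · intro p k hp _
      have h1 : ((da (p ^ k)).card : ℝ) ≤ k + 1 := by exact_mod_cast card_da_prime_pow hp k
      have hN := two_le_Nm hp.ne_zero hp.not_unit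
      have e : Nm (p ^ k) ^ δ = (Nm p ^ δ) ^ k := by
        rw [Nm_pow, ← Real.rpow_natCast, ← Real.rpow_natCast, ← Real.rpow_mul (by linarith),
          ← Real.rpow_mul (by linarith), mul_comm]
      rw [e]
      rcases Nat.eq_zero_or_pos k with rfl | hk
      · have h2 : (1:ℝ) ≤ K ^ c (p ^ 0) := one_le_pow₀ hK1
        rw [pow_zero (Nm p ^ δ), mul_one]
        refine le_trans h1 ?_
        simpa using h2
      by_cases hs : Nm p ≤ B
      · have hc : 1 ≤ c (p ^ k) := by
          apply Finset.card_pos.2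
          exact ⟨p, by rw [Finset.mem_filter]; exact ⟨mem_Bl.2 hs, hp, dvd_pow_self p hk.ne'⟩⟩
        have h3 : K ≤ K ^ c (p ^ k) := by
          calc K = K ^ 1 := (pow_one K).symm
            _ ≤ _ := pow_le_pow_right₀ hK1 hc
        refine h1.trans ((hKk k).trans ?_)
        have : ((2:ℝ) ^ δ) ^ k ≤ (Nm p ^ δ) ^ k := by
          gcongr
        exact mul_le_mul h3 this (by positivity) (by positivity)
      · have h4 := hB (Nm p) (by linarith)
        have h5 : (k:ℝ) + 1 ≤ 2 ^ k := by exact_mod_cast Nat.lt_two_pow_self (n := k)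
        have h6 : (2:ℝ) ^ k ≤ (Nm p ^ δ) ^ k := by gcongr
        calc _ ≤ _ := h1
          _ ≤ 1 * (Nm p ^ δ) ^ k := by linarith
          _ ≤ _ := by
            gcongr
            exact one_le_pow₀ hK1
    · intro x y hxy hx hy h
      have hx0 : x ≠ 0 := left_ne_zero_of_mul h
      have hy0 : y ≠ 0 := right_ne_zero_of_mul h
      have i1 := hx hx0
      have i2 := hy hy0
      have h1 : ((da (x * y)).card : ℝ) ≤ (da x).card * (da y).card := by exact_mod_cast card_da_mul hx0 hy0
      have h2 : c x + c y ≤ c (x * y) := by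
        simp only [c]
        rw [← Finset.card_union_of_disjoint]
        · apply Finset.card_le_card
          intro p hp
          rw [Finset.mem_union, Finset.mem_filter, Finset.mem_filter] at hp
          rw [Finset.mem_filter]
          rcases hp with ⟨a, b, c⟩ | ⟨a, b, c⟩
          · exact ⟨a, b, c.mul_right y⟩
          · exact ⟨a, b, c.mul_left x⟩
        · rw [Finset.disjoint_left]
          intro p h1 h2
          rw [Finset.mem_filter] at h1 h2
          exact h1.2.1.not_unit (hxy h1.2.2 h2.2.2)
      have n1 := Nm_nonneg x
      have n2 := Nm_nonneg y
      calc _ ≤ _ := h1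
        _ ≤ (K ^ (c x) * Nm x ^ δ) * (K ^ (c y) * Nm y ^ δ) := by gcongr
        _ = K ^ (c x + c y) * Nm (x * y) ^ δ := by
          rw [Nm_mul, Real.mul_rpow n1 n2, pow_add]; ring
        _ ≤ _ := by
          have := Nm_nonneg (x * y)
          gcongr
  refine ⟨4 * K ^ S.card, by positivity, fun n hn => ?_⟩
  have h1 : ((dv n).card : ℝ) ≤ 4 * (da n).card := by exact_mod_cast card_dv_le n
  have h2 : K ^ c n ≤ K ^ S.card := pow_le_pow_right₀ hK1 (Finset.card_filter_le _ _)
  have h3 := main n hn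
  have h4 : 0 ≤ Nm n ^ δ := Real.rpow_nonneg (Nm_nonneg _) _
  have h5 := mul_le_mul_of_nonneg_right h2 h4
  nlinarith

theorem sq_decomp {q : O} (ho : ¬ ωg ∣ q) : ∃ q1 r : O, q = r * r * q1 ∧ Squarefree q1 ∧ ¬ ωg ∣ r ∧ ¬ ωg ∣ q1 := by
  refine odd_induction (P := fun q => ∃ q1 r : O, q = r * r * q1 ∧ Squarefree q1 ∧ ¬ ωg ∣ r ∧ ¬ ωg ∣ q1) ?_ ?_ q ho
  · intro u hu
    exact ⟨u, 1, by ring, hu.squarefree, omega_not_dvd_unit isUnit_one, omega_not_dvd_unit hu⟩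
  · rintro p n hp hpo hno ⟨q1, r, rfl, hsf, hr, hq1⟩
    by_cases h : p ∣ q1
    · obtain ⟨q', rfl⟩ := h
      refine ⟨q', p * r, by ring, hsf.of_mul_right, omega_not_dvd_mul hpo hr, ?_⟩
      intro h; exact hq1 (h.mul_left p)
    · refine ⟨p * q1, r, by ring, ?_, hr, omega_not_dvd_mul hpo hq1⟩
      exact squarefree_mul_iff.2 ⟨hp.irreducible.isRelPrime_iff_not_dvd.2 h, hp.squarefree, hsf⟩

theorem sq_decomp_Sp {q : O} (hq : Sp q) : ∃ q1 r : O, q = r * r * q1 ∧ Squarefree q1 ∧ ¬ ωg ∣ r ∧ Sp q1 := by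
  obtain ⟨q1, r, rfl, h1, h2, h3⟩ := sq_decomp hq.odd
  refine ⟨q1, r, rfl, h1, h2, ?_⟩
  exact Sp.of_mul_left (Sp_sq r h2) hq


/-! ### Part G: the sieve -/

/-- elements of the ball that are `1` mod `2` -/
def SB (N : ℝ) : Finset O := (Bl N).filter Sp

/-- squarefree nonunits -/
def QB (Q : ℝ) : Finset O := (Bl Q).filter (fun q => Sp q ∧ Squarefree q ∧ ¬ IsUnit q)

/-- nonzero elements of the ball -/
def nz (N : ℝ) : Finset O := (Bl N).filter (fun n => n ≠ 0)

theorem mem_SB {N : ℝ} {n : O} : n ∈ SB N ↔ Nm n ≤ N ∧ Sp n := by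
  unfold SB; rw [Finset.mem_filter, mem_Bl]

theorem mem_QB {N : ℝ} {n : O} : n ∈ QB N ↔ Nm n ≤ N ∧ Sp n ∧ Squarefree n ∧ ¬ IsUnit n := by
  unfold QB; rw [Finset.mem_filter, mem_Bl]

theorem mem_nz {N : ℝ} {n : O} : n ∈ nz N ↔ Nm n ≤ N ∧ n ≠ 0 := by
  unfold nz; rw [Finset.mem_filter, mem_Bl]

/-- averages of `W` -/
def US (χ : O → O → ℤ) (X Q : ℝ) : ℝ := ∑ q ∈ QB Q, ‖W χ X q‖

/-- averages of `W` -/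
def VS (χ : O → O → ℤ) (X Q : ℝ) : ℝ := ∑ q ∈ SB Q, ‖W χ X q‖

/-- averages of `W` -/
def TS (χ : O → O → ℤ) (X N : ℝ) : ℝ := ∑ n ∈ SB N, ∑ m ∈ SB N, ‖W χ X (n * m)‖

theorem sum_le_of_image {α β : Type} [DecidableEq α] [Nonempty α] {s : Finset β} {t : Finset α} (g : α → β) (f : β → ℝ)
    (hf : ∀ x ∈ t, 0 ≤ f (g x)) (h : ∀ b ∈ s, ∃ x ∈ t, g x = b) : ∑ b ∈ s, f b ≤ ∑ x ∈ t, f (g x) := by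
  choose! i hi hg using h
  have e : ∑ b ∈ s, f b = ∑ x ∈ s.image i, f (g x) := by
    rw [Finset.sum_image]
    · apply Finset.sum_congr rfl; intro b hb; rw [hg b hb]
    · intro a ha b hb hab
      have := congrArg g hab
      rwa [hg a ha, hg b hb] at this
  rw [e]
  apply Finset.sum_le_sum_of_subset_of_nonneg
  · intro x hx; rw [Finset.mem_image] at hx; obtain ⟨b, hb, rfl⟩ := hx; exact hi b hb
  · intro x hx _; exact hf x hx

/-- units in the ball -/
def UB (Y : ℝ) : Finset O := (Bl Y).filter (fun q => IsUnit q)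

theorem mem_UB {Y : ℝ} {n : O} : n ∈ UB Y ↔ Nm n ≤ Y ∧ IsUnit n := by
  unfold UB; rw [Finset.mem_filter, mem_Bl]

theorem UB_card (Y : ℝ) : ((UB Y).card : ℝ) ≤ 4 := by
  have hsub : UB Y ⊆ ({1, -1, ig, -ig} : Finset O) := by
    intro y hy
    rw [mem_UB] at hy
    rcases unit_cases hy.2 with h | h | h | h <;> simp [h]
  have := (Finset.card_le_card hsub).trans Finset.card_le_four
  exact_mod_cast this

set_option maxHeartbeats 400000 in
theorem V_le {χ : O → O → ℤ} (hχ : IsQuadSym χ) {δ : ℝ} (hδ : 0 < δ) : ∃ C : ℝ, 0 < C ∧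
    ∀ X Q A : ℝ, 0 < X → 1 ≤ Q → 0 ≤ A →
      (∀ X' Q', 0 < X' → X' ≤ X → 1 ≤ Q' → Q' ≤ Q → US χ X' Q' ≤ A * Q') →
      VS χ X Q ≤ C * Q ^ δ * (Real.sqrt Q * (1 + X) + A * Q) := by
  obtain ⟨D, hD0, hD⟩ := divisor_bound hδ
  have hCg := Cg_pos
  set Z2 := ∑' n : O, Nm n ^ (-(2:ℝ)) with hZ2
  have hsZ := summable_Nm_rpow (σ := 2) (by norm_num)
  have hZ : 0 ≤ Z2 := tsum_nonneg (fun n => Real.rpow_nonneg (Nm_nonneg _) _)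
  refine ⟨D * (Z2 + 36 * (1 + Cg)), by positivity, ?_⟩
  intro X Q A hX hQ hA hU
  have hQ0 : 0 < Q := by linarith
  have hsQ : 1 ≤ Real.sqrt Q := Real.one_le_sqrt.2 hQ
  let R := (Bl (Real.sqrt Q)).filter (fun r => ¬ ωg ∣ r)
  let G : O → Finset O := fun r => (Bl (Q / Nm r ^ 2)).filter (fun q => Sp q ∧ Squarefree q)
  have s1 : VS χ X Q ≤ ∑ x ∈ R.sigma G, ‖W χ X (x.1 * x.1 * x.2)‖ := by
    apply sum_le_of_image (fun x : (Σ _ : O, O) => x.1 * x.1 * x.2) (fun q => ‖W χ X q‖)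
    · intros; exact norm_nonneg _
    · intro q hq
      rw [mem_SB] at hq
      obtain ⟨q1, r, rfl, h1, h2, h3⟩ := sq_decomp_Sp hq.2
      have hr := one_le_Nm (odd_ne_zero h2)
      have hq1 := one_le_Nm h3.ne_zero
      have hN := hq.1
      rw [Nm_mul, Nm_mul] at hN
      refine ⟨⟨r, q1⟩, ?_, rfl⟩
      rw [Finset.mem_sigma, Finset.mem_filter, Finset.mem_filter, mem_Bl, mem_Bl]
      refine ⟨⟨?_, h2⟩, ?_, h3, h1⟩
      · apply Real.le_sqrt_of_sq_le
        nlinarith [mul_pos (show 0 < Nm r by linarith) (show 0 < Nm r by linarith)]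
      · rw [le_div_iff₀ (by positivity)]; nlinarith
  rw [Finset.sum_sigma] at s1
  have s2 : ∀ r ∈ R, ∑ q ∈ G r, ‖W χ X (r * r * q)‖ ≤
      D * Q ^ δ * (A * Q * Nm r ^ (-(2:ℝ)) + 4 * (1 + Cg * X)) := by
    intro r hr
    rw [Finset.mem_filter, mem_Bl] at hr
    have hr0 := odd_ne_zero hr.2
    have hN := one_le_Nm hr0
    have hN0 : 0 < Nm r := by linarith
    have hNQ : Nm r ^ 2 ≤ Q := by
      have := Real.sq_sqrt hQ0.le
      nlinarith [hr.1]
    have hNQ1 : Nm r ≤ Q := by nlinarith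
    have hQ' : 1 ≤ Q / Nm r ^ 2 := by rw [le_div_iff₀ (by positivity)]; linarith
    have hQ'' : Q / Nm r ^ 2 ≤ Q := div_le_self hQ0.le (by nlinarith)
    have t1 : ∑ q ∈ G r, ‖W χ X (r * r * q)‖ ≤ ∑ q ∈ G r, ∑ d ∈ dv r, ‖W χ (X / Nm d) q‖ := by
      apply Finset.sum_le_sum; intro q hq
      rw [Finset.mem_filter] at hq
      exact W_sq_le hχ hr.2 hq.2.1.odd hX
    rw [Finset.sum_comm] at t1
    have t2 : ∀ d ∈ dv r, ∑ q ∈ G r, ‖W χ (X / Nm d) q‖ ≤ A * (Q / Nm r ^ 2) + 4 * (1 + Cg * X) := by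
      intro d hd
      have hd1 := one_le_Nm (dv_ne_zero hr0 hd)
      have hX' : 0 < X / Nm d := by positivity
      have hX'' : X / Nm d ≤ X := div_le_self hX.le hd1
      have sub : G r ⊆ QB (Q / Nm r ^ 2) ∪ UB (Q / Nm r ^ 2) := by
        intro q hq
        rw [Finset.mem_filter, mem_Bl] at hq
        rw [Finset.mem_union, mem_QB, mem_UB]
        by_cases hu : IsUnit q
        · exact Or.inr ⟨hq.1, hu⟩
        · exact Or.inl ⟨hq.1, hq.2.1, hq.2.2, hu⟩
      have u1 : ∑ q ∈ G r, ‖W χ (X / Nm d) q‖ ≤ ∑ q ∈ QB (Q / Nm r ^ 2) ∪ UB (Q / Nm r ^ 2), ‖W χ (X / Nm d) q‖ :=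
        Finset.sum_le_sum_of_subset_of_nonneg sub (fun _ _ _ => norm_nonneg _)
      have u2 := Finset.sum_union_inter (s₁ := QB (Q / Nm r ^ 2)) (s₂ := UB (Q / Nm r ^ 2)) (f := fun q => ‖W χ (X / Nm d) q‖)
      have u3 : 0 ≤ ∑ q ∈ QB (Q / Nm r ^ 2) ∩ UB (Q / Nm r ^ 2), ‖W χ (X / Nm d) q‖ :=
        Finset.sum_nonneg (fun _ _ => norm_nonneg _)
      have u4 := hU (X / Nm d) (Q / Nm r ^ 2) hX' hX'' hQ' hQ''
      have u5 : ∑ q ∈ UB (Q / Nm r ^ 2), ‖W χ (X / Nm d) q‖ ≤ 4 * (1 + Cg * X) := by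
        have : ∀ q ∈ UB (Q / Nm r ^ 2), ‖W χ (X / Nm d) q‖ ≤ 1 + Cg * X := by
          intro q hq
          rw [mem_UB] at hq
          refine (W_le' hχ (omega_not_dvd_unit hq.2) hX').trans ?_
          gcongr
        refine (Finset.sum_le_card_nsmul _ _ _ this).trans ?_
        rw [nsmul_eq_mul]
        exact mul_le_mul_of_nonneg_right (UB_card _) (by positivity)
      unfold US at u4
      linarith
    have t3 := Finset.sum_le_card_nsmul _ _ _ t2
    rw [nsmul_eq_mul] at t3
    have t4 : ((dv r).card : ℝ) ≤ D * Q ^ δ := by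
      refine (hD r hr0).trans ?_
      gcongr
    have e : A * (Q / Nm r ^ 2) = A * Q * Nm r ^ (-(2:ℝ)) := by
      rw [Real.rpow_neg hN0.le, Real.rpow_two]; field_simp
    rw [e] at t3
    refine t1.trans (t3.trans ?_)
    have hn : 0 ≤ Nm r ^ (-(2:ℝ)) := Real.rpow_nonneg hN0.le _
    exact mul_le_mul_of_nonneg_right t4 (by positivity)
  refine s1.trans ((Finset.sum_le_sum s2).trans ?_)
  rw [← Finset.mul_sum, Finset.sum_add_distrib, ← Finset.mul_sum, Finset.sum_const, nsmul_eq_mul]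
  have c1 : (R.card : ℝ) ≤ 9 * Real.sqrt Q := by
    refine le_trans ?_ (card_Bl hsQ)
    exact_mod_cast Finset.card_filter_le _ _
  have c2 : ∑ r ∈ R, Nm r ^ (-(2:ℝ)) ≤ Z2 :=
    hsZ.sum_le_tsum _ (fun n _ => Real.rpow_nonneg (Nm_nonneg _) _)
  have hAQ : 0 ≤ A * Q := by positivity
  have hP : 0 ≤ D * Q ^ δ := by positivity
  calc _ ≤ D * Q ^ δ * (A * Q * Z2 + 9 * Real.sqrt Q * (4 * (1 + Cg * X))) := by gcongr
    _ ≤ D * Q ^ δ * ((Z2 + 36 * (1 + Cg)) * (Real.sqrt Q * (1 + X) + A * Q)) := by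
      gcongr
      have p1 : 0 ≤ Real.sqrt Q * (1 + X) := by positivity
      have p2 : 9 * Real.sqrt Q * (4 * (1 + Cg * X)) ≤ 36 * (1 + Cg) * (Real.sqrt Q * (1 + X)) := by
        have : 1 + Cg * X ≤ (1 + Cg) * (1 + X) := by nlinarith
        have := mul_le_mul_of_nonneg_left this (show 0 ≤ 36 * Real.sqrt Q by positivity)
        nlinarith
      nlinarith [mul_nonneg hZ p1, mul_nonneg hCg.le hAQ]
    _ = _ := by ring

theorem T_le_V {χ : O → O → ℤ} {δ : ℝ} (hδ : 0 < δ) : ∃ C : ℝ, 0 < C ∧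
    ∀ X N : ℝ, 1 ≤ N → TS χ X N ≤ C * (N ^ 2) ^ δ * VS χ X (N ^ 2) := by
  obtain ⟨D, hD0, hD⟩ := divisor_bound hδ
  refine ⟨D, hD0, fun X N hN => ?_⟩
  unfold TS VS
  rw [← Finset.sum_product', Finset.mul_sum]
  rw [← Finset.sum_fiberwise_of_maps_to (s := SB N ×ˢ SB N) (t := SB (N ^ 2)) (g := fun p => p.1 * p.2)]
  · apply Finset.sum_le_sum
    intro q hq
    rw [mem_SB] at hq
    have hq0 := hq.2.ne_zero
    have e : ∑ p ∈ (SB N ×ˢ SB N).filter (fun p => p.1 * p.2 = q), ‖W χ X (p.1 * p.2)‖ =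
        ∑ p ∈ (SB N ×ˢ SB N).filter (fun p => p.1 * p.2 = q), ‖W χ X q‖ := by
      apply Finset.sum_congr rfl; intro p hp; rw [Finset.mem_filter] at hp; rw [hp.2]
    rw [e, Finset.sum_const, nsmul_eq_mul]
    apply mul_le_mul_of_nonneg_right _ (norm_nonneg _)
    have h1 : ((SB N ×ˢ SB N).filter (fun p => p.1 * p.2 = q)).card ≤ (dv q).card := by
      apply Finset.card_le_card_of_injOn (fun p => p.1)
      · intro p hp
        rw [Finset.mem_coe, Finset.mem_filter] at hp
        rw [Finset.mem_coe, mem_dv hq0]; exact ⟨p.2, hp.2.symm⟩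
      · rintro ⟨a, b⟩ hp ⟨a', b'⟩ hp' h
        rw [Finset.mem_coe, Finset.mem_filter, Finset.mem_product, mem_SB] at hp hp'
        simp only at h hp hp'
        subst h
        have : b = b' := mul_left_cancel₀ hp.1.1.2.ne_zero (hp.2.trans hp'.2.symm)
        rw [this]
    have h2 : (((SB N ×ˢ SB N).filter (fun p => p.1 * p.2 = q)).card : ℝ) ≤ (dv q).card := by exact_mod_cast h1
    refine h2.trans ((hD q hq0).trans ?_)
    have := Nm_nonneg q
    have := hq.1
    gcongr
  · rintro ⟨a, b⟩ hp
    rw [Finset.mem_product, mem_SB, mem_SB] at hp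
    rw [mem_SB, Nm_mul]
    refine ⟨?_, hp.1.2.mul hp.2.2⟩
    have := Nm_nonneg a
    have := Nm_nonneg b
    nlinarith [hp.1.1, hp.2.1]

theorem T_le {χ : O → O → ℤ} (hχ : IsQuadSym χ) {δ : ℝ} (hδ : 0 < δ) : ∃ C : ℝ, 0 < C ∧
    ∀ X N A : ℝ, 0 < X → 1 ≤ N → 0 ≤ A →
      (∀ X' Q', 0 < X' → X' ≤ X → 1 ≤ Q' → Q' ≤ N ^ 2 → US χ X' Q' ≤ A * Q') →
      TS χ X N ≤ C * N ^ δ * (N * (1 + X) + A * N ^ 2) := by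
  obtain ⟨C1, h1, H1⟩ := V_le hχ (δ := δ / 4) (by positivity)
  obtain ⟨C2, h2, H2⟩ := T_le_V (χ := χ) (δ := δ / 4) (by positivity)
  refine ⟨C2 * C1, by positivity, ?_⟩
  intro X N A hX hN hA hU
  have i1 := H1 X (N ^ 2) A hX (by nlinarith) hA hU
  have i2 := H2 X N hN
  rw [Real.sqrt_sq (by linarith)] at i1
  have e : (N ^ 2) ^ (δ / 4) * (N ^ 2) ^ (δ / 4) = N ^ δ := by
    rw [← Real.rpow_natCast N 2, ← Real.rpow_mul (by linarith), ← Real.rpow_add (by linarith)]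
    congr 1; push_cast; ring
  have hp : 0 ≤ (N ^ 2) ^ (δ / 4) := by positivity
  calc _ ≤ _ := i2
    _ ≤ C2 * (N ^ 2) ^ (δ / 4) * (C1 * (N ^ 2) ^ (δ / 4) * (N * (1 + X) + A * N ^ 2)) := by gcongr
    _ = C2 * C1 * ((N ^ 2) ^ (δ / 4) * (N ^ 2) ^ (δ / 4)) * (N * (1 + X) + A * N ^ 2) := by ring
    _ = _ := by rw [e]


/-! ### Part G2: duality and extension of the sieve -/

theorem sieve_SB {χ : O → O → ℤ} (hχ : IsQuadSym χ) {X N : ℝ} (hX : 0 < X) {S : Finset O}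
    (hS : ∀ m ∈ S, Sp m ∧ Nm m ≤ X) {a : O → ℂ} (ha : ∀ n, ‖a n‖ ≤ 1) :
    ∑ m ∈ S, ‖∑ n ∈ SB N, a n * (χ n m : ℂ)‖ ^ 2 ≤ Real.exp π * TS χ X N := by
  set w : O → ℝ := fun m => Real.exp (-π / X * Nm m) with hw
  set g : O → ℂ := fun m => ∑ n ∈ SB N, a n * (χ m n : ℂ) with hg
  have hsum : ∀ n ∈ SB N, ∀ n' ∈ SB N, Summable (fun m : O =>
      a n * (starRingEnd ℂ) (a n') * ((χ m (n * n') : ℂ) * (w m : ℂ))) := by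
    intro n hn n' hn'
    rw [mem_SB] at hn hn'
    exact (W_summable hχ (omega_not_dvd_mul hn.2.odd hn'.2.odd) hX).mul_left _
  have hexp : ∀ m, ((‖g m‖ ^ 2 * w m : ℝ) : ℂ) = ∑ n ∈ SB N, ∑ n' ∈ SB N,
      a n * (starRingEnd ℂ) (a n') * ((χ m (n * n') : ℂ) * (w m : ℂ)) := by
    intro m
    have e1 : ((‖g m‖ ^ 2 : ℝ) : ℂ) = g m * (starRingEnd ℂ) (g m) := by
      rw [Complex.mul_conj, Complex.normSq_eq_norm_sq]
    rw [Complex.ofReal_mul, e1, hg]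
    simp only [map_sum, map_mul]
    rw [Finset.sum_mul_sum, Finset.sum_mul]
    apply Finset.sum_congr rfl; intro n hn
    rw [Finset.sum_mul]
    apply Finset.sum_congr rfl; intro n' hn'
    rw [mem_SB] at hn hn'
    rw [hχ.mul_den _ _ _ hn.2.odd hn'.2.odd, map_intCast]
    push_cast; ring
  have hcs : Summable (fun m => ((‖g m‖ ^ 2 * w m : ℝ) : ℂ)) := by
    simp_rw [hexp]
    exact summable_sum (fun n hn => summable_sum (fun n' hn' => hsum n hn n' hn'))
  have hrs : Summable (fun m => ‖g m‖ ^ 2 * w m) := by exact_mod_cast hcs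
  have hts : ((∑' m, ‖g m‖ ^ 2 * w m : ℝ) : ℂ) = ∑ n ∈ SB N, ∑ n' ∈ SB N,
      a n * (starRingEnd ℂ) (a n') * W χ X (n * n') := by
    rw [Complex.ofReal_tsum]
    simp_rw [hexp]
    rw [Summable.tsum_finsetSum (fun n hn => summable_sum (fun n' hn' => hsum n hn n' hn'))]
    apply Finset.sum_congr rfl; intro n hn
    rw [Summable.tsum_finsetSum (fun n' hn' => hsum n hn n' hn')]
    apply Finset.sum_congr rfl; intro n' hn'
    rw [tsum_mul_left]; rfl
  have hw0 : ∀ m, 0 ≤ w m := fun m => (Real.exp_pos _).le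
  have hT : ∑' m, ‖g m‖ ^ 2 * w m ≤ TS χ X N := by
    have h0 : 0 ≤ ∑' m, ‖g m‖ ^ 2 * w m := tsum_nonneg (fun m => mul_nonneg (by positivity) (hw0 m))
    have : ∑' m, ‖g m‖ ^ 2 * w m = ‖((∑' m, ‖g m‖ ^ 2 * w m : ℝ) : ℂ)‖ := by
      rw [Complex.norm_real, Real.norm_of_nonneg h0]
    rw [this, hts]
    unfold TS
    refine (norm_sum_le _ _).trans (Finset.sum_le_sum (fun n _ => ?_))
    refine (norm_sum_le _ _).trans (Finset.sum_le_sum (fun n' _ => ?_))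
    rw [norm_mul, norm_mul, RCLike.norm_conj]
    have := mul_le_one₀ (ha n) (norm_nonneg _) (ha n')
    exact mul_le_of_le_one_left (norm_nonneg _) this
  calc ∑ m ∈ S, ‖∑ n ∈ SB N, a n * (χ n m : ℂ)‖ ^ 2
      ≤ ∑ m ∈ S, Real.exp π * (‖g m‖ ^ 2 * w m) := by
        apply Finset.sum_le_sum
        intro m hm
        have e : ∑ n ∈ SB N, a n * (χ n m : ℂ) = g m := by
          apply Finset.sum_congr rfl; intro n hn
          rw [mem_SB] at hn
          rw [recip hχ hn.2 (hS m hm).1]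
        rw [e]
        have : 1 ≤ Real.exp π * w m := by
          rw [hw, ← Real.exp_add]
          apply Real.one_le_exp
          have : Nm m / X ≤ 1 := (div_le_one hX).2 (hS m hm).2
          have h2 : π + -π / X * Nm m = π * (1 - Nm m / X) := by ring
          rw [h2]; exact mul_nonneg Real.pi_pos.le (by linarith)
        nlinarith [sq_nonneg ‖g m‖]
    _ = Real.exp π * ∑ m ∈ S, (‖g m‖ ^ 2 * w m) := by rw [Finset.mul_sum]
    _ ≤ Real.exp π * TS χ X N := by
        gcongr
        exact (hrs.sum_le_tsum S (fun m _ => mul_nonneg (by positivity) (hw0 m))).trans hT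

theorem sum_nz_split (f : O → ℂ) (N : ℝ) : ∑ n ∈ nz N, f n =
    ∑ n ∈ SB N, f n + ∑ n ∈ SB N, f (ig * n) + ∑ n ∈ nz (N / 2), f (ωg * n) := by
  have hig : ig ≠ 0 := isUnit_ig.ne_zero
  have e1 : ∑ n ∈ SB N, f n = ∑ n ∈ (nz N).filter Sp, f n := by
    congr 1; ext n; rw [Finset.mem_filter, mem_nz, mem_SB]
    exact ⟨fun h => ⟨⟨h.1, h.2.ne_zero⟩, h.2⟩, fun h => ⟨h.1.1, h.2⟩⟩
  have e2 : ∑ n ∈ SB N, f (ig * n) = ∑ n ∈ (nz N).filter (fun n => ¬ Sp n ∧ ¬ ωg ∣ n), f n := by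
    refine Finset.sum_bij (fun n _ => ig * n) ?_ ?_ ?_ ?_
    · intro n hn
      rw [mem_SB] at hn
      rw [Finset.mem_filter, mem_nz, Nm_mul, Nm_ig, one_mul]
      exact ⟨⟨hn.1, mul_ne_zero hig hn.2.ne_zero⟩, not_Sp_ig_mul hn.2,
        omega_not_dvd_mul (omega_not_dvd_unit isUnit_ig) hn.2.odd⟩
    · intro a _ b _ h; exact mul_left_cancel₀ hig h
    · intro n hn
      rw [Finset.mem_filter, mem_nz] at hn
      have h := (Sp_or n hn.2.2).resolve_left hn.2.1
      have e : ig * (-(ig * n)) = n := by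
        have := ig_sq
        linear_combination (-n) * this
      refine ⟨-(ig * n), ?_, e⟩
      rw [mem_SB]
      refine ⟨?_, h.neg⟩
      have := congrArg Nm e
      rw [Nm_mul, Nm_ig, one_mul] at this
      rw [this]; exact hn.1.1
    · intros; rfl
  have e3 : ∑ n ∈ nz (N / 2), f (ωg * n) = ∑ n ∈ (nz N).filter (fun n => ωg ∣ n), f n := by
    refine Finset.sum_bij (fun n _ => ωg * n) ?_ ?_ ?_ ?_
    · intro n hn
      rw [mem_nz] at hn
      rw [Finset.mem_filter, mem_nz, Nm_mul, Nm_omega]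
      exact ⟨⟨by linarith [hn.1], mul_ne_zero omega_ne_zero hn.2⟩, Dvd.intro _ rfl⟩
    · intro a _ b _ h; exact mul_left_cancel₀ omega_ne_zero h
    · intro n hn
      rw [Finset.mem_filter, mem_nz] at hn
      obtain ⟨⟨h1, h2⟩, c, rfl⟩ := hn
      refine ⟨c, ?_, rfl⟩
      rw [Nm_mul, Nm_omega] at h1
      rw [mem_nz]
      exact ⟨by linarith, right_ne_zero_of_mul h2⟩
    · intros; rfl
  rw [e1, e2, e3, add_assoc, ← Finset.sum_union, ← Finset.sum_union]
  · congr 1; ext n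
    simp only [Finset.mem_union, Finset.mem_filter]
    by_cases h1 : Sp n <;> by_cases h2 : ωg ∣ n <;> simp [h1, h2]
  · rw [Finset.disjoint_left]; intro n hn hn'
    simp only [Finset.mem_union, Finset.mem_filter] at hn hn'
    rcases hn' with h | h
    · exact h.2.1 hn.2
    · exact hn.2.odd h.2
  · rw [Finset.disjoint_left]; intro n hn hn'
    simp only [Finset.mem_filter] at hn hn'
    exact hn.2.2 hn'.2

theorem nz_empty {N : ℝ} (h : N < 1) : nz N = ∅ := by
  apply Finset.eq_empty_of_forall_notMem
  intro n hn; rw [mem_nz] at hn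
  linarith [one_le_Nm hn.2, hn.1]

theorem three_sq (A B D : ℂ) : ‖A + B + D‖ ^ 2 ≤ 6 * ‖A‖ ^ 2 + 6 * ‖B‖ ^ 2 + 3 / 2 * ‖D‖ ^ 2 := by
  have h : ‖A + B + D‖ ≤ ‖A‖ + ‖B‖ + ‖D‖ := norm_add₃_le
  have h0 := norm_nonneg (A + B + D)
  have : ‖A + B + D‖ ^ 2 ≤ (‖A‖ + ‖B‖ + ‖D‖) ^ 2 := by gcongr
  nlinarith [sq_nonneg (‖A‖ - ‖B‖), sq_nonneg (4 * ‖A‖ - ‖D‖), sq_nonneg (4 * ‖B‖ - ‖D‖)]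

theorem sieve_ext {χ : O → O → ℤ} (hχ : IsQuadSym χ) {X N0 : ℝ} (hX : 0 < X) {S : Finset O}
    (hS : ∀ m ∈ S, Sp m ∧ Nm m ≤ X) {φ : ℝ → ℝ} (h0 : ∀ N, 0 ≤ N → 0 ≤ φ N)
    (h2 : ∀ N, 0 ≤ N → φ (N / 2) ≤ φ N / 2)
    (hT : ∀ N, 1 ≤ N → N ≤ N0 → TS χ X N ≤ φ N) (k : ℕ) :
    ∀ N : ℝ, 0 ≤ N → N ≤ N0 → N < 2 ^ k → ∀ a : O → ℂ, (∀ n, ‖a n‖ ≤ 1) →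
    ∑ m ∈ S, ‖∑ n ∈ nz N, a n * (χ n m : ℂ)‖ ^ 2 ≤ 48 * Real.exp π * φ N := by
  have hempty : ∀ N : ℝ, 0 ≤ N → N < 1 → ∀ a : O → ℂ,
      ∑ m ∈ S, ‖∑ n ∈ nz N, a n * (χ n m : ℂ)‖ ^ 2 ≤ 48 * Real.exp π * φ N := by
    intro N hN hN1 a
    rw [nz_empty hN1]
    have := h0 N hN
    simp; positivity
  induction k with
  | zero => intro N hN _ hN2 a _; exact hempty N hN (by simpa using hN2) a
  | succ k ih =>
    intro N hN hN0 hN2 a ha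
    rcases lt_or_ge N 1 with h1 | h1
    · exact hempty N hN h1 a
    have b1 := sieve_SB hχ (N := N) hX hS ha
    have b2 := sieve_SB hχ (N := N) hX hS (a := fun n => a (ig * n)) (fun n => ha _)
    have b3 := ih (N / 2) (by positivity) (by linarith) (by rw [pow_succ] at hN2; linarith)
      (fun n => a (ωg * n)) (fun n => ha _)
    have hTN := hT N h1 hN0
    have h2N := h2 N hN
    have hφ := h0 N hN
    have hchi : ∀ m ∈ S, ∀ c : O, ‖(χ c m : ℂ)‖ ^ 2 ≤ 1 := by
      intro m hm c
      have := chi_norm_le hχ (hS m hm).1.odd c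
      exact pow_le_one₀ (norm_nonneg _) this
    have key : ∀ m ∈ S, ‖∑ n ∈ nz N, a n * (χ n m : ℂ)‖ ^ 2 ≤
        6 * ‖∑ n ∈ SB N, a n * (χ n m : ℂ)‖ ^ 2 + 6 * ‖∑ n ∈ SB N, a (ig * n) * (χ n m : ℂ)‖ ^ 2 +
        3 / 2 * ‖∑ n ∈ nz (N / 2), a (ωg * n) * (χ n m : ℂ)‖ ^ 2 := by
      intro m hm
      have ho := (hS m hm).1.odd
      rw [sum_nz_split]
      have e : ∀ (c : O) (T : Finset O), ∑ n ∈ T, a (c * n) * (χ (c * n) m : ℂ) =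
          (χ c m : ℂ) * ∑ n ∈ T, a (c * n) * (χ n m : ℂ) := by
        intro c T
        rw [Finset.mul_sum]; apply Finset.sum_congr rfl; intro n _
        rw [chi_mul hχ ho]; push_cast; ring
      rw [e, e]
      refine (three_sq _ _ _).trans ?_
      rw [norm_mul, norm_mul, mul_pow, mul_pow]
      have p1 := mul_le_of_le_one_left (sq_nonneg ‖∑ n ∈ SB N, a (ig * n) * (χ n m : ℂ)‖) (hchi m hm ig)
      have p2 := mul_le_of_le_one_left (sq_nonneg ‖∑ n ∈ nz (N / 2), a (ωg * n) * (χ n m : ℂ)‖) (hchi m hm ωg)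
      linarith
    refine (Finset.sum_le_sum key).trans ?_
    rw [Finset.sum_add_distrib, Finset.sum_add_distrib, ← Finset.mul_sum, ← Finset.mul_sum, ← Finset.mul_sum]
    have hE := Real.exp_pos π
    have q1 : Real.exp π * TS χ X N ≤ Real.exp π * φ N := by gcongr
    have q2 : 48 * Real.exp π * φ (N / 2) ≤ 48 * Real.exp π * (φ N / 2) := by gcongr
    have q3 : 0 ≤ Real.exp π * φ N := by positivity
    nlinarith

theorem QB_card {Q : ℝ} (hQ : 1 ≤ Q) : ((QB Q).card : ℝ) ≤ 9 * Q := by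
  refine le_trans ?_ (card_Bl hQ)
  have : (QB Q).card ≤ (Bl Q).card := Finset.card_filter_le _ _
  exact_mod_cast this

theorem US_crude {χ : O → O → ℤ} (hχ : IsQuadSym χ) {X Q : ℝ} (hX : 0 < X) (hQ : 1 ≤ Q) :
    US χ X Q ≤ 9 * Cg * Real.sqrt Q * Q := by
  unfold US
  have : ∀ q ∈ QB Q, ‖W χ X q‖ ≤ Cg * Real.sqrt Q := by
    intro q hq
    rw [mem_QB] at hq
    refine (W_PV hχ hq.2.1.odd hq.2.2.1 hq.2.2.2 hX).trans ?_
    have := Cg_pos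
    have := hq.1
    gcongr
  refine (Finset.sum_le_card_nsmul _ _ _ this).trans ?_
  rw [nsmul_eq_mul]
  have h1 := QB_card hQ
  have h2 : 0 ≤ Cg * Real.sqrt Q := mul_nonneg Cg_pos.le (Real.sqrt_nonneg _)
  nlinarith

/-- from a bound for `US` to the sieve -/
theorem sieve_of_US {χ : O → O → ℤ} (hχ : IsQuadSym χ) {δ : ℝ} (hδ : 0 < δ) : ∃ C : ℝ, 0 < C ∧
    ∀ X N A : ℝ, 1 ≤ X → 1 ≤ N → 0 ≤ A →
      (∀ X' Q', 0 < X' → X' ≤ X → 1 ≤ Q' → Q' ≤ N ^ 2 → US χ X' Q' ≤ A * Q') →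
      ∀ S : Finset O, (∀ m ∈ S, Sp m ∧ Nm m ≤ X) → ∀ a : O → ℂ, (∀ n, ‖a n‖ ≤ 1) →
      ∑ m ∈ S, ‖∑ n ∈ nz N, a n * (χ n m : ℂ)‖ ^ 2 ≤ C * N ^ δ * (X * N + A * N ^ 2) := by
  obtain ⟨C, hC, H⟩ := T_le hχ hδ
  refine ⟨48 * Real.exp π * (2 * C), by positivity, ?_⟩
  intro X N A hX hN hA hU S hS a ha
  have hX0 : 0 < X := by linarith
  have hN0 : 0 < N := by linarith
  obtain ⟨k, hk⟩ := pow_unbounded_of_one_lt N (one_lt_two)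
  have := sieve_ext hχ hX0 hS (N0 := N) (φ := fun M => 2 * C * N ^ δ * (X * M + A * M ^ 2))
    (fun M hM => by positivity) (fun M hM => ?_) (fun M hM hMN => ?_) k N hN0.le le_rfl hk a ha
  · refine this.trans (le_of_eq ?_); ring
  · have h1 : X * (M / 2) + A * (M / 2) ^ 2 ≤ (X * M + A * M ^ 2) / 2 := by
      have : 0 ≤ A * M ^ 2 := by positivity
      nlinarith
    have h2 := mul_le_mul_of_nonneg_left h1 (show 0 ≤ 2 * C * N ^ δ by positivity)
    linarith
  · have h1 := H X M A hX0 hM hA (fun X' Q' a1 a2 a3 a4 => hU X' Q' a1 a2 a3 (a4.trans (by gcongr)))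
    refine h1.trans ?_
    have h3 : M ^ δ ≤ N ^ δ := Real.rpow_le_rpow (by linarith) hMN hδ.le
    have h4 : M * (1 + X) + A * M ^ 2 ≤ 2 * (X * M + A * M ^ 2) := by
      have : 0 ≤ A * M ^ 2 := by positivity
      nlinarith
    calc C * M ^ δ * (M * (1 + X) + A * M ^ 2) ≤ C * N ^ δ * (2 * (X * M + A * M ^ 2)) := by
          have : 0 ≤ M * (1 + X) + A * M ^ 2 := by positivity
          gcongr
      _ = _ := by ring

theorem sieve_crude {χ : O → O → ℤ} (hχ : IsQuadSym χ) {δ : ℝ} (hδ : 0 < δ) : ∃ C : ℝ, 0 < C ∧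
    ∀ X N : ℝ, 1 ≤ X → 1 ≤ N →
      ∀ S : Finset O, (∀ m ∈ S, Sp m ∧ Nm m ≤ X) → ∀ a : O → ℂ, (∀ n, ‖a n‖ ≤ 1) →
      ∑ m ∈ S, ‖∑ n ∈ nz N, a n * (χ n m : ℂ)‖ ^ 2 ≤ C * N ^ δ * (X * N + N ^ 3) := by
  obtain ⟨C, hC, H⟩ := sieve_of_US hχ hδ
  have hCg := Cg_pos
  refine ⟨C * (1 + 9 * Cg), by positivity, ?_⟩
  intro X N hX hN S hS a ha
  have hN0 : 0 < N := by linarith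
  have h1 := H X N (9 * Cg * N) hX hN (by positivity) (fun X' Q' a1 a2 a3 a4 => ?_) S hS a ha
  · refine h1.trans ?_
    rw [show C * (1 + 9 * Cg) * N ^ δ * (X * N + N ^ 3) = C * N ^ δ * ((1 + 9 * Cg) * (X * N + N ^ 3)) by ring]
    gcongr
    have : 0 ≤ X * N := by positivity
    have : 0 ≤ N ^ 3 := by positivity
    nlinarith [mul_nonneg hCg.le ‹0 ≤ X * N›]
  · refine (US_crude hχ a1 a3).trans ?_
    have : Real.sqrt Q' ≤ N := Real.sqrt_le_left hN0.le |>.2 a4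
    gcongr


/-! ### Part G3: the improved sieve -/

/-- character sums over balls -/
def AS (χ : O → O → ℤ) (j : ℕ) (q : O) : ℂ := ∑ k ∈ nz (j:ℝ), (χ k q : ℂ)

theorem Nm_nat (k : O) : ∃ N : ℕ, Nm k = N := by
  refine ⟨(Zsqrtd.norm k).toNat, ?_⟩
  have : ((Zsqrtd.norm k).toNat : ℤ) = Zsqrtd.norm k := Int.toNat_of_nonneg (GaussianInt.norm_nonneg k)
  unfold Nm
  exact_mod_cast this.symm

theorem geom_tail {x : ℝ} (h0 : 0 ≤ x) (h1 : x < 1) (N : ℕ) :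
    HasSum (fun j : ℕ => if N ≤ j then x ^ j * (1 - x) else 0) (x ^ N) := by
  have h := (hasSum_geometric_of_lt_one h0 h1).mul_left (x ^ N * (1 - x))
  have e : x ^ N * (1 - x) * (1 - x)⁻¹ = x ^ N := by
    rw [mul_assoc, mul_inv_cancel₀ (by linarith), mul_one]
  rw [e] at h
  have hinj : Function.Injective (fun j : ℕ => j + N) := fun a b h => by simpa using h
  rw [← hinj.hasSum_iff]
  · have e2 : ((fun j : ℕ => if N ≤ j then x ^ j * (1 - x) else 0) ∘ fun j => j + N) =
        fun j => x ^ N * (1 - x) * x ^ j := by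
      funext j; simp only [Function.comp]; rw [if_pos (by omega), pow_add]; ring
    rw [e2]; exact h
  · intro j hj
    rw [if_neg]
    intro hN
    exact hj ⟨j - N, by simp; omega⟩

theorem AS_summable {χ : O → O → ℤ} (hχ : IsQuadSym χ) {q : O} (ho : ¬ ωg ∣ q) {x : ℝ}
    (hx0 : 0 ≤ x) (hx1 : x < 1) : Summable (fun j : ℕ => x ^ j * ‖AS χ j q‖) := by
  have hxn : ‖x‖ < 1 := by rwa [Real.norm_of_nonneg hx0]
  have h1' : Summable (fun j : ℕ => ((j:ℝ) ^ 1 * x ^ j)) :=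
    summable_pow_mul_geometric_of_norm_lt_one 1 hxn
  have h1 : Summable (fun j : ℕ => 9 * ((j:ℝ) ^ 1 * x ^ j)) := h1'.mul_left 9
  refine Summable.of_nonneg_of_le (fun j => by positivity) (fun j => ?_) h1
  have : ‖AS χ j q‖ ≤ 9 * j := by
    rcases Nat.eq_zero_or_pos j with h | h
    · subst h; unfold AS; rw [nz_empty (by norm_num)]; simp
    · have hj : (1:ℝ) ≤ j := by exact_mod_cast h
      unfold AS
      refine (norm_sum_le _ _).trans ?_
      refine (Finset.sum_le_card_nsmul _ _ 1 (fun k _ => chi_norm_le hχ ho k)).trans ?_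
      rw [nsmul_eq_mul, mul_one]
      refine le_trans ?_ (card_Bl hj)
      have : (nz (j:ℝ)).card ≤ (Bl (j:ℝ)).card := Finset.card_filter_le _ _
      exact_mod_cast this
  have hp := pow_nonneg hx0 j
  rw [pow_one]
  nlinarith

theorem W_abel {χ : O → O → ℤ} (hχ : IsQuadSym χ) {q : O} (ho : ¬ ωg ∣ q) (hu : ¬ IsUnit q)
    {X : ℝ} (hX : 0 < X) : ‖W χ X q‖ ≤
      ∑' j : ℕ, (1 - Real.exp (-π / X)) * (Real.exp (-π / X) ^ j * ‖AS χ j q‖) := by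
  set x := Real.exp (-π / X) with hx
  have hx0 : 0 < x := Real.exp_pos _
  have hx1 : x < 1 := by rw [hx, Real.exp_lt_one_iff]; exact div_neg_of_neg_of_pos (by linarith [Real.pi_pos]) hX
  choose Nn hNn using Nm_nat
  let F : O → ℕ → ℂ := fun k j => (χ k q : ℂ) * ((if Nn k ≤ j then x ^ j * (1 - x) else 0 : ℝ) : ℂ)
  have hpow : ∀ k, Real.exp (-π / X * Nm k) = x ^ (Nn k) := by
    intro k; rw [hx, ← Real.exp_nat_mul, hNn k]; congr 1; ring
  have hnn : ∀ k j, 0 ≤ (if Nn k ≤ j then x ^ j * (1 - x) else 0 : ℝ) := by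
    intro k j; split_ifs
    · have := sub_pos.2 hx1; positivity
    · exact le_rfl
  have hprod : Summable (fun p : O × ℕ => (if Nn p.1 ≤ p.2 then x ^ p.2 * (1 - x) else 0 : ℝ)) := by
    rw [summable_prod_of_nonneg (fun p => hnn _ _)]
    refine ⟨fun k => (geom_tail hx0.le hx1 (Nn k)).summable, ?_⟩
    have : ∀ k, ∑' j : ℕ, (if Nn k ≤ j then x ^ j * (1 - x) else 0 : ℝ) = Real.exp (-(π / X) * Nm k) := by
      intro k; rw [(geom_tail hx0.le hx1 (Nn k)).tsum_eq, ← hpow]; congr 1; ring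
    simp_rw [this]
    exact summable_gauss (by positivity)
  have hF : Summable (Function.uncurry F) := by
    refine Summable.of_norm_bounded hprod ?_
    rintro ⟨k, j⟩
    simp only [Function.uncurry, F]
    rw [norm_mul, Complex.norm_real, Real.norm_of_nonneg (hnn _ _)]
    exact mul_le_of_le_one_left (hnn _ _) (chi_norm_le hχ ho k)
  have e1 : W χ X q = ∑' k, ∑' j, F k j := by
    unfold W
    apply tsum_congr; intro k
    rw [hpow, ← (geom_tail hx0.le hx1 (Nn k)).tsum_eq, Complex.ofReal_tsum, ← tsum_mul_left]
  rw [e1, ← hF.tsum_comm]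
  have e2 : ∀ j, ∑' k, F k j = ((x ^ j * (1 - x) : ℝ) : ℂ) * AS χ j q := by
    intro j
    rw [tsum_eq_sum (s := nz (j:ℝ))]
    · unfold AS; rw [Finset.mul_sum]
      apply Finset.sum_congr rfl
      intro k hk
      rw [mem_nz, hNn k] at hk
      have : Nn k ≤ j := by exact_mod_cast hk.1
      simp only [F, if_pos this]; ring
    · intro k hk
      by_cases h0 : k = 0
      · simp only [F]; rw [h0, chi_zero hχ ho hu]; simp
      · have : ¬ Nn k ≤ j := by
          intro h; apply hk; rw [mem_nz, hNn k]; exact ⟨by exact_mod_cast h, h0⟩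
        simp only [F, if_neg this]; simp
  simp_rw [e2]
  refine tsum_of_norm_bounded ((AS_summable hχ ho hx0.le hx1).mul_left (1 - x)).hasSum ?_
  intro j
  rw [norm_mul, Complex.norm_real, Real.norm_of_nonneg (by have := sub_pos.2 hx1; positivity)]
  rw [← mul_assoc, mul_comm (x ^ j)]


theorem sum_sq_le_card {S : Finset O} (f : O → ℝ) (hf : ∀ q ∈ S, 0 ≤ f q) {c B : ℝ} (hc : (S.card : ℝ) ≤ c)
    (hB : ∑ q ∈ S, f q ^ 2 ≤ B) : ∑ q ∈ S, f q ≤ Real.sqrt (c * B) := by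
  apply Real.le_sqrt_of_sq_le
  have h := sq_sum_le_card_mul_sum_sq (s := S) (f := f)
  refine h.trans ?_
  have : 0 ≤ ∑ q ∈ S, f q ^ 2 := Finset.sum_nonneg (fun _ _ => sq_nonneg _)
  have : (0:ℝ) ≤ S.card := by positivity
  have : 0 ≤ c := this.trans hc
  gcongr

theorem W_avg {χ : O → O → ℤ} (hχ : IsQuadSym χ) {δ : ℝ} (hδ : 0 < δ) (hδ1 : δ ≤ 1) : ∃ C : ℝ, 0 < C ∧
    ∀ Y Q : ℝ, 1 ≤ Y → Y ^ 2 ≤ Q → ∀ S : Finset O, S ⊆ QB Q → ∀ x : O → ℝ,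
      (∀ q ∈ S, Y / 2 ≤ x q ∧ x q ≤ Y) →
      ∑ q ∈ S, ‖W χ (x q) q‖ ≤ C * Y ^ δ * (Q * Real.sqrt Y) := by
  obtain ⟨C, hC, H⟩ := sieve_crude hχ hδ
  refine ⟨2 * π * (2 * (3 * Real.sqrt C)), by positivity, ?_⟩
  intro Y Q hY hYQ S hS x hx
  have hY0 : 0 < Y := by linarith
  have hQ : 1 ≤ Q := by nlinarith
  have hQ0 : 0 < Q := by linarith
  set ρ := Real.exp (-π / Y) with hρ
  have hρ0 : 0 < ρ := Real.exp_pos _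
  have hρ1 : ρ < 1 := by
    rw [hρ, Real.exp_lt_one_iff]; exact div_neg_of_neg_of_pos (by linarith [Real.pi_pos]) hY0
  have hcard : (S.card : ℝ) ≤ 9 * Q := by
    refine le_trans ?_ (QB_card hQ)
    exact_mod_cast Finset.card_le_card hS
  -- pointwise
  have p1 : ∀ q ∈ S, ‖W χ (x q) q‖ ≤ ∑' j : ℕ, 2 * π / Y * (ρ ^ j * ‖AS χ j q‖) := by
    intro q hq
    have hq' := mem_QB.1 (hS hq)
    obtain ⟨hx1, hx2⟩ := hx q hq
    have hx0 : 0 < x q := by linarith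
    refine (W_abel hχ hq'.2.1.odd hq'.2.2.2 hx0).trans ?_
    have hr0 : 0 < Real.exp (-π / x q) := Real.exp_pos _
    have hr1 : Real.exp (-π / x q) < 1 := by
      rw [Real.exp_lt_one_iff]; exact div_neg_of_neg_of_pos (by linarith [Real.pi_pos]) hx0
    refine Summable.tsum_le_tsum (fun j => ?_) ((AS_summable hχ hq'.2.1.odd hr0.le hr1).mul_left _)
      ((AS_summable hχ hq'.2.1.odd hρ0.le hρ1).mul_left _)
    have a1 : 1 - Real.exp (-π / x q) ≤ 2 * π / Y := by
      have := Real.add_one_le_exp (-π / x q)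
      have h2 : π / x q ≤ 2 * π / Y := by
        rw [div_le_div_iff₀ hx0 hY0]; nlinarith [Real.pi_pos]
      have h3 : -π / x q = - (π / x q) := by ring
      rw [h3] at this ⊢
      linarith
    have a2 : Real.exp (-π / x q) ≤ ρ := by
      rw [hρ]; apply Real.exp_le_exp.2
      rw [div_le_div_iff₀ hx0 hY0]; nlinarith [Real.pi_pos]
    gcongr
  have p2 : ∀ j : ℕ, ∑ q ∈ S, ‖AS χ j q‖ ≤
      3 * Real.sqrt C * (Y ^ δ * (Q * Real.sqrt Y)) * (1 + j / Y) ^ 2 := by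
    intro j
    rcases Nat.eq_zero_or_pos j with h | h
    · have : ∑ q ∈ S, ‖AS χ j q‖ = 0 := by
        apply Finset.sum_eq_zero; intro q _; rw [h]; unfold AS; rw [nz_empty (by norm_num)]; simp
      rw [this]; positivity
    have hj : (1:ℝ) ≤ j := by exact_mod_cast h
    have hj0 : (0:ℝ) < j := by linarith
    have h1 := H Q j hQ hj S (fun q hq => ⟨(mem_QB.1 (hS hq)).2.1, (mem_QB.1 (hS hq)).1⟩)
      (fun _ => 1) (by simp)
    simp only [one_mul] at h1
    have h2 := sum_sq_le_card (fun q => ‖AS χ j q‖) (fun _ _ => norm_nonneg _) hcard h1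
    refine h2.trans ?_
    apply Real.sqrt_le_iff.2
    refine ⟨by positivity, ?_⟩
    set J := (j:ℝ) / Y with hJ
    have hJ0 : 0 < J := by positivity
    have ej : (j:ℝ) = J * Y := by rw [hJ]; field_simp
    have k1 : (j:ℝ) ^ δ ≤ (1 + J) * Y ^ δ := by
      rw [ej, Real.mul_rpow hJ0.le hY0.le]
      gcongr
      calc J ^ δ ≤ (1 + J) ^ δ := by gcongr; linarith
        _ ≤ (1 + J) ^ (1:ℝ) := Real.rpow_le_rpow_of_exponent_le (by linarith) hδ1
        _ = 1 + J := Real.rpow_one _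
    have k2 : Q * (j:ℝ) + (j:ℝ) ^ 3 ≤ Q * Y * (1 + J) ^ 3 := by
      rw [ej]
      have : (J * Y) ^ 3 ≤ J ^ 3 * Y * Q := by
        have : 0 ≤ J ^ 3 * Y := by positivity
        nlinarith
      have h3 : 0 ≤ Q * Y := by positivity
      have h4 : J + J ^ 3 ≤ (1 + J) ^ 3 := by nlinarith [sq_nonneg J]
      nlinarith [mul_le_mul_of_nonneg_left h4 h3]
    have k3 : Y ^ δ ≤ Y ^ δ * Y ^ δ := by
      have := Real.one_le_rpow hY hδ.le
      nlinarith
    have hs1 := Real.sq_sqrt hC.le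
    have hs2 := Real.sq_sqrt hY0.le
    calc 9 * Q * (C * (j:ℝ) ^ δ * (Q * j + (j:ℝ) ^ 3))
        ≤ 9 * Q * (C * ((1 + J) * (Y ^ δ * Y ^ δ)) * (Q * Y * (1 + J) ^ 3)) := by
          gcongr
          exact k1.trans (by gcongr)
      _ = (3 * Real.sqrt C * (Y ^ δ * (Q * Real.sqrt Y)) * (1 + J) ^ 2) ^ 2 := by
          rw [show (3 * Real.sqrt C * (Y ^ δ * (Q * Real.sqrt Y)) * (1 + J) ^ 2) ^ 2 =
            9 * (Real.sqrt C ^ 2) * (Y ^ δ * Y ^ δ) * Q ^ 2 * (Real.sqrt Y ^ 2) * (1 + J) ^ 4 by ring, hs1, hs2]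
          ring
  -- sum
  set K := 3 * Real.sqrt C * (Y ^ δ * (Q * Real.sqrt Y)) with hK
  have hK0 : 0 ≤ K := by positivity
  set τ := Real.exp (-1 / Y) with hτ
  have hτ0 : 0 < τ := Real.exp_pos _
  have hτ1 : τ < 1 := by rw [hτ, Real.exp_lt_one_iff]; exact div_neg_of_neg_of_pos (by norm_num) hY0
  have p3 : ∀ j : ℕ, ∑ q ∈ S, 2 * π / Y * (ρ ^ j * ‖AS χ j q‖) ≤ 2 * π / Y * K * τ ^ j := by
    intro j
    rw [← Finset.mul_sum, ← Finset.mul_sum, mul_assoc (2 * π / Y)]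
    have h1 := p2 j
    have h2 : ρ ^ j * (1 + j / Y) ^ 2 ≤ τ ^ j := by
      rw [hρ, hτ, ← Real.exp_nat_mul, ← Real.exp_nat_mul]
      have hJ0 : 0 ≤ (j:ℝ) / Y := by positivity
      have h3 : (1 + (j:ℝ) / Y) ^ 2 ≤ Real.exp (2 * (j / Y)) := by
        have := Real.add_one_le_exp ((j:ℝ) / Y)
        rw [show 2 * ((j:ℝ) / Y) = j / Y + j / Y by ring, Real.exp_add]
        nlinarith
      calc _ ≤ Real.exp (j * (-π / Y)) * Real.exp (2 * (j / Y)) := by gcongr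
        _ = Real.exp (j * (-π / Y) + 2 * (j / Y)) := by rw [Real.exp_add]
        _ ≤ _ := by
          apply Real.exp_le_exp.2
          have : (j:ℝ) * (-π / Y) + 2 * (j / Y) - j * (-1 / Y) = (3 - π) * (j / Y) := by ring
          have := Real.pi_gt_three
          nlinarith
    have hρj : 0 ≤ ρ ^ j := by positivity
    apply mul_le_mul_of_nonneg_left _ (by positivity)
    calc ρ ^ j * ∑ q ∈ S, ‖AS χ j q‖ ≤ ρ ^ j * (K * (1 + j / Y) ^ 2) := by gcongr
      _ = K * (ρ ^ j * (1 + j / Y) ^ 2) := by ring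
      _ ≤ K * τ ^ j := by gcongr
  have hsummable : ∀ q ∈ S, Summable (fun j : ℕ => 2 * π / Y * (ρ ^ j * ‖AS χ j q‖)) := by
    intro q hq
    exact (AS_summable hχ (mem_QB.1 (hS hq)).2.1.odd hρ0.le hρ1).mul_left _
  refine (Finset.sum_le_sum p1).trans ?_
  rw [← Summable.tsum_finsetSum hsummable]
  have hg := (hasSum_geometric_of_lt_one hτ0.le hτ1).mul_left (2 * π / Y * K)
  refine (Summable.tsum_le_tsum p3 (summable_sum hsummable) hg.summable).trans ?_
  rw [hg.tsum_eq]
  have h5 : (1 - τ)⁻¹ ≤ 2 * Y := by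
    rw [inv_le_comm₀ (by linarith) (by positivity)]
    have : τ ≤ 1 / (1 + 1 / Y) := by
      rw [hτ, show (-1 / Y) = -(1 / Y) by ring, Real.exp_neg, ← one_div]
      apply one_div_le_one_div_of_le (by positivity)
      have := Real.add_one_le_exp (1 / Y)
      linarith
    have h6 : 1 / (1 + 1 / Y) = Y / (Y + 1) := by field_simp
    rw [h6] at this
    have h7 : 1 - Y / (Y + 1) = 1 / (Y + 1) := by field_simp; ring
    have h8 : (2 * Y)⁻¹ ≤ 1 / (Y + 1) := by
      rw [← one_div]; apply one_div_le_one_div_of_le (by positivity); linarith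
    linarith
  calc 2 * π / Y * K * (1 - τ)⁻¹ ≤ 2 * π / Y * K * (2 * Y) := by gcongr
    _ = 2 * π * (2 * (3 * Real.sqrt C)) * Y ^ δ * (Q * Real.sqrt Y) := by rw [hK]; field_simp

theorem W_block {χ : O → O → ℤ} (hχ : IsQuadSym χ) {δ : ℝ} (hδ : 0 < δ) (hδ1 : δ ≤ 1) : ∃ C : ℝ, 0 < C ∧
    ∀ X Q : ℝ, 0 < X → 1 ≤ Q →
      ∑ q ∈ (QB Q).filter (fun q => Q / 2 < Nm q), ‖W χ X q‖ ≤ C * (Q ^ δ * Q * Real.sqrt X) := by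
  obtain ⟨C, hC, H⟩ := W_avg hχ hδ hδ1
  have hCg := Cg_pos
  refine ⟨2 * C + 9 * Cg, by positivity, ?_⟩
  intro X Q hX hQ
  have hQ0 : 0 < Q := by linarith
  set S := (QB Q).filter (fun q => Q / 2 < Nm q) with hS
  have hsub : S ⊆ QB Q := Finset.filter_subset _ _
  have hcard : (S.card : ℝ) ≤ 9 * Q := by
    refine le_trans ?_ (QB_card hQ)
    exact_mod_cast Finset.card_le_card hsub
  have hQd : 1 ≤ Q ^ δ := Real.one_le_rpow hQ hδ.le
  have hsX := Real.sqrt_nonneg X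
  have hP : 0 ≤ Q ^ δ * Q * Real.sqrt X := by positivity
  have triv : ∀ B, 0 ≤ B → B ≤ Cg * Real.sqrt X → (∀ q ∈ S, ‖W χ X q‖ ≤ B) →
      ∑ q ∈ S, ‖W χ X q‖ ≤ (2 * C + 9 * Cg) * (Q ^ δ * Q * Real.sqrt X) := by
    intro B hB0 hB h
    refine (Finset.sum_le_card_nsmul _ _ _ h).trans ?_
    rw [nsmul_eq_mul]
    calc (S.card : ℝ) * B ≤ 9 * Q * (Cg * Real.sqrt X) := by gcongr
      _ = 9 * Cg * (1 * Q * Real.sqrt X) := by ring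
      _ ≤ 9 * Cg * (Q ^ δ * Q * Real.sqrt X) := by gcongr
      _ ≤ _ := by nlinarith
  rcases le_or_gt X 1 with c1 | c1
  · refine triv (Cg * X) (by positivity) ?_ (fun q hq => ?_)
    · gcongr
      apply Real.le_sqrt_of_sq_le; nlinarith
    · have hq' := mem_QB.1 (hsub hq)
      exact W_le hχ hq'.2.1.odd hq'.2.2.2 hX
  rcases le_or_gt (X ^ 2) Q with c2 | c2
  · have h := H X Q c1.le c2 S hsub (fun _ => X) (fun q _ => ⟨by linarith, le_rfl⟩)
    refine h.trans ?_
    have hXQ : X ≤ Q := by nlinarith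
    calc C * X ^ δ * (Q * Real.sqrt X) ≤ C * Q ^ δ * (Q * Real.sqrt X) := by gcongr
      _ = C * (Q ^ δ * Q * Real.sqrt X) := by ring
      _ ≤ _ := by gcongr; linarith
  rcases le_or_gt X Q with c3 | c3
  · have hY1 : 1 ≤ Q / X := by rw [le_div_iff₀ hX]; linarith
    have hYX : Q / X ≤ X := by rw [div_le_iff₀ hX]; nlinarith
    have h := H (Q / X) Q hY1 (by rw [div_pow, div_le_iff₀ (by positivity)]; nlinarith) S hsub
      (fun q => Nm q / X) (fun q hq => by
        rw [hS, Finset.mem_filter, mem_QB] at hq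
        have := hq.2; have := hq.2
        constructor
        · rw [div_div, mul_comm, ← div_div]; gcongr
        · gcongr; exact hq.1.1)
    have e : ∀ q ∈ S, ‖W χ X q‖ ≤ 2 * X / Real.sqrt Q * ‖W χ (Nm q / X) q‖ := by
      intro q hq
      rw [hS, Finset.mem_filter, mem_QB] at hq
      rw [W_FE hχ hq.1.2.1.odd hq.1.2.2.1 hX]
      apply mul_le_mul_of_nonneg_right _ (norm_nonneg _)
      have hN : Real.sqrt (Q / 2) ≤ Real.sqrt (Nm q) := Real.sqrt_le_sqrt hq.2.le
      have h2 : Real.sqrt Q ≤ 2 * Real.sqrt (Q / 2) := by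
        rw [show (2:ℝ) = Real.sqrt 4 by rw [show (4:ℝ) = 2 ^ 2 by norm_num, Real.sqrt_sq (by norm_num)],
          ← Real.sqrt_mul (by norm_num)]
        apply Real.sqrt_le_sqrt
        rw [show Real.sqrt 4 = 2 by rw [show (4:ℝ) = 2 ^ 2 by norm_num, Real.sqrt_sq (by norm_num)]]
        linarith
      have hsQ : 0 < Real.sqrt Q := Real.sqrt_pos.2 hQ0
      have hsN : 0 < Real.sqrt (Nm q) := by linarith
      rw [div_le_div_iff₀ hsN hsQ]
      nlinarith
    refine (Finset.sum_le_sum e).trans ?_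
    rw [← Finset.mul_sum]
    have hsQ : 0 < Real.sqrt Q := Real.sqrt_pos.2 hQ0
    have hsX0 : 0 < Real.sqrt X := Real.sqrt_pos.2 hX
    calc 2 * X / Real.sqrt Q * ∑ q ∈ S, ‖W χ (Nm q / X) q‖
        ≤ 2 * X / Real.sqrt Q * (C * (Q / X) ^ δ * (Q * Real.sqrt (Q / X))) := by gcongr
      _ ≤ 2 * X / Real.sqrt Q * (C * Q ^ δ * (Q * Real.sqrt (Q / X))) := by
          gcongr
          exact div_le_self hQ0.le c1.le
      _ = 2 * C * (Q ^ δ * Q * Real.sqrt X) := by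
          rw [Real.sqrt_div hQ0.le]
          field_simp
          rw [Real.sq_sqrt hX.le]
      _ ≤ _ := by gcongr; linarith
  · refine triv (Cg * Real.sqrt Q) (by positivity) ?_ (fun q hq => ?_)
    · gcongr
    · have hq' := mem_QB.1 (hsub hq)
      refine (W_PV hχ hq'.2.1.odd hq'.2.2.1 hq'.2.2.2 hX).trans ?_
      gcongr
      exact hq'.1

theorem US_le {χ : O → O → ℤ} (hχ : IsQuadSym χ) {δ : ℝ} (hδ : 0 < δ) (hδ1 : δ ≤ 1) : ∃ C : ℝ, 0 < C ∧
    ∀ X Q : ℝ, 0 < X → 0 ≤ Q → US χ X Q ≤ C * (Q ^ δ * Q * Real.sqrt X) := by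
  obtain ⟨C, hC, H⟩ := W_block hχ hδ hδ1
  refine ⟨2 * C, by positivity, ?_⟩
  intro X Q hX
  have main : ∀ k : ℕ, ∀ Q : ℝ, 0 ≤ Q → Q < 2 ^ k → US χ X Q ≤ 2 * C * (Q ^ δ * Q * Real.sqrt X) := by
    have hempty : ∀ Q : ℝ, 0 ≤ Q → Q < 1 → US χ X Q ≤ 2 * C * (Q ^ δ * Q * Real.sqrt X) := by
      intro Q hQ hQ1
      have : QB Q = ∅ := by
        apply Finset.eq_empty_of_forall_notMem
        intro n hn; rw [mem_QB] at hn
        linarith [one_le_Nm hn.2.1.ne_zero, hn.1]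
      unfold US; rw [this, Finset.sum_empty]; positivity
    intro k
    induction k with
    | zero => intro Q hQ hQ1; exact hempty Q hQ (by simpa using hQ1)
    | succ k ih =>
      intro Q hQ hQk
      rcases lt_or_ge Q 1 with h1 | h1
      · exact hempty Q hQ h1
      have b1 := H X Q hX h1
      have b2 := ih (Q / 2) (by positivity) (by rw [pow_succ] at hQk; linarith)
      have e : US χ X Q = ∑ q ∈ (QB Q).filter (fun q => Q / 2 < Nm q), ‖W χ X q‖ + US χ X (Q / 2) := by
        unfold US
        rw [← Finset.sum_filter_add_sum_filter_not (QB Q) (fun q => Q / 2 < Nm q)]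
        congr 2
        ext q; rw [Finset.mem_filter, mem_QB, mem_QB, not_lt]
        exact ⟨fun h => ⟨h.2, h.1.2⟩, fun h => ⟨⟨by linarith [h.1], h.2⟩, h.1⟩⟩
      rw [e]
      have h3 : (Q / 2) ^ δ ≤ Q ^ δ := Real.rpow_le_rpow (by positivity) (by linarith) hδ.le
      have h4 : 2 * C * ((Q / 2) ^ δ * (Q / 2) * Real.sqrt X) ≤ 2 * C * (Q ^ δ * (Q / 2) * Real.sqrt X) := by
        gcongr
      nlinarith
  intro hQ
  obtain ⟨k, hk⟩ := pow_unbounded_of_one_lt Q (one_lt_two)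
  exact main k Q hQ hk

/-- the quadratic large sieve in the form used -/
theorem sieve {χ : O → O → ℤ} (hχ : IsQuadSym χ) {δ : ℝ} (hδ : 0 < δ) (hδ1 : δ ≤ 1) : ∃ C : ℝ, 0 < C ∧
    ∀ X N : ℝ, 1 ≤ X → 1 ≤ N →
      ∀ S : Finset O, (∀ m ∈ S, Sp m ∧ Nm m ≤ X) → ∀ a : O → ℂ, (∀ n, ‖a n‖ ≤ 1) →
      ∑ m ∈ S, ‖∑ n ∈ nz N, a n * (χ n m : ℂ)‖ ^ 2 ≤ C * N ^ δ * (X * N + Real.sqrt X * N ^ 2) := by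
  obtain ⟨C1, hC1, H1⟩ := sieve_of_US hχ (δ := δ / 2) (by positivity)
  obtain ⟨C2, hC2, H2⟩ := US_le hχ (δ := δ / 4) (by positivity) (by linarith)
  refine ⟨C1 * (1 + C2), by positivity, ?_⟩
  intro X N hX hN S hS a ha
  have hN0 : 0 < N := by linarith
  have hX0 : 0 < X := by linarith
  have eN : (N ^ 2) ^ (δ / 4) = N ^ (δ / 2) := by
    rw [← Real.rpow_natCast N 2, ← Real.rpow_mul hN0.le]; congr 1; push_cast; ring
  have eN2 : N ^ (δ / 2) * N ^ (δ / 2) = N ^ δ := by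
    rw [← Real.rpow_add hN0]; congr 1; ring
  have hNd : 1 ≤ N ^ (δ / 2) := Real.one_le_rpow hN (by positivity)
  have h1 := H1 X N (C2 * (N ^ (δ / 2) * Real.sqrt X)) hX hN (by positivity) (fun X' Q' a1 a2 a3 a4 => ?_) S hS a ha
  · refine h1.trans ?_
    have hXN : 0 ≤ X * N := by positivity
    have hR : 0 ≤ Real.sqrt X * N ^ 2 := by positivity
    calc C1 * N ^ (δ / 2) * (X * N + C2 * (N ^ (δ / 2) * Real.sqrt X) * N ^ 2)
        ≤ C1 * N ^ (δ / 2) * (N ^ (δ / 2) * ((1 + C2) * (X * N + Real.sqrt X * N ^ 2))) := by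
          gcongr
          have t1 : X * N ≤ N ^ (δ / 2) * (X * N) := le_mul_of_one_le_left hXN hNd
          have t2 : 0 ≤ N ^ (δ / 2) * (C2 * (X * N)) := by positivity
          have t3 : 0 ≤ N ^ (δ / 2) * (Real.sqrt X * N ^ 2) := by positivity
          nlinarith
      _ = C1 * (1 + C2) * (N ^ (δ / 2) * N ^ (δ / 2)) * (X * N + Real.sqrt X * N ^ 2) := by ring
      _ = _ := by rw [eN2]
  · refine (H2 X' Q' a1 (by linarith)).trans ?_
    have : Q' ^ (δ / 4) ≤ N ^ (δ / 2) := by rw [← eN]; gcongr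
    have h3 : Real.sqrt X' ≤ Real.sqrt X := Real.sqrt_le_sqrt a2
    have hQ' : 0 ≤ Q' := by linarith
    calc C2 * (Q' ^ (δ / 4) * Q' * Real.sqrt X') ≤ C2 * (N ^ (δ / 2) * Q' * Real.sqrt X) := by gcongr
      _ = _ := by ring


/-! ### Theta functions, functional equation and the entire function `(s-1) L(s)` -/

def th (F : O → ℂ) (a y : ℝ) : ℂ := ∑' n : O, F n * ((Real.exp (-π * (a * Nm n) * y) : ℝ) : ℂ)

structure TP (F G : O → ℂ) (a B : ℝ) : Prop where
  ha : 0 < a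
  hF : ∀ n, ‖F n‖ ≤ B
  hG : ∀ n, ‖G n‖ ≤ B
  hF0 : F 0 = 0
  fe : ∀ y : ℝ, 0 < y → th F a (1 / y) = (y : ℂ) * th G a y

theorem th_summable {F : O → ℂ} {a B : ℝ} (hF : ∀ n, ‖F n‖ ≤ B) (ha : 0 < a) {y : ℝ} (hy : 0 < y) :
    Summable (fun n : O => F n * ((Real.exp (-π * (a * Nm n) * y) : ℝ) : ℂ)) := by
  have := summable_bdd_gauss hF (c := π * a * y) (by positivity)
  refine this.congr (fun n => ?_)
  rw [show -(π * a * y) * Nm n = -π * (a * Nm n) * y by ring]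

theorem th_cont {F : O → ℂ} {a B : ℝ} (hF : ∀ n, ‖F n‖ ≤ B) (ha : 0 < a) :
    ContinuousOn (th F a) (Set.Ioi 0) := by
  have key : ∀ c : ℝ, 0 < c → ContinuousOn (th F a) (Set.Ioi c) := by
    intro c hc
    unfold th
    refine continuousOn_tsum (u := fun n : O => B * Real.exp (-(π * a * c) * Nm n)) ?_
      ((summable_gauss (by positivity)).mul_left B) ?_
    · intro n; fun_prop
    · intro n y hy
      rw [norm_mul, Complex.norm_real, Real.norm_of_nonneg (Real.exp_pos _).le]
      refine mul_le_mul (hF n) (Real.exp_le_exp.2 ?_) (Real.exp_pos _).le ((norm_nonneg _).trans (hF n))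
      have h1 : c ≤ y := le_of_lt hy
      have h2 : 0 ≤ π * (a * Nm n) := mul_nonneg pi_pos.le (mul_nonneg ha.le (Nm_nonneg n))
      nlinarith [mul_le_mul_of_nonneg_left h1 h2]
  intro y hy
  have hy' : (0:ℝ) < y := hy
  exact ((key (y / 2) (by positivity)).continuousAt (Ioi_mem_nhds (by linarith))).continuousWithinAt

theorem th_decay {F : O → ℂ} {a B : ℝ} (hF : ∀ n, ‖F n‖ ≤ B) (ha : 0 < a) (r : ℝ) :
    (fun y => th F a y - F 0) =O[atTop] (fun y : ℝ => y ^ r) := by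
  have h1 : (fun y => th F a y - F 0) =O[atTop] (fun y : ℝ => Real.exp (-(π * a) * y)) := by
    refine Asymptotics.IsBigO.of_bound (B * (∑' n : O, Real.exp (-(π * a) * Nm n)) * Real.exp (π * a)) ?_
    filter_upwards [eventually_ge_atTop (1:ℝ)] with y hy
    have hy0 : 0 < y := by linarith
    have hB : 0 ≤ B := (norm_nonneg _).trans (hF 0)
    have hs := th_summable hF ha hy0
    have e : th F a y - F 0 = ∑' n : O, if n = 0 then 0 else F n * ((Real.exp (-π * (a * Nm n) * y) : ℝ) : ℂ) := by
      unfold th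
      rw [hs.tsum_eq_add_tsum_ite 0]
      simp [Nm_zero]
    have hsg := summable_gauss (c := π * a) (by positivity)
    rw [e]
    have hb : ∀ n : O, ‖(if n = 0 then 0 else F n * ((Real.exp (-π * (a * Nm n) * y) : ℝ) : ℂ) : ℂ)‖ ≤
        B * Real.exp (π * a) * Real.exp (-(π * a) * y) * Real.exp (-(π * a) * Nm n) := by
      intro n
      split_ifs with h
      · simp; positivity
      · rw [norm_mul, Complex.norm_real, Real.norm_of_nonneg (Real.exp_pos _).le,
          mul_assoc B, mul_assoc B, ← Real.exp_add, ← Real.exp_add]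
        refine mul_le_mul (hF n) (Real.exp_le_exp.2 ?_) (Real.exp_pos _).le hB
        have hn := one_le_Nm h
        have : 0 < π * a := by positivity
        nlinarith [mul_nonneg this.le (mul_nonneg (sub_nonneg.2 hn) (sub_nonneg.2 hy))]
    refine (tsum_of_norm_bounded (hsg.mul_left (B * Real.exp (π * a) * Real.exp (-(π * a) * y))).hasSum hb).trans ?_
    rw [tsum_mul_left, Real.norm_of_nonneg (Real.exp_pos _).le]
    apply le_of_eq; ring
  exact h1.trans (isLittleO_exp_neg_mul_rpow_atTop (by positivity) r).isBigO

/-- the weak functional-equation pair -/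
def fep {F G : O → ℂ} {a B : ℝ} (h : TP F G a B) : WeakFEPair ℂ where
  f := th F a
  g := th G a
  k := 1
  ε := 1
  f₀ := 0
  g₀ := G 0
  hf_int := (th_cont h.hF h.ha).locallyIntegrableOn measurableSet_Ioi
  hg_int := (th_cont h.hG h.ha).locallyIntegrableOn measurableSet_Ioi
  hk := one_pos
  hε := one_ne_zero
  h_feq := by
    intro x hx
    rw [h.fe x hx]; simp
  hf_top := by
    intro r
    have := th_decay h.hF h.ha r
    rwa [h.hF0] at this
  hg_top := th_decay h.hG h.ha

/-- Dirichlet series -/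
def Dser (F : O → ℂ) (s : ℂ) : ℂ := ∑' n : O, F n / (Nm n : ℂ) ^ s

theorem norm_Nm_cpow {n : O} (hn : n ≠ 0) (s : ℂ) : ‖(Nm n : ℂ) ^ s‖ = Nm n ^ s.re :=
  Complex.norm_cpow_eq_rpow_re_of_pos (Nm_pos hn) s

theorem Dser_summable {F : O → ℂ} {B : ℝ} (hF : ∀ n, ‖F n‖ ≤ B) {s : ℂ} (hs : 1 < s.re) :
    Summable (fun n : O => F n / (Nm n : ℂ) ^ s) := by
  have hs0 : s ≠ 0 := by rintro rfl; simp at hs; linarith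
  refine Summable.of_norm_bounded ((summable_Nm_rpow hs).mul_left B) (fun n => ?_)
  have hB : 0 ≤ B := (norm_nonneg _).trans (hF 0)
  by_cases hn : n = 0
  · subst hn
    rw [Nm_zero, Complex.ofReal_zero, Complex.zero_cpow hs0]; simp
    exact mul_nonneg hB (Real.rpow_nonneg le_rfl _)
  · rw [norm_div, norm_Nm_cpow hn, Real.rpow_neg (Nm_nonneg n), div_eq_mul_inv]
    exact mul_le_mul_of_nonneg_right (hF n) (inv_nonneg.2 (Real.rpow_nonneg (Nm_nonneg n) _))

theorem mellin_th {F : O → ℂ} {a B : ℝ} (hF : ∀ n, ‖F n‖ ≤ B) (ha : 0 < a) {s : ℂ} (hs : 1 < s.re) :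
    mellin (fun y => th F a y - F 0) s = Complex.Gamma s * ((π * a : ℝ) : ℂ) ^ (-s) * Dser F s := by
  have hs0 : s ≠ 0 := by rintro rfl; simp at hs; linarith
  haveI : Countable O := eqvZ.injective.countable
  have hH := hasSum_mellin_pi_mul₀ (a := F) (p := fun n : O => a * Nm n)
    (F := fun y => th F a y - F 0) (s := s)
    (fun n => mul_nonneg ha.le (Nm_nonneg n)) (by linarith) ?_ ?_
  · have e : ∀ n : O, (π:ℂ) ^ (-s) * Complex.Gamma s * F n / ((a * Nm n : ℝ) : ℂ) ^ s =
        Complex.Gamma s * ((π * a : ℝ) : ℂ) ^ (-s) * (F n / (Nm n : ℂ) ^ s) := by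
      intro n
      rw [Complex.ofReal_mul, Complex.ofReal_mul, Complex.mul_cpow_ofReal_nonneg ha.le (Nm_nonneg n),
        Complex.mul_cpow_ofReal_nonneg pi_pos.le ha.le, Complex.cpow_neg (a:ℂ) s]
      rw [div_eq_mul_inv, div_eq_mul_inv, mul_inv]; ring
    have := hH.tsum_eq
    rw [← this]
    unfold Dser
    rw [← tsum_mul_left]
    exact tsum_congr e
  · intro y hy
    have hs := th_summable hF ha (show 0 < y from hy)
    have e : th F a y - F 0 = ∑' n : O, if n = 0 then 0 else F n * ((Real.exp (-π * (a * Nm n) * y) : ℝ) : ℂ) := by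
      unfold th
      rw [hs.tsum_eq_add_tsum_ite 0]
      simp [Nm_zero]
    have hif : ∀ n : O, (if a * Nm n = 0 then 0 else F n * ((Real.exp (-π * (a * Nm n) * y) : ℝ) : ℂ) : ℂ) =
        if n = 0 then 0 else F n * ((Real.exp (-π * (a * Nm n) * y) : ℝ) : ℂ) := by
      intro n
      have : a * Nm n = 0 ↔ n = 0 := by
        rw [mul_eq_zero]; simp [ha.ne', Nm_eq_zero]
      by_cases hn : n = 0
      · simp [hn, Nm_zero]
      · rw [if_neg hn, if_neg (by rwa [this])]
    simp_rw [hif]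
    rw [e]
    refine Summable.hasSum ?_
    refine Summable.of_norm_bounded hs.norm (fun n => ?_)
    split_ifs <;> simp
  · refine Summable.of_norm_bounded ((summable_Nm_rpow hs).mul_left (B * a ^ (-s.re))) (fun n => ?_)
    have hB : 0 ≤ B := (norm_nonneg _).trans (hF 0)
    rw [norm_div, norm_norm, Real.norm_of_nonneg (Real.rpow_nonneg (mul_nonneg ha.le (Nm_nonneg n)) _),
      Real.mul_rpow ha.le (Nm_nonneg n), div_eq_mul_inv, mul_inv, ← Real.rpow_neg ha.le,
      ← Real.rpow_neg (Nm_nonneg n), mul_assoc]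
    exact mul_le_mul_of_nonneg_right (hF n) (mul_nonneg (Real.rpow_nonneg ha.le _) (Real.rpow_nonneg (Nm_nonneg n) _))

def MM {F G : O → ℂ} {a B : ℝ} (h : TP F G a B) (s : ℂ) : ℂ :=
  ((s - 1) * (fep h).Λ₀ s + G 0) * ((π * a : ℝ) : ℂ) ^ s * (Complex.Gamma s)⁻¹

theorem MM_diff {F G : O → ℂ} {a B : ℝ} (h : TP F G a B) : Differentiable ℂ (MM h) := by
  unfold MM
  have h1 := (fep h).differentiable_Λ₀
  have h2 := Complex.differentiable_one_div_Gamma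
  have hpa : ((π * a : ℝ) : ℂ) ≠ 0 := by
    rw [Complex.ofReal_ne_zero]; have := h.ha; positivity
  have h3 : Differentiable ℂ (fun s : ℂ => ((π * a : ℝ) : ℂ) ^ s) := fun s =>
    (differentiableAt_id.const_cpow (Or.inl hpa))
  exact ((((differentiable_id.sub_const 1).mul h1).add_const _).mul h3).mul h2

theorem MM_eq {F G : O → ℂ} {a B : ℝ} (h : TP F G a B) {s : ℂ} (hs : s ≠ 1) :
    MM h s = (s - 1) * (fep h).Λ s * ((π * a : ℝ) : ℂ) ^ s * (Complex.Gamma s)⁻¹ := by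
  unfold MM WeakFEPair.Λ
  have e1 : (fep h).f₀ = 0 := rfl
  have e2 : (fep h).g₀ = G 0 := rfl
  have e3 : (fep h).k = 1 := rfl
  have e4 : (fep h).ε = 1 := rfl
  rw [e1, e2, e3, e4]
  have : (1:ℂ) - s ≠ 0 := sub_ne_zero.2 hs.symm
  congr 2
  simp only [Complex.ofReal_one, smul_eq_mul]
  field_simp
  ring

theorem MM_right {F G : O → ℂ} {a B : ℝ} (h : TP F G a B) {s : ℂ} (hs : 1 < s.re) :
    MM h s = (s - 1) * Dser F s := by
  have hs1 : s ≠ 1 := by rintro rfl; simp at hs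
  rw [MM_eq h hs1]
  have h1 := ((fep h).hasMellin (s := s) hs).2
  have e1 : (fep h).f₀ = F 0 := h.hF0.symm
  have e5 : (fep h).f = th F a := rfl
  rw [e1, e5] at h1
  rw [← h1, mellin_th h.hF h.ha hs]
  have hG : Complex.Gamma s ≠ 0 := Complex.Gamma_ne_zero_of_re_pos (by linarith)
  have hpa : ((π * a : ℝ) : ℂ) ≠ 0 := by
    rw [Complex.ofReal_ne_zero]; have := h.ha; positivity
  rw [Complex.cpow_neg]
  have : ((π * a : ℝ) : ℂ) ^ s ≠ 0 := by
    rw [Ne, Complex.cpow_eq_zero_iff]; exact fun hh => hpa hh.1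
  field_simp

theorem MM_left {F G : O → ℂ} {a B : ℝ} (h : TP F G a B) {s : ℂ} (hs : s.re < 0) :
    MM h s = - (Complex.Gamma (2 - s) * (Complex.Gamma s)⁻¹ * ((π * a : ℝ) : ℂ) ^ (2 * s - 1) * Dser G (1 - s)) := by
  have hs1 : s ≠ 1 := by rintro rfl; simp at hs; linarith
  rw [MM_eq h hs1]
  have h2 := (fep h).functional_equation (1 - s)
  have h1 := ((fep h).symm.hasMellin (s := 1 - s) (by
    show (1:ℝ) < (1 - s).re
    simp; linarith)).2
  have e1 : (fep h).symm.f₀ = G 0 := rfl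
  have e5 : (fep h).symm.f = th G a := rfl
  have e3 : (fep h).k = 1 := rfl
  have e4 : (fep h).ε = 1 := rfl
  rw [e1, e5] at h1
  rw [e3, e4, one_smul, Complex.ofReal_one, sub_sub_cancel] at h2
  rw [h2, ← h1, mellin_th h.hG h.ha (by simp; linarith)]
  have hpa : ((π * a : ℝ) : ℂ) ≠ 0 := by
    rw [Complex.ofReal_ne_zero]; have := h.ha; positivity
  have e6 : ((π * a : ℝ) : ℂ) ^ (2 * s - 1) = ((π * a : ℝ) : ℂ) ^ (-(1 - s)) * ((π * a : ℝ) : ℂ) ^ s := by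
    rw [← Complex.cpow_add _ _ hpa]; congr 1; ring
  have e7 : Complex.Gamma (2 - s) = (1 - s) * Complex.Gamma (1 - s) := by
    rw [← Complex.Gamma_add_one _ (sub_ne_zero.2 hs1.symm)]; congr 1; ring
  rw [e6, e7]; ring


/-! ### Growth in vertical strips -/

theorem norm_Gamma_le {z : ℂ} (hz : 0 < z.re) : ‖Complex.Gamma z‖ ≤ Real.Gamma z.re := by
  rw [Complex.Gamma_eq_integral hz, Real.Gamma_eq_integral hz, Complex.GammaIntegral]
  refine (MeasureTheory.norm_integral_le_integral_norm _).trans (le_of_eq ?_)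
  refine MeasureTheory.setIntegral_congr_fun measurableSet_Ioi (fun x hx => ?_)
  have hx : 0 < x := hx
  rw [norm_mul, Complex.norm_real, Real.norm_of_nonneg (Real.exp_pos _).le,
    Complex.norm_cpow_eq_rpow_re_of_pos hx]
  simp

theorem Gamma_strip {a b : ℝ} (ha : 0 < a) :
    ∃ K : ℝ, 0 < K ∧ ∀ z : ℂ, a ≤ z.re → z.re ≤ b → ‖Complex.Gamma z‖ ≤ K := by
  have hc : ContinuousOn Real.Gamma (Set.Icc a b) := by
    intro x hx
    refine (Real.differentiableAt_Gamma (fun m => ?_)).continuousAt.continuousWithinAt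
    have := hx.1
    have h2 : (0:ℝ) ≤ m := Nat.cast_nonneg m
    linarith
  obtain ⟨K, hK⟩ := isCompact_Icc.exists_bound_of_continuousOn hc
  refine ⟨max K 1, by positivity, fun z h1 h2 => ?_⟩
  refine (norm_Gamma_le (by linarith)).trans ?_
  exact ((le_abs_self _).trans (hK z.re ⟨h1, h2⟩)).trans (le_max_left _ _)

theorem norm_sin_le' (z : ℂ) : ‖Complex.sin z‖ ≤ Real.exp |z.im| := by
  unfold Complex.sin
  rw [norm_div, norm_mul, Complex.norm_I, mul_one]
  have h1 : ‖Complex.exp (-z * I)‖ ≤ Real.exp |z.im| := by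
    rw [Complex.norm_exp]; apply Real.exp_le_exp.2; simp [le_abs_self]
  have h2 : ‖Complex.exp (z * I)‖ ≤ Real.exp |z.im| := by
    rw [Complex.norm_exp]; apply Real.exp_le_exp.2; simp [neg_le_abs]
  have h3 := norm_sub_le (Complex.exp (-z * I)) (Complex.exp (z * I))
  have : ‖(2:ℂ)‖ = 2 := by simp
  rw [this, div_le_iff₀ (by norm_num)]
  linarith

theorem inv_Gamma_growth : ∃ K : ℝ, 0 < K ∧ ∀ s : ℂ, -(1/2) ≤ s.re → s.re ≤ 3/2 → 1 ≤ |s.im| →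
    ‖(Complex.Gamma s)⁻¹‖ ≤ K * Real.exp (π * |s.im|) := by
  obtain ⟨K, hK, h⟩ := Gamma_strip (a := 3/2) (b := 7/2) (by norm_num)
  refine ⟨K, hK, fun s h1 h2 h3 => ?_⟩
  have im_ne : s.im ≠ 0 := by intro hh; rw [hh] at h3; simp at h3; linarith
  have ha : (1 - s) ≠ 0 := by intro hh; apply im_ne; simpa using congrArg Complex.im hh
  have hb : (2 - s) ≠ 0 := by intro hh; apply im_ne; simpa using congrArg Complex.im hh
  have na : 1 ≤ ‖1 - s‖ := h3.trans (by simpa using Complex.abs_im_le_norm (1 - s))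
  have nb : 1 ≤ ‖2 - s‖ := h3.trans (by simpa using Complex.abs_im_le_norm (2 - s))
  have hsin : Complex.sin (π * s) ≠ 0 := by
    rw [Ne, Complex.sin_eq_zero_iff]
    rintro ⟨k, hk⟩
    have := congrArg Complex.im hk
    simp [pi_ne_zero, im_ne] at this
  have hr := Complex.Gamma_mul_Gamma_one_sub s
  have e : (Complex.Gamma s)⁻¹ = Complex.Gamma (1 - s) * Complex.sin (π * s) / π := by
    have hp : (π:ℂ) ≠ 0 := by exact_mod_cast pi_ne_zero
    have hne : Complex.Gamma s ≠ 0 := by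
      intro h0; rw [h0, zero_mul] at hr
      exact (div_ne_zero hp hsin) hr.symm
    rw [eq_div_iff hsin] at hr
    rw [eq_div_iff hp, inv_mul_eq_div, div_eq_iff hne]
    refine hr.symm.trans ?_; ring
  have e2 : Complex.Gamma (3 - s) = (2 - s) * ((1 - s) * Complex.Gamma (1 - s)) := by
    rw [← Complex.Gamma_add_one _ ha, show 1 - s + 1 = 2 - s by ring, ← Complex.Gamma_add_one _ hb]
    congr 1; ring
  have h4 : ‖Complex.Gamma (1 - s)‖ ≤ K := by
    have h5 := h (3 - s) (by simp; linarith) (by simp; linarith)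
    rw [e2, norm_mul, norm_mul] at h5
    have h0 := norm_nonneg (Complex.Gamma (1 - s))
    nlinarith [mul_le_mul na (le_refl ‖Complex.Gamma (1 - s)‖) h0 (by linarith),
      mul_nonneg (sub_nonneg.2 nb) (mul_nonneg (norm_nonneg (1 - s)) h0)]
  rw [e, norm_div, norm_mul, Complex.norm_real, Real.norm_of_nonneg pi_pos.le]
  have h6 := norm_sin_le' (π * s)
  have e3 : |((π:ℂ) * s).im| = π * |s.im| := by
    simp [abs_mul, abs_of_pos pi_pos]
  rw [e3] at h6
  refine (div_le_self (by positivity) (by linarith [pi_gt_three])).trans ?_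
  exact mul_le_mul h4 h6 (norm_nonneg _) hK.le

theorem MM_growth {F G : O → ℂ} {a B : ℝ} (h : TP F G a B) : ∃ K : ℝ, 0 < K ∧ ∀ s : ℂ, -(1/2) ≤ s.re →
    s.re ≤ 3/2 → 1 ≤ |s.im| → ‖MM h s‖ ≤ K * Real.exp (5 * |s.im|) := by
  obtain ⟨K1, hK1, h1⟩ := inv_Gamma_growth
  have hconv : ∀ z : ℂ, MellinConvergent (fep h).f_modif z := fun z =>
    ((fep h).isStrongFEPair_toStrongFEPair.hasMellin z).1
  have hΛ : ∃ K : ℝ, 0 < K ∧ ∀ s : ℂ, -(1/2) ≤ s.re → s.re ≤ 3/2 → ‖(fep h).Λ₀ s‖ ≤ K := by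
    have i1 := (hconv (-(1/2))).norm
    have i2 := (hconv (3/2)).norm
    refine ⟨(∫ t : ℝ in Set.Ioi 0, (‖(t:ℂ) ^ ((-(1/2) : ℂ) - 1) • (fep h).f_modif t‖ +
      ‖(t:ℂ) ^ ((3/2 : ℂ) - 1) • (fep h).f_modif t‖)) + 1, ?_, fun s hs1 hs2 => ?_⟩
    · have : 0 ≤ ∫ t : ℝ in Set.Ioi 0, (‖(t:ℂ) ^ ((-(1/2) : ℂ) - 1) • (fep h).f_modif t‖ +
        ‖(t:ℂ) ^ ((3/2 : ℂ) - 1) • (fep h).f_modif t‖) :=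
        MeasureTheory.integral_nonneg (fun _ => by positivity)
      linarith
    · have : ‖(fep h).Λ₀ s‖ ≤ (∫ t : ℝ in Set.Ioi 0, (‖(t:ℂ) ^ ((-(1/2) : ℂ) - 1) • (fep h).f_modif t‖ +
        ‖(t:ℂ) ^ ((3/2 : ℂ) - 1) • (fep h).f_modif t‖)) := by
        unfold WeakFEPair.Λ₀ mellin
        refine MeasureTheory.norm_integral_le_of_norm_le (i1.add i2) ?_
        refine (MeasureTheory.ae_restrict_iff' measurableSet_Ioi).2 (Filter.Eventually.of_forall ?_)
        intro t ht
        have ht : 0 < t := ht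
        simp only [norm_smul, Complex.norm_cpow_eq_rpow_re_of_pos ht]
        rw [← add_mul]
        refine mul_le_mul_of_nonneg_right ?_ (norm_nonneg _)
        have r1 : ((-(1/2) : ℂ) - 1).re = -(3/2) := by norm_num
        have r2 : ((3/2 : ℂ) - 1).re = 1/2 := by norm_num
        rw [r1, r2]
        rcases le_total t 1 with h1 | h1
        · have : t ^ (s - 1).re ≤ t ^ (-(3/2) : ℝ) :=
            Real.rpow_le_rpow_of_exponent_ge ht h1 (by simp; linarith)
          have := Real.rpow_nonneg ht.le (1/2)
          linarith
        · have : t ^ (s - 1).re ≤ t ^ (1/2 : ℝ) :=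
            Real.rpow_le_rpow_of_exponent_le h1 (by simp; linarith)
          have := Real.rpow_nonneg ht.le (-(3/2))
          linarith
      linarith
  obtain ⟨K2, hK2, h2⟩ := hΛ
  have hpa : 0 < π * a := mul_pos pi_pos h.ha
  set K3 : ℝ := (π * a) ^ (-(1/2) : ℝ) + (π * a) ^ (3/2 : ℝ) with hK3
  have hK3p : 0 < K3 := by positivity
  have h3 : ∀ s : ℂ, -(1/2) ≤ s.re → s.re ≤ 3/2 → ‖((π * a : ℝ) : ℂ) ^ s‖ ≤ K3 := by
    intro s hs1 hs2
    rw [Complex.norm_cpow_eq_rpow_re_of_pos hpa]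
    have := Real.rpow_nonneg hpa.le (3/2)
    have := Real.rpow_nonneg hpa.le (-(1/2))
    rcases le_total (π * a) 1 with h1 | h1
    · have : (π * a) ^ s.re ≤ (π * a) ^ (-(1/2) : ℝ) :=
        Real.rpow_le_rpow_of_exponent_ge hpa h1 hs1
      linarith
    · have : (π * a) ^ s.re ≤ (π * a) ^ (3/2 : ℝ) := Real.rpow_le_rpow_of_exponent_le h1 hs2
      linarith
  refine ⟨(3 * K2 + ‖G 0‖) * K3 * K1, by positivity, fun s hs1 hs2 hs3 => ?_⟩
  have hn : ‖s - 1‖ ≤ 3 * Real.exp |s.im| := by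
    have q1 : ‖s - 1‖ ≤ |(s - 1).re| + |(s - 1).im| := Complex.norm_le_abs_re_add_abs_im _
    have q2 : |(s - 1).re| ≤ 3/2 := by rw [abs_le]; simp; constructor <;> linarith
    have q3 : (s - 1).im = s.im := by simp
    have q4 := Real.add_one_le_exp |s.im|
    rw [q3] at q1
    have := abs_nonneg s.im
    linarith
  have he : 1 ≤ Real.exp |s.im| := Real.one_le_exp (abs_nonneg _)
  have t1 : ‖(s - 1) * (fep h).Λ₀ s + G 0‖ ≤ (3 * K2 + ‖G 0‖) * Real.exp |s.im| := by
    refine (norm_add_le _ _).trans ?_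
    rw [norm_mul]
    have := mul_le_mul hn (h2 s hs1 hs2) (norm_nonneg _) (by positivity)
    nlinarith [norm_nonneg (G 0)]
  unfold MM
  rw [norm_mul, norm_mul]
  have t2 := mul_le_mul t1 (h3 s hs1 hs2) (norm_nonneg _) (by positivity)
  have t3 := mul_le_mul t2 (h1 s hs1 hs2 hs3) (norm_nonneg _) (by positivity)
  refine t3.trans ?_
  have : Real.exp |s.im| * Real.exp (π * |s.im|) ≤ Real.exp (5 * |s.im|) := by
    rw [← Real.exp_add]; apply Real.exp_le_exp.2
    nlinarith [pi_lt_four, abs_nonneg s.im]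
  calc _ = (3 * K2 + ‖G 0‖) * K3 * K1 * (Real.exp |s.im| * Real.exp (π * |s.im|)) := by ring
    _ ≤ _ := mul_le_mul_of_nonneg_left this (by positivity)


/-! ### Application to the quadratic Hecke characters -/

def Eh (h : O → ℂ) (m k : O) : ℂ := (∑ b : RQ (4:O), h (m * ot b) * psi 4 k (ot b)) / 4

theorem Eh_congr {h : O → ℂ} (hh : Per 4 h) {m c : O} (hm : (4:O) ∣ m - c) : Eh h m = Eh h c := by
  funext k
  unfold Eh
  congr 1
  refine Finset.sum_congr rfl (fun b _ => ?_)
  congr 1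
  apply hh
  rw [← sub_mul]; exact Dvd.dvd.mul_right hm _

theorem Nm_four : Nm 4 = 16 := by
  rw [Nm_eq, show (4:O).re = 4 from rfl, show (4:O).im = 0 from rfl]; norm_num

theorem Eh_norm {h : O → ℂ} (h1 : ∀ n, ‖h n‖ ≤ 1) (m k : O) : ‖Eh h m k‖ ≤ 4 := by
  unfold Eh
  rw [norm_div]
  have : ‖∑ b : RQ (4:O), h (m * ot b) * psi 4 k (ot b)‖ ≤ 16 := by
    refine (norm_sum_le _ _).trans ?_
    have : ∀ x ∈ (Finset.univ : Finset (RQ (4:O))), ‖h (m * ot x) * psi 4 k (ot x)‖ ≤ 1 := by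
      intro x _; rw [norm_mul, norm_psi, mul_one]; exact h1 _
    refine (Finset.sum_le_card_nsmul _ _ _ this).trans ?_
    rw [nsmul_eq_mul, mul_one]
    have := card_RQ (4:O)
    rw [Nm_four] at this
    exact this.le
  have h4 : ‖(4:ℂ)‖ = 4 := by simp
  rw [h4, div_le_iff₀ (by norm_num)]; linarith

theorem TP_of {χ : O → O → ℤ} (hχ : IsQuadSym χ) {m : O} (sm : Sp m) (hsf : Squarefree m) {h : O → ℂ}
    (hh : Per 4 h) (h0 : h 0 = 0) (h1 : ∀ n, ‖h n‖ ≤ 1) :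
    ∃ w : ℂ, ‖w‖ = 1 ∧ TP (fun n => h n * (χ n m : ℂ)) (fun n => w * (Eh h m n * (χ n m : ℂ)))
      (1 / (4 * Real.sqrt (Nm m))) 4 := by
  haveI : NeZero m := ⟨sm.ne_zero⟩
  have hN := Nm_pos sm.ne_zero
  have hs : 0 < Real.sqrt (Nm m) := Real.sqrt_pos.2 hN
  have hss : Real.sqrt (Nm m) * Real.sqrt (Nm m) = Nm m := Real.mul_self_sqrt hN.le
  have hg := norm_gs hχ sm.odd hsf
  have hg' : ‖gs χ m‖ = Real.sqrt (Nm m) := by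
    rw [← hg, Real.sqrt_sq (norm_nonneg _)]
  have hw : ‖gs χ m / (Real.sqrt (Nm m) : ℂ)‖ = 1 := by
    rw [norm_div, hg', Complex.norm_real, Real.norm_of_nonneg hs.le, div_self hs.ne']
  refine ⟨gs χ m / (Real.sqrt (Nm m) : ℂ), hw, ?_⟩
  refine ⟨by positivity, fun n => ?_, fun n => ?_, by simp [h0], fun y hy => ?_⟩
  · rw [norm_mul]
    have := mul_le_mul (h1 n) (chi_norm_le hχ sm.odd n) (norm_nonneg _) zero_le_one
    linarith
  · rw [norm_mul, hw, one_mul, norm_mul]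
    have := mul_le_mul (Eh_norm h1 m n) (chi_norm_le hχ sm.odd n) (norm_nonneg _) (by norm_num)
    linarith
  · have hPer : Per (4 * m) (fun n => h n * (χ n m : ℂ)) :=
      (hh.of_dvd (dvd_mul_right _ _)).mul ((chi_per hχ sm.odd).of_dvd (dvd_mul_left _ _))
    have hy' : 0 < 1 / (4 * Real.sqrt (Nm m)) / y := by positivity
    have hp := theta_poisson hPer hy'
    have hq : Nm (4 * m) * (1 / (4 * Real.sqrt (Nm m)) / y) = 4 * Real.sqrt (Nm m) / y := by
      rw [Nm_mul, Nm_four]; nth_rewrite 1 [← hss]; field_simp; norm_num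
    rw [hq] at hp
    have hsc : (Real.sqrt (Nm m) : ℂ) ≠ 0 := by exact_mod_cast hs.ne'
    have hyc : (y : ℂ) ≠ 0 := by exact_mod_cast hy.ne'
    unfold th
    calc _ = ∑' n : O, h n * (χ n m : ℂ) *
          ((Real.exp (-π * (1 / (4 * Real.sqrt (Nm m)) / y) * Nm n) : ℝ) : ℂ) := by
          refine tsum_congr (fun n => ?_)
          congr 3; ring
      _ = _ := by
          rw [hp, ← tsum_mul_left, ← tsum_mul_left]
          refine tsum_congr (fun k => ?_)
          rw [ft_crt hχ sm.odd hsf hh k]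
          have e : -π / (4 * Real.sqrt (Nm m) / y) * Nm k = -π * (1 / (4 * Real.sqrt (Nm m)) * Nm k) * y := by
            field_simp
          rw [e]
          unfold Eh
          push_cast
          field_simp

/-- the modulus-4 part of the character -/
def hu (χ : O → O → ℤ) (u n : O) : ℂ := if IsPrimary n then (χ u n : ℂ) else 0

theorem primary_congr {a b : O} (h : (4:O) ∣ a - b) : IsPrimary a ↔ IsPrimary b := by
  unfold IsPrimary
  have h4 : ωg ^ 3 ∣ (4:O) := ⟨-ωg, by ext <;> simp [ωg, pow_succ]⟩
  have h5 := h4.trans h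
  rw [show a - 1 = (a - b) + (b - 1) by ring]
  exact dvd_add_right h5

theorem hu_per {χ : O → O → ℤ} (hχ : IsQuadSym χ) {u : O} (hu1 : u = 1 ∨ u = ig) : Per 4 (hu χ u) := by
  intro a b hab
  unfold hu
  by_cases ha : IsPrimary a
  · have hb := (primary_congr hab).1 ha
    rw [if_pos ha, if_pos hb]
    have oa := (Sp_of_primary ha).odd
    have ob := (Sp_of_primary hb).odd
    rcases hu1 with rfl | rfl
    · rw [chi_one hχ oa, chi_one hχ ob]
    · rw [chi_ig_congr hχ oa ob hab]
  · rw [if_neg ha, if_neg (fun hb => ha ((primary_congr hab).2 hb))]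

theorem hu_zero (χ : O → O → ℤ) (u : O) : hu χ u 0 = 0 := by
  unfold hu
  rw [if_neg]
  intro h; exact (Sp_of_primary h).ne_zero rfl

theorem hu_norm {χ : O → O → ℤ} (hχ : IsQuadSym χ) (u n : O) : ‖hu χ u n‖ ≤ 1 := by
  unfold hu
  split_ifs with h
  · exact chi_norm_le hχ (Sp_of_primary h).odd u
  · simp

theorem L_eq {χ : O → O → ℤ} (hχ : IsQuadSym χ) {L : ℂ → O → ℂ} (hL : IsHeckeL χ L) {m u : O} (sm : Sp m)
    {G : O → ℂ} {a B : ℝ} (T : TP (fun n => hu χ u n * (χ n m : ℂ)) G a B) {s : ℂ} (hs : s ≠ 1) :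
    (s - 1) * L s (u * m) = MM T s := by
  have hD : ∀ s : ℂ, 1 < s.re → L s (u * m) = Dser (fun n => hu χ u n * (χ n m : ℂ)) s := by
    intro s hs
    rw [hL.1 _ s hs]
    unfold Dser
    refine (tsum_subtype {n : O | IsPrimary n} (fun n : O => (χ (u * m) n : ℂ) / (Nm n : ℂ) ^ s)).trans ?_
    refine tsum_congr (fun n => ?_)
    by_cases hn : IsPrimary n
    · rw [Set.indicator_of_mem (by exact hn)]
      unfold hu
      beta_reduce
      rw [if_pos hn, chi_mul hχ (Sp_of_primary hn).odd, recip hχ sm (Sp_of_primary hn)]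
      push_cast; rfl
    · rw [Set.indicator_of_notMem (by exact hn)]
      unfold hu; beta_reduce; rw [if_neg hn]; simp
  have hopen : IsOpen {s : ℂ | s ≠ 1} := isOpen_ne
  have hA1 : AnalyticOnNhd ℂ (fun s => (s - 1) * L s (u * m)) {s : ℂ | s ≠ 1} := by
    apply DifferentiableOn.analyticOnNhd _ hopen
    exact ((differentiable_id.sub_const 1).differentiableOn).mul (hL.2 (u * m))
  have hA2 : AnalyticOnNhd ℂ (MM T) {s : ℂ | s ≠ 1} :=
    ((MM_diff T).differentiableOn).analyticOnNhd hopen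
  have hpre : IsPreconnected {s : ℂ | s ≠ 1} := by
    have := isConnected_compl_singleton_of_one_lt_rank (E := ℂ) (by
      rw [Complex.rank_real_complex]; norm_num) (1:ℂ)
    exact this.isPreconnected
  have := hA1.eqOn_of_preconnected_of_eventuallyEq hA2 hpre (z₀ := 2) (by simp) ?_
  · exact this hs
  · have hmem : {s : ℂ | 1 < s.re} ∈ 𝓝 (2:ℂ) :=
      (isOpen_lt continuous_const Complex.continuous_re).mem_nhds (by simp)
    filter_upwards [hmem] with z hz
    rw [MM_right T hz, hD z hz]


/-! ### The `ℓ²` norm over the family and bounds for Dirichlet polynomials -/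

def ns (S : Finset O) (v : O → ℂ) : ℝ := ‖(WithLp.toLp 2 (fun m : S => v m) : EuclideanSpace ℂ S)‖

theorem ns_sq (S : Finset O) (v : O → ℂ) : ns S v ^ 2 = ∑ m ∈ S, ‖v m‖ ^ 2 := by
  unfold ns
  rw [EuclideanSpace.norm_sq_eq]
  simp only
  exact Finset.sum_coe_sort S (fun m => ‖v m‖ ^ 2)

theorem ns_nonneg (S : Finset O) (v : O → ℂ) : 0 ≤ ns S v := norm_nonneg _

theorem ns_add (S : Finset O) (v w : O → ℂ) : ns S (fun m => v m + w m) ≤ ns S v + ns S w := by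
  unfold ns
  refine le_trans (le_of_eq ?_) (norm_add_le _ _)
  rfl

theorem ns_congr {S : Finset O} {v w : O → ℂ} (h : ∀ m ∈ S, v m = w m) : ns S v = ns S w := by
  have : (fun m : S => v m) = (fun m : S => w m) := funext (fun m => h m m.2)
  unfold ns; rw [this]

theorem ns_le {S : Finset O} {v : O → ℂ} {b : ℝ} (hb : 0 ≤ b) (h : ∑ m ∈ S, ‖v m‖ ^ 2 ≤ b ^ 2) : ns S v ≤ b := by
  rw [← ns_sq] at h
  exact le_of_sq_le_sq h hb

theorem ns_mono {S : Finset O} {v w : O → ℂ} {c : ℝ} (hc : 0 ≤ c) (h : ∀ m ∈ S, ‖v m‖ ≤ c * ‖w m‖) :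
    ns S v ≤ c * ns S w := by
  refine ns_le (mul_nonneg hc (ns_nonneg _ _)) ?_
  rw [mul_pow, ns_sq, Finset.mul_sum]
  refine Finset.sum_le_sum (fun m hm => ?_)
  rw [← mul_pow]
  exact pow_le_pow_left₀ (norm_nonneg _) (h m hm) 2

theorem ns_zero (S : Finset O) {v : O → ℂ} (h : ∀ m ∈ S, v m = 0) : ns S v = 0 := by
  have := ns_sq S v
  rw [Finset.sum_eq_zero (fun m hm => by rw [h m hm]; simp)] at this
  exact pow_eq_zero_iff (two_ne_zero) |>.1 this

theorem ns_smul_le {S : Finset O} {v : O → ℂ} {c : ℂ} {b : ℝ} (hc : ‖c‖ ≤ b) : ns S (fun m => c * v m) ≤ b * ns S v :=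
  ns_mono ((norm_nonneg _).trans hc) (fun m _ => by
    rw [norm_mul]; exact mul_le_mul_of_nonneg_right hc (norm_nonneg _))

def PP (χ : O → O → ℤ) (b : O → ℂ) (A : Finset O) (s : ℂ) (m : O) : ℂ :=
  ∑ n ∈ A, b n * (χ n m : ℂ) / (Nm n : ℂ) ^ s

def RR (X Y : ℝ) : ℝ := Real.sqrt (X + Real.sqrt X * Y)

theorem RR_mono {X Y Y' : ℝ} (h : Y ≤ Y') : RR X Y ≤ RR X Y' := by
  unfold RR
  apply Real.sqrt_le_sqrt
  have := mul_le_mul_of_nonneg_left h (Real.sqrt_nonneg X)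
  linarith

theorem RR_nonneg (X Y : ℝ) : 0 ≤ RR X Y := Real.sqrt_nonneg _

/-- A weighted form of the sieve. -/
theorem sieve_w {χ : O → O → ℤ} (hχ : IsQuadSym χ) {δ : ℝ} (hδ : 0 < δ) (hδ1 : δ ≤ 1/4) : ∃ C : ℝ, 0 < C ∧
    ∀ X N : ℝ, 1 ≤ X → 1 ≤ N → ∀ S : Finset O, (∀ m ∈ S, Sp m ∧ Nm m ≤ X) → ∀ (a : O → ℂ) (c : ℝ), 0 ≤ c →
      (∀ n ∈ nz N, ‖a n‖ ≤ c) →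
      ns S (fun m => ∑ n ∈ nz N, a n * (χ n m : ℂ)) ≤ c * (C * N ^ δ * Real.sqrt N * RR X N) := by
  obtain ⟨C, hC, H⟩ := sieve hχ (δ := 2 * δ) (by positivity) (by linarith)
  refine ⟨Real.sqrt C, Real.sqrt_pos.2 hC, fun X N hX hN S hS a c hc ha => ?_⟩
  have hR := RR_nonneg X N
  rcases hc.eq_or_lt with rfl | hc
  · rw [zero_mul]
    refine le_of_eq (ns_zero S (fun m _ => Finset.sum_eq_zero (fun n hn => ?_)))
    rw [norm_le_zero_iff.1 (ha n hn), zero_mul]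
  · refine ns_le (by positivity) ?_
    have h1 := H X N hX hN S hS (fun n => if n ∈ nz N then a n / c else 0) (fun n => by
      split_ifs with hn
      · rw [norm_div, Complex.norm_real, Real.norm_of_nonneg hc.le, div_le_one hc]; exact ha n hn
      · simp)
    have e : ∀ m, ‖∑ n ∈ nz N, a n * (χ n m : ℂ)‖ ^ 2 =
        c ^ 2 * ‖∑ n ∈ nz N, (if n ∈ nz N then a n / c else 0) * (χ n m : ℂ)‖ ^ 2 := by
      intro m
      have : ∑ n ∈ nz N, a n * (χ n m : ℂ) =
          (c:ℂ) * ∑ n ∈ nz N, (if n ∈ nz N then a n / c else 0) * (χ n m : ℂ) := by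
        rw [Finset.mul_sum]
        refine Finset.sum_congr rfl (fun n hn => ?_)
        have hc' : (c:ℂ) ≠ 0 := by exact_mod_cast hc.ne'
        rw [if_pos hn]; field_simp
      rw [this, norm_mul, mul_pow, Complex.norm_real, Real.norm_of_nonneg hc.le]
    simp_rw [e]
    rw [← Finset.mul_sum]
    refine (mul_le_mul_of_nonneg_left h1 (by positivity)).trans (le_of_eq ?_)
    have hN0 : 0 < N := by linarith
    have e1 : (N ^ δ) ^ 2 = N ^ (2 * δ) := by
      rw [← Real.rpow_natCast, ← Real.rpow_mul hN0.le]; congr 1; push_cast; ring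
    have e2 : RR X N ^ 2 = X + Real.sqrt X * N := by
      unfold RR; apply Real.sq_sqrt
      have := Real.sqrt_nonneg X
      positivity
    rw [mul_pow, mul_pow, mul_pow, mul_pow, Real.sq_sqrt hC.le, Real.sq_sqrt hN0.le, e1, e2]
    ring

theorem PP_block {χ : O → O → ℤ} (hχ : IsQuadSym χ) {δ : ℝ} (hδ : 0 < δ) (hδ1 : δ ≤ 1/4) : ∃ C : ℝ, 0 < C ∧
    ∀ X Y : ℝ, 1 ≤ X → 1 ≤ Y → ∀ S : Finset O, (∀ m ∈ S, Sp m ∧ Nm m ≤ X) → ∀ b : O → ℂ, (∀ n, ‖b n‖ ≤ 4) →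
      ∀ s : ℂ, 0 ≤ s.re → s.re ≤ 3/2 →
      ns S (PP χ b (nz Y \ nz (Y / 2)) s) ≤ C * Y ^ (δ + 1/2 - s.re) * RR X Y := by
  obtain ⟨C, hC, H⟩ := sieve_w hχ hδ hδ1
  refine ⟨C * 4 * 4, by positivity, fun X Y hX hY S hS b hb s hs hs2 => ?_⟩
  have hY0 : 0 < Y := by linarith
  have h1 := H X Y hX hY S hS (fun n => if n ∈ nz (Y / 2) then 0 else b n / (Nm n : ℂ) ^ s)
    (4 * (Y / 2) ^ (-s.re)) (by positivity) (fun n hn => by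
      split_ifs with h
      · simp; positivity
      · rw [mem_nz] at hn h
        have hlt : Y / 2 < Nm n := by
          by_contra hh
          exact h ⟨not_lt.1 hh, hn.2⟩
        rw [norm_div, norm_Nm_cpow hn.2, div_eq_mul_inv, ← Real.rpow_neg (Nm_nonneg n)]
        refine mul_le_mul (hb n) ?_ (Real.rpow_nonneg (Nm_nonneg n) _) (by norm_num)
        exact Real.rpow_le_rpow_of_nonpos (by positivity) hlt.le (by linarith))
  have e : ns S (PP χ b (nz Y \ nz (Y / 2)) s) =
      ns S (fun m => ∑ n ∈ nz Y, (if n ∈ nz (Y / 2) then 0 else b n / (Nm n : ℂ) ^ s) * (χ n m : ℂ)) := by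
    refine ns_congr (fun m _ => ?_)
    unfold PP
    rw [Finset.sdiff_eq_filter, Finset.sum_filter]
    refine Finset.sum_congr rfl (fun n _ => ?_)
    by_cases h : n ∈ nz (Y / 2)
    · rw [if_pos h, if_neg (not_not.2 h), zero_mul]
    · rw [if_neg h, if_pos h]; ring
  rw [e]
  refine h1.trans ?_
  have e3 : (Y / 2) ^ (-s.re) ≤ 4 * Y ^ (-s.re) := by
    rw [Real.div_rpow hY0.le (by norm_num), Real.rpow_neg (by norm_num : (0:ℝ) ≤ 2), div_inv_eq_mul, mul_comm]
    refine mul_le_mul_of_nonneg_right ?_ (by positivity)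
    calc (2:ℝ) ^ s.re ≤ 2 ^ (2:ℝ) := Real.rpow_le_rpow_of_exponent_le (by norm_num) (by linarith)
      _ = 4 := by norm_num
  have e4 : Y ^ (δ + 1/2 - s.re) = Y ^ δ * Real.sqrt Y * Y ^ (-s.re) := by
    rw [Real.sqrt_eq_rpow, ← Real.rpow_add hY0, ← Real.rpow_add hY0]; congr 1
  rw [e4]
  have hR := RR_nonneg X Y
  calc 4 * (Y / 2) ^ (-s.re) * (C * Y ^ δ * Real.sqrt Y * RR X Y)
      ≤ 4 * (4 * Y ^ (-s.re)) * (C * Y ^ δ * Real.sqrt Y * RR X Y) := by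
        refine mul_le_mul_of_nonneg_right ?_ (by positivity)
        linarith
    _ = _ := by ring

theorem PP_neg {χ : O → O → ℤ} (hχ : IsQuadSym χ) {δ : ℝ} (hδ : 0 < δ) (hδ1 : δ ≤ 1/4) : ∃ C : ℝ, 0 < C ∧
    ∀ X Y : ℝ, 1 ≤ X → 1 ≤ Y → ∀ S : Finset O, (∀ m ∈ S, Sp m ∧ Nm m ≤ X) → ∀ b : O → ℂ, (∀ n, ‖b n‖ ≤ 4) →
      ∀ s : ℂ, s.re = -(1/2) →
      ns S (PP χ b (nz Y) s) ≤ C * Y ^ (δ + 1) * RR X Y := by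
  obtain ⟨C, hC, H⟩ := sieve_w hχ hδ hδ1
  refine ⟨4 * C, by positivity, fun X Y hX hY S hS b hb s hs => ?_⟩
  have hY0 : 0 < Y := by linarith
  have h1 := H X Y hX hY S hS (fun n => b n / (Nm n : ℂ) ^ s)
    (4 * Y ^ (1/2:ℝ)) (by positivity) (fun n hn => by
        rw [mem_nz] at hn
        rw [norm_div, norm_Nm_cpow hn.2, div_eq_mul_inv, ← Real.rpow_neg (Nm_nonneg n), hs, neg_neg]
        refine mul_le_mul (hb n) ?_ (Real.rpow_nonneg (Nm_nonneg n) _) (by norm_num)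
        exact Real.rpow_le_rpow (Nm_nonneg n) hn.1 (by norm_num))
  have e : ns S (PP χ b (nz Y) s) =
      ns S (fun m => ∑ n ∈ nz Y, (b n / (Nm n : ℂ) ^ s) * (χ n m : ℂ)) := by
    refine ns_congr (fun m _ => ?_)
    unfold PP
    exact Finset.sum_congr rfl (fun n _ => by ring)
  rw [e]
  refine h1.trans (le_of_eq ?_)
  have e4 : Y ^ (δ + 1) = Y ^ δ * Real.sqrt Y * Y ^ (1/2:ℝ) := by
    rw [Real.sqrt_eq_rpow, ← Real.rpow_add hY0, ← Real.rpow_add hY0]; congr 1; ring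
  rw [e4]; ring

theorem nz_mono {Y Y' : ℝ} (h : Y ≤ Y') : nz Y ⊆ nz Y' := by
  intro n hn; rw [mem_nz] at *; exact ⟨hn.1.trans h, hn.2⟩

theorem PP_sdiff (χ : O → O → ℤ) (b : O → ℂ) {A B : Finset O} (h : A ⊆ B) (s : ℂ) (m : O) :
    PP χ b B s m = PP χ b (B \ A) s m + PP χ b A s m := by
  unfold PP; rw [Finset.sum_sdiff h]

theorem PP_half {χ : O → O → ℤ} (hχ : IsQuadSym χ) {δ : ℝ} (hδ : 0 < δ) (hδ1 : δ ≤ 1/4) : ∃ C : ℝ, 0 < C ∧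
    ∀ X Y : ℝ, 1 ≤ X → 1 ≤ Y → ∀ S : Finset O, (∀ m ∈ S, Sp m ∧ Nm m ≤ X) → ∀ b : O → ℂ, (∀ n, ‖b n‖ ≤ 4) →
      ∀ s : ℂ, s.re = 1/2 →
      ns S (PP χ b (nz Y) s) ≤ C * Y ^ δ * RR X Y := by
  obtain ⟨C, hC, H⟩ := PP_block hχ hδ hδ1
  have h2 : (2:ℝ) ^ (-δ) < 1 := Real.rpow_lt_one_of_one_lt_of_neg (by norm_num) (by linarith)
  have h20 : (0:ℝ) < 2 ^ (-δ) := by positivity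
  set K := C / (1 - 2 ^ (-δ)) with hK
  have hKp : 0 < K := div_pos hC (by linarith)
  have hKe : K * 2 ^ (-δ) + C = K := by
    rw [hK]; field_simp [show (1 - (2:ℝ) ^ (-δ)) ≠ 0 by linarith]; ring
  have main : ∀ k : ℕ, ∀ X Y : ℝ, 1 ≤ X → 0 < Y → Y < 2 ^ k → ∀ S : Finset O, (∀ m ∈ S, Sp m ∧ Nm m ≤ X) →
      ∀ b : O → ℂ, (∀ n, ‖b n‖ ≤ 4) → ∀ s : ℂ, s.re = 1/2 →
      ns S (PP χ b (nz Y) s) ≤ K * Y ^ δ * RR X Y := by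
    intro k
    induction k with
    | zero =>
      intro X Y hX hY hY1 S hS b hb s hs
      have : nz Y = ∅ := nz_empty (by simpa using hY1)
      rw [this, ns_zero S (fun m _ => by unfold PP; simp)]
      have := RR_nonneg X Y
      positivity
    | succ k ih =>
      intro X Y hX hY hYk S hS b hb s hs
      by_cases hY1 : Y < 1
      · have : nz Y = ∅ := nz_empty hY1
        rw [this, ns_zero S (fun m _ => by unfold PP; simp)]
        have := RR_nonneg X Y
        positivity
      · have i1 := ih X (Y / 2) hX (by positivity) (by rw [pow_succ] at hYk; linarith) S hS b hb s hs
        have i2 := H X Y hX (not_lt.1 hY1) S hS b hb s (by rw [hs]; norm_num) (by rw [hs]; norm_num)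
        rw [hs, show δ + 1/2 - 1/2 = δ by ring] at i2
        have hsub : nz (Y / 2) ⊆ nz Y := nz_mono (by linarith)
        have i3 : ns S (PP χ b (nz Y) s) ≤ ns S (PP χ b (nz Y \ nz (Y / 2)) s) + ns S (PP χ b (nz (Y / 2)) s) := by
          rw [ns_congr (fun m _ => PP_sdiff χ b hsub s m)]; exact ns_add _ _ _
        have e : (Y / 2) ^ δ = 2 ^ (-δ) * Y ^ δ := by
          rw [Real.div_rpow hY.le (by norm_num), Real.rpow_neg (by norm_num)]; field_simp
        have hR : RR X (Y / 2) ≤ RR X Y := RR_mono (by linarith)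
        rw [e] at i1
        have i4 : K * (2 ^ (-δ) * Y ^ δ) * RR X (Y / 2) ≤ K * (2 ^ (-δ) * Y ^ δ) * RR X Y :=
          mul_le_mul_of_nonneg_left hR (by positivity)
        calc _ ≤ C * Y ^ δ * RR X Y + K * (2 ^ (-δ) * Y ^ δ) * RR X Y := by linarith
          _ = (K * 2 ^ (-δ) + C) * Y ^ δ * RR X Y := by ring
          _ = _ := by rw [hKe]
  refine ⟨K, hKp, fun X Y hX hY S hS b hb s hs => ?_⟩
  obtain ⟨k, hk⟩ := pow_unbounded_of_one_lt Y (by norm_num : (1:ℝ) < 2)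
  exact main k X Y hX (by linarith) hk S hS b hb s hs

theorem RR_two_pow {X Y : ℝ} (hX : 0 ≤ X) (hY : 0 ≤ Y) (k : ℕ) :
    RR X (2 ^ k * Y) ≤ (2:ℝ) ^ ((k:ℝ) / 2) * RR X Y := by
  have e : (2:ℝ) ^ ((k:ℝ) / 2) = Real.sqrt (2 ^ k) := by
    rw [Real.sqrt_eq_rpow, ← Real.rpow_natCast, ← Real.rpow_mul (by norm_num)]; congr 1; ring
  rw [e]; unfold RR
  rw [← Real.sqrt_mul (by positivity)]
  apply Real.sqrt_le_sqrt
  have : (1:ℝ) ≤ 2 ^ k := one_le_pow₀ (by norm_num)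
  nlinarith

theorem PP_tail {χ : O → O → ℤ} (hχ : IsQuadSym χ) {δ : ℝ} (hδ : 0 < δ) (hδ1 : δ ≤ 1/4) : ∃ C : ℝ, 0 < C ∧
    ∀ X Y : ℝ, 1 ≤ X → 1 ≤ Y → ∀ S : Finset O, (∀ m ∈ S, Sp m ∧ Nm m ≤ X) → ∀ b : O → ℂ, (∀ n, ‖b n‖ ≤ 4) →
      ∀ s : ℂ, s.re = 3/2 →
      ns S (fun m => Dser (fun n => b n * (χ n m : ℂ)) s - PP χ b (nz Y) s m) ≤ C * Y ^ (δ - 1) * RR X Y := by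
  obtain ⟨C, hC, H⟩ := PP_block hχ hδ hδ1
  set ρ : ℝ := 2 ^ (δ - 1/2) with hρ
  have hρ0 : 0 < ρ := by positivity
  have hρ1 : ρ < 1 := Real.rpow_lt_one_of_one_lt_of_neg (by norm_num) (by linarith)
  refine ⟨C / (1 - ρ), div_pos hC (by linarith), fun X Y hX hY S hS b hb s hs => ?_⟩
  have hY0 : 0 < Y := by linarith
  have hR := RR_nonneg X Y
  have main : ∀ k : ℕ, ns S (PP χ b (nz (2 ^ k * Y) \ nz Y) s) ≤
      C * Y ^ (δ - 1) * RR X Y * ∑ j ∈ Finset.range k, ρ ^ (j + 1) := by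
    intro k
    induction k with
    | zero =>
      simp only [pow_zero, one_mul, Finset.sdiff_self, Finset.range_zero, Finset.sum_empty, mul_zero]
      exact le_of_eq (ns_zero S (fun m _ => by unfold PP; simp))
    | succ k ih =>
      have hp : (1:ℝ) ≤ 2 ^ (k+1) := one_le_pow₀ (by norm_num)
      have i2 := H X (2 ^ (k + 1) * Y) hX (by nlinarith) S hS b hb s (by rw [hs]; norm_num) (by rw [hs])
      have eh : 2 ^ (k + 1) * Y / 2 = 2 ^ k * Y := by rw [pow_succ]; ring
      rw [eh, hs, show δ + 1/2 - 3/2 = δ - 1 by ring] at i2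
      have hk1 : (1:ℝ) ≤ 2 ^ k := one_le_pow₀ (by norm_num)
      have hsub1 : nz Y ⊆ nz (2 ^ k * Y) := nz_mono (by nlinarith)
      have hsub2 : nz (2 ^ k * Y) ⊆ nz (2 ^ (k + 1) * Y) := nz_mono (by rw [pow_succ]; nlinarith)
      have i3 : ns S (PP χ b (nz (2 ^ (k + 1) * Y) \ nz Y) s) ≤
          ns S (PP χ b (nz (2 ^ (k + 1) * Y) \ nz (2 ^ k * Y)) s) + ns S (PP χ b (nz (2 ^ k * Y) \ nz Y) s) := by
        rw [ns_congr (w := fun m => PP χ b (nz (2 ^ (k + 1) * Y) \ nz (2 ^ k * Y)) s m +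
          PP χ b (nz (2 ^ k * Y) \ nz Y) s m) (fun m _ => ?_)]
        · exact ns_add _ _ _
        · have a1 := PP_sdiff χ b (hsub1.trans hsub2) s m
          have a2 := PP_sdiff χ b hsub1 s m
          have a3 := PP_sdiff χ b hsub2 s m
          linear_combination a3 + a2 - a1
      have i4 : C * (2 ^ (k + 1) * Y) ^ (δ - 1) * RR X (2 ^ (k + 1) * Y) ≤
          C * Y ^ (δ - 1) * RR X Y * ρ ^ (k + 1) := by
        have r1 := RR_two_pow (X := X) (Y := Y) (by linarith) hY0.le (k + 1)
        have e1 : ((2:ℝ) ^ (k + 1) * Y) ^ (δ - 1) = (2:ℝ) ^ (((k + 1 : ℕ) : ℝ) * (δ - 1)) * Y ^ (δ - 1) := by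
          rw [Real.mul_rpow (by positivity) hY0.le, ← Real.rpow_natCast, ← Real.rpow_mul (by norm_num)]
        have e2 : ρ ^ (k + 1) = (2:ℝ) ^ (((k + 1 : ℕ) : ℝ) * (δ - 1)) * (2:ℝ) ^ (((k + 1 : ℕ) : ℝ) / 2) := by
          rw [hρ, ← Real.rpow_natCast, ← Real.rpow_mul (by norm_num), ← Real.rpow_add (by norm_num)]
          congr 1; ring
        rw [e1, e2]
        calc _ ≤ C * ((2:ℝ) ^ (((k + 1 : ℕ) : ℝ) * (δ - 1)) * Y ^ (δ - 1)) *
              ((2:ℝ) ^ (((k + 1 : ℕ) : ℝ) / 2) * RR X Y) := mul_le_mul_of_nonneg_left r1 (by positivity)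
          _ = _ := by ring
      rw [Finset.sum_range_succ, mul_add]
      linarith
  have hgeo : ∀ k : ℕ, ∑ j ∈ Finset.range k, ρ ^ (j + 1) ≤ 1 / (1 - ρ) := by
    intro k
    have h1 : ∑ j ∈ Finset.range k, ρ ^ (j + 1) ≤ ∑ j ∈ Finset.range k, ρ ^ j := by
      refine Finset.sum_le_sum (fun j _ => ?_)
      rw [pow_succ]; nlinarith [pow_pos hρ0 j]
    have h2 := (summable_geometric_of_lt_one hρ0.le hρ1).sum_le_tsum (Finset.range k) (fun j _ => by positivity)
    rw [tsum_geometric_of_lt_one hρ0.le hρ1] at h2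
    rw [one_div]; linarith
  have main2 : ∀ k : ℕ, ns S (fun m => PP χ b (nz (2 ^ k * Y)) s m - PP χ b (nz Y) s m) ≤
      C / (1 - ρ) * Y ^ (δ - 1) * RR X Y := by
    intro k
    have hk1 : (1:ℝ) ≤ 2 ^ k := one_le_pow₀ (by norm_num)
    have hsub1 : nz Y ⊆ nz (2 ^ k * Y) := nz_mono (by nlinarith)
    rw [ns_congr (w := PP χ b (nz (2 ^ k * Y) \ nz Y) s) (fun m _ => by
      rw [PP_sdiff χ b hsub1 s m]; ring)]
    refine (main k).trans ?_
    refine (mul_le_mul_of_nonneg_left (hgeo k) (by positivity)).trans (le_of_eq ?_)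
    ring
  have hs1 : 1 < s.re := by rw [hs]; norm_num
  have hs0 : s ≠ 0 := by rintro rfl; simp at hs1; linarith
  have hlim : ∀ m ∈ S, Tendsto (fun k : ℕ => PP χ b (nz (2 ^ k * Y)) s m) atTop
      (𝓝 (Dser (fun n => b n * (χ n m : ℂ)) s)) := by
    intro m hm
    have hsum := (Dser_summable (F := fun n => b n * (χ n m : ℂ)) (B := 4) (fun n => by
      rw [norm_mul]
      have := mul_le_mul (hb n) (chi_norm_le hχ (hS m hm).1.odd n) (norm_nonneg _) (by norm_num)
      linarith) hs1).hasSum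
    have hB : Tendsto (fun k : ℕ => Bl (2 ^ k * Y)) atTop atTop := by
      rw [tendsto_atTop]
      intro A
      obtain ⟨k0, hk0⟩ := pow_unbounded_of_one_lt (∑ n ∈ A, Nm n) (by norm_num : (1:ℝ) < 2)
      filter_upwards [eventually_ge_atTop k0] with k hk
      intro n hn
      rw [mem_Bl]
      have := Finset.single_le_sum (f := fun n => Nm n) (fun n _ => Nm_nonneg n) hn
      have h3 : (2:ℝ) ^ k0 ≤ 2 ^ k := pow_le_pow_right₀ (by norm_num) hk
      have h4 : (0:ℝ) < 2 ^ k := by positivity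
      have : Nm n ≤ ∑ n ∈ A, Nm n := this
      nlinarith
    have h5 := hsum.comp hB
    refine h5.congr (fun k => ?_)
    simp only [Function.comp]
    unfold PP nz
    rw [Finset.sum_filter]
    refine Finset.sum_congr rfl (fun n _ => ?_)
    by_cases hn : n = 0
    · subst hn; rw [Nm_zero, Complex.ofReal_zero, Complex.zero_cpow hs0]; simp
    · rw [if_pos hn]
  have hR2 : 0 ≤ C / (1 - ρ) * Y ^ (δ - 1) * RR X Y := by
    have : 0 < C / (1 - ρ) := div_pos hC (by linarith)
    positivity
  refine ns_le hR2 ?_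
  have hfin : Tendsto (fun k : ℕ => ∑ m ∈ S, ‖PP χ b (nz (2 ^ k * Y)) s m - PP χ b (nz Y) s m‖ ^ 2) atTop
      (𝓝 (∑ m ∈ S, ‖Dser (fun n => b n * (χ n m : ℂ)) s - PP χ b (nz Y) s m‖ ^ 2)) := by
    refine tendsto_finsetSum _ (fun m hm => ?_)
    exact (((hlim m hm).sub_const _).norm).pow 2
  refine le_of_tendsto' hfin (fun k => ?_)
  rw [← ns_sq S (fun m => PP χ b (nz (2 ^ k * Y)) s m - PP χ b (nz Y) s m)]
  exact pow_le_pow_left₀ (ns_nonneg _ _) (main2 k) 2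


/-! ### Phragmén–Lindelöf for the family, and elementary estimates -/

theorem ns_le_sum (S : Finset O) (v : O → ℂ) : ns S v ≤ ∑ m ∈ S, ‖v m‖ := by
  refine ns_le (Finset.sum_nonneg (fun _ _ => norm_nonneg _)) ?_
  exact Finset.sum_sq_le_sq_sum_of_nonneg (fun _ _ => norm_nonneg _)

theorem PL_ns {a b : ℝ} (hab : a < b) (hab2 : b - a ≤ 2) {S : Finset O} {f : O → ℂ → ℂ} {κ C : ℝ} (hκ : 0 ≤ κ)
    (hd : ∀ m ∈ S, ∀ z : ℂ, a ≤ z.re → z.re ≤ b → DifferentiableAt ℂ (f m) z)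
    (hg : ∀ m ∈ S, ∃ K : ℝ, 0 < K ∧ ∀ z : ℂ, a ≤ z.re → z.re ≤ b → 1 ≤ |z.im| →
      ‖f m z‖ ≤ K * Real.exp (κ * |z.im|))
    (ha : ∀ z : ℂ, z.re = a → ns S (fun m => f m z) ≤ C)
    (hb : ∀ z : ℂ, z.re = b → ns S (fun m => f m z) ≤ C)
    {z : ℂ} (hza : a ≤ z.re) (hzb : z.re ≤ b) : ns S (fun m => f m z) ≤ C := by
  have hdiff : ∀ w : ℂ, a ≤ w.re → w.re ≤ b →
      DifferentiableAt ℂ (fun z => (WithLp.toLp 2 (fun m : S => f m z) : EuclideanSpace ℂ S)) w := by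
    intro w h1 h2
    rw [differentiableAt_euclidean]
    intro m
    exact hd m m.2 w h1 h2
  have := PhragmenLindelof.vertical_strip (a := a) (b := b) (C := C) (z := z)
    (f := fun z => (WithLp.toLp 2 (fun m : S => f m z) : EuclideanSpace ℂ S)) ?_ ?_ ?_ ?_ hza hzb
  · exact this
  · refine ⟨fun w hw => (hdiff w ?_ ?_).differentiableWithinAt, fun w hw => (hdiff w ?_ ?_).continuousAt.continuousWithinAt⟩
    · exact hw.1.le
    · exact hw.2.le
    all_goals
      rw [Complex.closure_preimage_re, closure_Ioo hab.ne] at hw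
    · exact hw.1
    · exact hw.2
  · refine ⟨1, ?_, κ, ?_⟩
    · rw [lt_div_iff₀ (by linarith)]; linarith [pi_gt_three]
    · have hex : ∃ K : O → ℝ, ∀ m ∈ S, 0 < K m ∧ ∀ z : ℂ, a ≤ z.re → z.re ≤ b → 1 ≤ |z.im| →
          ‖f m z‖ ≤ K m * Real.exp (κ * |z.im|) := by
        choose! K hK using hg
        exact ⟨K, hK⟩
      obtain ⟨K, hK⟩ := hex
      refine Asymptotics.IsBigO.of_bound (∑ m ∈ S, K m) ?_
      rw [eventually_inf_principal]
      have hev : ∀ᶠ w : ℂ in comap (_root_.abs ∘ Complex.im) atTop, 1 ≤ |w.im| :=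
        (tendsto_comap (f := (_root_.abs ∘ Complex.im)) (x := atTop)).eventually (eventually_ge_atTop 1)
      filter_upwards [hev] with w hw hw2
      have h1 : ns S (fun m => f m w) ≤ ∑ m ∈ S, K m * Real.exp (κ * |w.im|) :=
        (ns_le_sum S _).trans (Finset.sum_le_sum (fun m hm => (hK m hm).2 w hw2.1.le hw2.2.le hw))
      refine (show _ ≤ _ from h1).trans ?_
      rw [← Finset.sum_mul, Real.norm_of_nonneg (Real.exp_pos _).le]
      refine mul_le_mul_of_nonneg_left (Real.exp_le_exp.2 ?_) (Finset.sum_nonneg (fun m hm => (hK m hm).1.le))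
      have := Real.add_one_le_exp (1 * |w.im|)
      refine mul_le_mul_of_nonneg_left ?_ hκ
      linarith
  · intro w hw; exact ha w hw
  · intro w hw; exact hb w hw

theorem exp_poly {u : ℝ} (hu : 0 ≤ u) : Real.exp (-u ^ 2) * (1 + u) ^ 3 ≤ 8 := by
  have h1 := Real.quadratic_le_exp_of_nonneg (x := u ^ 2) (by positivity)
  rw [Real.exp_neg, inv_mul_le_iff₀ (Real.exp_pos _)]
  nlinarith [sq_nonneg (u - 1), sq_nonneg (u ^ 2 - u), mul_nonneg hu (sq_nonneg (u - 1)), sq_nonneg (u ^ 2 - 1)]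

/-- gamma quotient -/
def gq (s : ℂ) : ℂ := Complex.Gamma (2 - s) * (Complex.Gamma s)⁻¹

theorem norm_Gamma_half (t : ℝ) : ‖Complex.Gamma (1/2 - t * I)‖ = ‖Complex.Gamma (1/2 + t * I)‖ := by
  rw [← Complex.norm_conj (Complex.Gamma (1/2 + t * I)), ← Complex.Gamma_conj]
  congr 2
  simp [Complex.ext_iff]

theorem Gamma_half_ne (t : ℝ) : Complex.Gamma (1/2 + t * I) ≠ 0 :=
  Complex.Gamma_ne_zero_of_re_pos (by simp)

theorem s_eq {s : ℂ} {σ : ℝ} (h : s.re = σ) : s = σ + s.im * I := by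
  rw [← h, Complex.re_add_im]

theorem gq_half {s : ℂ} (h : s.re = 1/2) : ‖gq s‖ = ‖s - 1‖ := by
  have e := s_eq h
  set t := s.im
  have e1 : Complex.Gamma (2 - s) = (1/2 - t * I) * Complex.Gamma (1/2 - t * I) := by
    rw [← Complex.Gamma_add_one]
    · congr 1; rw [e]; push_cast; ring
    · intro h0; have := congrArg Complex.re h0; simp at this
  have e2 : s = 1/2 + t * I := by rw [e]; push_cast; ring
  unfold gq
  have hs : Complex.Gamma s ≠ 0 := by rw [e2]; exact Gamma_half_ne t
  rw [e1, norm_mul, norm_mul, norm_inv, norm_Gamma_half, ← e2, mul_assoc,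
    mul_inv_cancel₀ (norm_ne_zero_iff.2 hs), mul_one, ← norm_neg]
  congr 1; rw [e2]; ring

theorem gq_right {s : ℂ} (h : s.re = 3/2) : ‖gq s‖ = ‖s - 1‖⁻¹ := by
  have e := s_eq h
  set t := s.im
  have e2 : s = (1/2 + t * I) + 1 := by rw [e]; push_cast; ring
  have hne : (1/2 + t * I : ℂ) ≠ 0 := by
    intro h0; have := congrArg Complex.re h0; simp at this
  have e1 : Complex.Gamma s = (1/2 + t * I) * Complex.Gamma (1/2 + t * I) := by
    rw [← Complex.Gamma_add_one _ hne, ← e2]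
  have e3 : 2 - s = 1/2 - t * I := by rw [e]; push_cast; ring
  unfold gq
  have hs := norm_ne_zero_iff.2 (Gamma_half_ne t)
  rw [e1, e3, norm_mul, norm_inv, norm_mul, norm_Gamma_half, mul_inv, mul_comm, mul_assoc,
    inv_mul_cancel₀ hs, mul_one]
  congr 2; rw [e2]; ring

theorem gq_left {s : ℂ} (h : s.re = -(1/2)) : ‖gq s‖ ≤ (2 + |s.im|) ^ 3 := by
  have e := s_eq h
  set t := s.im
  have e2 : 1/2 + t * I = s + 1 := by rw [e]; push_cast; ring
  have hne : s ≠ 0 := by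
    rintro rfl; simp at h
  have e1 : Complex.Gamma (1/2 + t * I) = s * Complex.Gamma s := by
    rw [← Complex.Gamma_add_one _ hne, ← e2]
  have hn1 : (1/2 - t * I : ℂ) ≠ 0 := by
    intro h0; have := congrArg Complex.re h0; simp at this
  have hn2 : (1/2 - t * I + 1 : ℂ) ≠ 0 := by
    intro h0; have := congrArg Complex.re h0; norm_num at this
  have e3 : Complex.Gamma (2 - s) = (1/2 - t * I + 1) * ((1/2 - t * I) * Complex.Gamma (1/2 - t * I)) := by
    rw [← Complex.Gamma_add_one _ hn1, ← Complex.Gamma_add_one _ hn2]; congr 1; rw [e]; push_cast; ring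
  have hs : Complex.Gamma s ≠ 0 := by
    intro h0; rw [h0, mul_zero] at e1; exact Gamma_half_ne t e1
  have e4 : ‖gq s‖ = ‖(1/2 - t * I + 1 : ℂ)‖ * ‖(1/2 - t * I : ℂ)‖ * ‖s‖ := by
    unfold gq
    rw [e3, norm_mul, norm_mul, norm_mul, norm_inv, norm_Gamma_half, e1, norm_mul]
    have := norm_ne_zero_iff.2 hs
    field_simp
  have b : ∀ z : ℂ, |z.re| ≤ 2 → |z.im| = |t| → ‖z‖ ≤ 2 + |t| := by
    intro z h1 h2
    have := Complex.norm_le_abs_re_add_abs_im z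
    linarith
  rw [e4, show (2 + |t|) ^ 3 = (2 + |t|) * (2 + |t|) * (2 + |t|) by ring]
  have b1 : ‖(1/2 - t * I + 1 : ℂ)‖ ≤ 2 + |t| := b _ (by norm_num [abs_le]) (by simp)
  have b2 : ‖(1/2 - t * I : ℂ)‖ ≤ 2 + |t| := b _ (by norm_num [abs_le]) (by simp)
  have b3 : ‖s‖ ≤ 2 + |t| := b _ (by rw [h]; norm_num [abs_le]) rfl
  gcongr

theorem gq_growth : ∃ K : ℝ, 0 < K ∧ ∀ s : ℂ, -(1/2) ≤ s.re → s.re ≤ 3/2 → 1 ≤ |s.im| →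
    ‖gq s‖ ≤ K * Real.exp (5 * |s.im|) := by
  obtain ⟨K1, hK1, h1⟩ := inv_Gamma_growth
  obtain ⟨K2, hK2, h2⟩ := Gamma_strip (a := 1/2) (b := 5/2) (by norm_num)
  refine ⟨K2 * K1, by positivity, fun s a1 a2 a3 => ?_⟩
  unfold gq
  rw [norm_mul]
  have := mul_le_mul (h2 (2 - s) (by simp; linarith) (by simp; linarith)) (h1 s a1 a2 a3) (norm_nonneg _) hK2.le
  refine this.trans ?_
  rw [mul_assoc]
  refine mul_le_mul_of_nonneg_left (mul_le_mul_of_nonneg_left (Real.exp_le_exp.2 ?_) hK1.le) hK2.le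
  exact mul_le_mul_of_nonneg_right (by linarith [pi_lt_four]) (abs_nonneg _)

theorem gq_diff {s : ℂ} (h : s.re < 2) : DifferentiableAt ℂ gq s := by
  unfold gq
  refine DifferentiableAt.mul ?_ (Complex.differentiable_one_div_Gamma s)
  refine DifferentiableAt.comp s (g := Complex.Gamma) ?_ (differentiableAt_id.const_sub 2)
  refine Complex.differentiableAt_Gamma _ (fun m h0 => ?_)
  have := congrArg Complex.re h0
  simp at this
  have : (0:ℝ) ≤ m := Nat.cast_nonneg m
  linarith

theorem norm_exp_sq (s s0 : ℂ) (h : |s.re - s0.re| ≤ 1) :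
    ‖Complex.exp ((s - s0) ^ 2)‖ ≤ 3 * Real.exp (-|s.im - s0.im| ^ 2) := by
  rw [Complex.norm_exp]
  have e : ((s - s0) ^ 2).re = (s.re - s0.re) ^ 2 - |s.im - s0.im| ^ 2 := by
    rw [sq_abs, pow_two, Complex.mul_re]; simp; ring
  rw [e, sub_eq_add_neg, Real.exp_add]
  refine mul_le_mul_of_nonneg_right ?_ (Real.exp_pos _).le
  have h1 : (s.re - s0.re) ^ 2 ≤ 1 := by rw [← sq_abs]; nlinarith [abs_nonneg (s.re - s0.re)]
  calc Real.exp ((s.re - s0.re) ^ 2) ≤ Real.exp 1 := Real.exp_le_exp.2 h1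
    _ ≤ 3 := by have := Real.exp_one_lt_d9; linarith


/-! ### Families of completed L-functions -/

/-- exponential growth in the strip -/
def EG (κ : ℝ) (f : ℂ → ℂ) : Prop := ∃ K : ℝ, 0 < K ∧ ∀ z : ℂ, -(1/2) ≤ z.re → z.re ≤ 3/2 → 1 ≤ |z.im| →
      ‖f z‖ ≤ K * Real.exp (κ * |z.im|)

theorem EG.add {κ : ℝ} {f g : ℂ → ℂ} (hf : EG κ f) (hg : EG κ g) : EG κ (fun z => f z + g z) := by
  obtain ⟨K, hK, h1⟩ := hf
  obtain ⟨K', hK', h2⟩ := hg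
  refine ⟨K + K', by positivity, fun z a b c => (norm_add_le _ _).trans ?_⟩
  rw [add_mul]
  exact add_le_add (h1 z a b c) (h2 z a b c)

theorem EG.sub {κ : ℝ} {f g : ℂ → ℂ} (hf : EG κ f) (hg : EG κ g) : EG κ (fun z => f z - g z) := by
  obtain ⟨K, hK, h1⟩ := hf
  obtain ⟨K', hK', h2⟩ := hg
  refine ⟨K + K', by positivity, fun z a b c => (norm_sub_le _ _).trans ?_⟩
  rw [add_mul]
  exact add_le_add (h1 z a b c) (h2 z a b c)

theorem EG.mul0 {κ : ℝ} {f g : ℂ → ℂ} (hf : EG κ f) (hg : EG 0 g) : EG κ (fun z => f z * g z) := by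
  obtain ⟨K, hK, h1⟩ := hf
  obtain ⟨K', hK', h2⟩ := hg
  refine ⟨K * K', by positivity, fun z a b c => ?_⟩
  rw [norm_mul]
  have := mul_le_mul (h1 z a b c) (h2 z a b c) (norm_nonneg _) (by positivity)
  refine this.trans (le_of_eq ?_)
  simp; ring

theorem EG_bdd {f : ℂ → ℂ} (K : ℝ) (h : ∀ z : ℂ, -(1/2) ≤ z.re → z.re ≤ 3/2 → ‖f z‖ ≤ K) : EG 0 f := by
  refine ⟨|K| + 1, by positivity, fun z a b c => ?_⟩
  have := h z a b
  simp
  linarith [le_abs_self K]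

theorem EG_lin : EG 5 (fun z => z - 1) := by
  refine ⟨3, by norm_num, fun z a b c => ?_⟩
  have h1 := Complex.norm_le_abs_re_add_abs_im (z - 1)
  have h2 : |(z-1).re| ≤ 2 := by rw [abs_le]; constructor <;> simp <;> linarith
  have h3 : (z-1).im = z.im := by simp
  rw [h3] at h1
  have := Real.add_one_le_exp (5 * |z.im|)
  linarith [abs_nonneg z.im]

theorem EG_cpow {a : ℝ} (ha : 0 < a) (c d : ℝ) (e : ℂ) : EG 0 (fun z => (a:ℂ) ^ (c * z + e)) := by
  refine EG_bdd (Real.exp (|Real.log a| * (|c| * 2 + |e.re|))) (fun z h1 h2 => ?_)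
  rw [Complex.norm_cpow_eq_rpow_re_of_pos ha, Real.rpow_def_of_pos ha]
  refine Real.exp_le_exp.2 ((le_abs_self _).trans ?_)
  rw [abs_mul]
  refine mul_le_mul_of_nonneg_left ?_ (abs_nonneg _)
  have : (c * z + e).re = c * z.re + e.re := by simp
  rw [this]
  refine (abs_add_le _ _).trans ?_
  rw [abs_mul]
  have : |z.re| ≤ 2 := by rw [abs_le]; constructor <;> linarith
  have := mul_le_mul_of_nonneg_left this (abs_nonneg c)
  linarith

theorem PP_bdd {χ : O → O → ℤ} (hχ : IsQuadSym χ) {m : O} (sm : Sp m) {b : O → ℂ} (hb : ∀ n, ‖b n‖ ≤ 4) (Y : ℝ) :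
    ∃ K : ℝ, ∀ s : ℂ, -(1/2) ≤ s.re → ‖PP χ b (nz Y) s m‖ ≤ K := by
  refine ⟨∑ n ∈ nz Y, 4 * Nm n, fun s hs => ?_⟩
  unfold PP
  refine (norm_sum_le _ _).trans (Finset.sum_le_sum (fun n hn => ?_))
  have hn0 := (mem_nz.1 hn).2
  have h1 := one_le_Nm hn0
  rw [norm_div, norm_mul, norm_Nm_cpow hn0]
  have h2 : ‖b n‖ * ‖(χ n m : ℂ)‖ ≤ 4 * 1 :=
    mul_le_mul (hb n) (chi_norm_le hχ sm.odd n) (norm_nonneg _) (by norm_num)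
  rw [div_le_iff₀ (Real.rpow_pos_of_pos (by linarith) _), mul_assoc]
  have h3 : 1 ≤ Nm n * Nm n ^ s.re := by
    rw [← Real.rpow_one_add' (by linarith) (by linarith)]
    exact Real.one_le_rpow h1 (by linarith)
  linarith

theorem PP_diff (χ : O → O → ℤ) (b : O → ℂ) (Y : ℝ) (m : O) : Differentiable ℂ (fun s => PP χ b (nz Y) s m) := by
  intro s
  unfold PP
  refine DifferentiableAt.fun_sum (fun n hn => ?_)
  have hn0 : (Nm n : ℂ) ≠ 0 := by
    have := Nm_pos (mem_nz.1 hn).2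
    exact_mod_cast this.ne'
  refine DifferentiableAt.div (differentiableAt_const _) ?_ (by simp [Complex.cpow_eq_zero_iff, hn0])
  exact differentiableAt_id.const_cpow (Or.inl hn0)

def al (m : O) : ℝ := π * (1 / (4 * Real.sqrt (Nm m)))

structure MF (χ : O → O → ℤ) (X : ℝ) (S : Finset O) (h E w : O → ℂ) (M : O → ℂ → ℂ) : Prop where
  hX : 1 ≤ X
  hS : ∀ m ∈ S, Sp m ∧ Nm m ≤ X
  hlow : ∀ m ∈ S, X / 2 < Nm m
  hh : ∀ n, ‖h n‖ ≤ 4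
  hE : ∀ n, ‖E n‖ ≤ 4
  hw : ∀ m ∈ S, ‖w m‖ = 1
  diff : ∀ m ∈ S, Differentiable ℂ (M m)
  right : ∀ m ∈ S, ∀ s : ℂ, 1 < s.re → M m s = (s - 1) * Dser (fun n => h n * (χ n m : ℂ)) s
  left : ∀ m ∈ S, ∀ s : ℂ, s.re < 0 → M m s =
    -(gq s * (al m : ℂ) ^ (2 * s - 1) * (w m * Dser (fun n => E n * (χ n m : ℂ)) (1 - s)))
  growth : ∀ m ∈ S, EG 5 (M m)

theorem al_pos {m : O} (sm : Sp m) : 0 < al m := by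
  unfold al
  have := Nm_pos sm.ne_zero
  positivity

theorem al_sq {m : O} (sm : Sp m) : al m ^ 2 = π ^ 2 / (16 * Nm m) := by
  unfold al
  have := Nm_pos sm.ne_zero
  have h2 := Real.sq_sqrt this.le
  rw [mul_pow, div_pow, mul_pow, h2]
  ring

theorem al_half {m : O} (sm : Sp m) {s : ℂ} (hs : s.re = 1/2) : ‖(al m : ℂ) ^ (2 * s - 1)‖ = 1 := by
  rw [Complex.norm_cpow_eq_rpow_re_of_pos (al_pos sm)]
  simp [hs]

theorem al_right {X : ℝ} (hX : 1 ≤ X) {m : O} (sm : Sp m) (hl : X / 2 < Nm m) {s : ℂ} (hs : s.re = 3/2) :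
    ‖(al m : ℂ) ^ (2 * s - 1)‖ ≤ 2 / X := by
  rw [Complex.norm_cpow_eq_rpow_re_of_pos (al_pos sm)]
  have : (2 * s - 1).re = (2:ℕ) := by simp [hs]; norm_num
  rw [this, Real.rpow_natCast, al_sq sm, div_le_div_iff₀ (by linarith) (by linarith)]
  have h16 : π ^ 2 ≤ 16 := by nlinarith [pi_lt_four, pi_pos]
  nlinarith

theorem al_left {X : ℝ} (hX : 1 ≤ X) {m : O} (sm : Sp m) (hl : Nm m ≤ X) {s : ℂ} (hs : s.re = -(1/2)) :
    ‖(al m : ℂ) ^ (2 * s - 1)‖ ≤ 2 * X := by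
  rw [Complex.norm_cpow_eq_rpow_re_of_pos (al_pos sm)]
  have : (2 * s - 1).re = -(2:ℕ) := by simp [hs]; norm_num
  have hp := Nm_pos sm.ne_zero
  rw [this, Real.rpow_neg (al_pos sm).le, Real.rpow_natCast, al_sq sm, inv_div, div_le_iff₀ (by positivity)]
  have h9 : 9 ≤ π ^ 2 := by nlinarith [pi_gt_three]
  nlinarith


/-! ### Step A: the bound on the critical line -/

/-- the bracket -/
def Br (χ : O → O → ℤ) (h E w : O → ℂ) (M : O → ℂ → ℂ) (Z : ℝ) (m : O) (s : ℂ) : ℂ :=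
  M m s - (s - 1) * PP χ h (nz Z) s m + gq s * (al m : ℂ) ^ (2 * s - 1) * (w m * PP χ E (nz Z) (1 - s) m)

theorem Br_right {χ : O → O → ℤ} {X Z : ℝ} {S : Finset O} {h E w : O → ℂ} {M : O → ℂ → ℂ}
    (F : MF χ X S h E w M) {A B : ℝ} {s : ℂ} (hs : s.re = 3/2)
    (hA : ns S (fun m => Dser (fun n => h n * (χ n m : ℂ)) s - PP χ h (nz Z) s m) ≤ A)
    (hB : ns S (PP χ E (nz Z) (1 - s)) ≤ B) :
    ns S (fun m => Br χ h E w M Z m s) ≤ ‖s - 1‖ * A + ‖s - 1‖⁻¹ * (2 / X) * B := by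
  have hX := F.hX
  have e : ns S (fun m => Br χ h E w M Z m s) = ns S (fun m =>
      (s - 1) * (Dser (fun n => h n * (χ n m : ℂ)) s - PP χ h (nz Z) s m) +
      gq s * (al m : ℂ) ^ (2 * s - 1) * (w m * PP χ E (nz Z) (1 - s) m)) := by
    refine ns_congr (fun m hm => ?_)
    unfold Br
    rw [F.right m hm s (by rw [hs]; norm_num)]
    ring
  rw [e]
  refine (ns_add _ _ _).trans (add_le_add ?_ ?_)
  · exact (ns_smul_le le_rfl).trans (mul_le_mul_of_nonneg_left hA (norm_nonneg _))
  · refine (ns_mono (w := PP χ E (nz Z) (1 - s)) (c := ‖s - 1‖⁻¹ * (2 / X)) (by positivity) (fun m hm => ?_)).trans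
      (mul_le_mul_of_nonneg_left hB (by positivity))
    rw [norm_mul, norm_mul, norm_mul, F.hw m hm, one_mul, gq_right hs]
    refine mul_le_mul_of_nonneg_right ?_ (norm_nonneg _)
    exact mul_le_mul_of_nonneg_left (al_right hX (F.hS m hm).1 (F.hlow m hm) hs) (by positivity)

theorem Br_left {χ : O → O → ℤ} {X Z : ℝ} {S : Finset O} {h E w : O → ℂ} {M : O → ℂ → ℂ}
    (F : MF χ X S h E w M) {A B : ℝ} {s : ℂ} (hs : s.re = -(1/2))
    (hA : ns S (fun m => Dser (fun n => E n * (χ n m : ℂ)) (1 - s) - PP χ E (nz Z) (1 - s) m) ≤ A)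
    (hB : ns S (PP χ h (nz Z) s) ≤ B) :
    ns S (fun m => Br χ h E w M Z m s) ≤ ‖s - 1‖ * B + (2 + |s.im|) ^ 3 * (2 * X) * A := by
  have hX := F.hX
  have e : ns S (fun m => Br χ h E w M Z m s) = ns S (fun m =>
      -(s - 1) * PP χ h (nz Z) s m +
      -(gq s * (al m : ℂ) ^ (2 * s - 1) * (w m * (Dser (fun n => E n * (χ n m : ℂ)) (1 - s) - PP χ E (nz Z) (1 - s) m)))) := by
    refine ns_congr (fun m hm => ?_)
    unfold Br
    rw [F.left m hm s (by rw [hs]; norm_num)]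
    ring
  rw [e]
  refine (ns_add _ _ _).trans (add_le_add ?_ ?_)
  · exact (ns_smul_le (norm_neg _).le).trans (mul_le_mul_of_nonneg_left hB (norm_nonneg _))
  · refine (ns_mono (w := fun m => Dser (fun n => E n * (χ n m : ℂ)) (1 - s) - PP χ E (nz Z) (1 - s) m)
      (c := (2 + |s.im|) ^ 3 * (2 * X)) (by positivity) (fun m hm => ?_)).trans
      (mul_le_mul_of_nonneg_left hA (by positivity))
    rw [norm_neg, norm_mul, norm_mul, norm_mul, F.hw m hm, one_mul]
    refine mul_le_mul_of_nonneg_right ?_ (norm_nonneg _)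
    exact mul_le_mul (gq_left hs) (al_left hX (F.hS m hm).1 (F.hS m hm).2 hs) (norm_nonneg _) (by positivity)

theorem Br_half {χ : O → O → ℤ} {X Z : ℝ} {S : Finset O} {h E w : O → ℂ} {M : O → ℂ → ℂ}
    (F : MF χ X S h E w M) {A B D : ℝ} {s : ℂ} (hs : s.re = 1/2)
    (hA : ns S (PP χ h (nz Z) s) ≤ A)
    (hB : ns S (PP χ E (nz Z) (1 - s)) ≤ B)
    (hD : ns S (fun m => Br χ h E w M Z m s) ≤ D) :
    ns S (fun m => M m s) ≤ D + ‖s - 1‖ * A + ‖s - 1‖ * B := by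
  have e : ns S (fun m => M m s) = ns S (fun m => (Br χ h E w M Z m s + (s - 1) * PP χ h (nz Z) s m) +
      -(gq s * (al m : ℂ) ^ (2 * s - 1) * (w m * PP χ E (nz Z) (1 - s) m))) := by
    refine ns_congr (fun m hm => ?_)
    unfold Br
    ring
  rw [e]
  refine (ns_add _ _ _).trans (add_le_add ((ns_add _ _ _).trans (add_le_add hD ?_)) ?_)
  · exact (ns_smul_le le_rfl).trans (mul_le_mul_of_nonneg_left hA (norm_nonneg _))
  · refine (ns_mono (w := PP χ E (nz Z) (1 - s)) (c := ‖s - 1‖) (by positivity) (fun m hm => ?_)).trans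
      (mul_le_mul_of_nonneg_left hB (by positivity))
    rw [norm_neg, norm_mul, norm_mul, norm_mul, F.hw m hm, one_mul, gq_half hs, al_half (F.hS m hm).1 hs, mul_one]

theorem Br_diff {χ : O → O → ℤ} {X Z : ℝ} {S : Finset O} {h E w : O → ℂ} {M : O → ℂ → ℂ}
    (F : MF χ X S h E w M) {m : O} (hm : m ∈ S) {s : ℂ} (hs : s.re < 2) :
    DifferentiableAt ℂ (Br χ h E w M Z m) s := by
  unfold Br
  have ha : (al m : ℂ) ≠ 0 := by exact_mod_cast (al_pos (F.hS m hm).1).ne'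
  have h1 : DifferentiableAt ℂ (fun s => PP χ E (nz Z) (1 - s) m) s :=
    DifferentiableAt.comp s (g := fun s => PP χ E (nz Z) s m) (PP_diff χ E Z m _) (differentiableAt_id.const_sub 1)
  have h2 : DifferentiableAt ℂ (fun s : ℂ => (al m : ℂ) ^ (2 * s - 1)) s :=
    DifferentiableAt.const_cpow (by fun_prop) (Or.inl ha)
  exact ((F.diff m hm s).sub ((differentiableAt_id.sub_const 1).mul (PP_diff χ h Z m s))).add
    (((gq_diff hs).mul h2).mul (h1.const_mul _))

theorem Br_growth {χ : O → O → ℤ} (hχ : IsQuadSym χ) {X Z : ℝ} {S : Finset O} {h E w : O → ℂ} {M : O → ℂ → ℂ}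
    (F : MF χ X S h E w M) {m : O} (hm : m ∈ S) : EG 5 (Br χ h E w M Z m) := by
  obtain ⟨K1, h1⟩ := PP_bdd hχ (F.hS m hm).1 F.hh Z
  obtain ⟨K2, h2⟩ := PP_bdd hχ (F.hS m hm).1 F.hE Z
  have e1 : EG 0 (fun z => PP χ h (nz Z) z m) := EG_bdd K1 (fun z a _ => h1 z a)
  have e2 : EG 0 (fun z => w m * PP χ E (nz Z) (1 - z) m) := EG_bdd K2 (fun z a b => by
    rw [norm_mul, F.hw m hm, one_mul]
    exact h2 (1 - z) (by simp; linarith))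
  have e3 : EG 0 (fun z => (al m : ℂ) ^ (2 * z - 1)) := by
    have := EG_cpow (al_pos (F.hS m hm).1) 2 0 (-1)
    simpa [sub_eq_add_neg] using this
  exact ((F.growth m hm).sub (EG_lin.mul0 e1)).add (EG.mul0 (EG.mul0 gq_growth e3) e2)

theorem abs_T {t t0 : ℝ} : 2 + |t| ≤ (|t0| + 2) * (1 + |t - t0|) := by
  have := abs_sub_abs_le_abs_sub t t0
  nlinarith [abs_nonneg t0, abs_nonneg (t - t0), mul_nonneg (abs_nonneg t0) (abs_nonneg (t - t0))]

theorem realR {X T u p A B C3 C1 Z δ R e : ℝ} (hX : 1 ≤ X) (hT : 2 ≤ T) (hu : 0 ≤ u) (hp : 0 < p)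
    (hC3 : 0 < C3) (hC1 : 0 < C1) (hR : 0 ≤ R)
    (hZ0 : 0 < Z) (hZ : Z ^ 2 = X * T ^ 2) (hA : A = C3 * Z ^ (δ - 1) * R) (hB : B = C1 * Z ^ (δ + 1) * R)
    (hp1 : p ≤ T * (1 + u)) (hp2 : T ≤ p * (5 * (1 + u))) (he : 0 ≤ e) (he1 : e * (1 + u) ^ 3 ≤ 8) :
    (Z * (3 * e)) * (p * A + p⁻¹ * (2 / X) * B) ≤ 240 * (C1 + C3) * (T * Z ^ δ * R) := by
  have hX0 : 0 < X := by linarith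
  have hz1 : Z ^ (δ - 1) = Z ^ δ / Z := by rw [Real.rpow_sub_one hZ0.ne']
  have hz2 : Z ^ (δ + 1) = Z ^ δ * Z := by rw [Real.rpow_add_one hZ0.ne']
  have hzp : 0 < Z ^ δ := Real.rpow_pos_of_pos hZ0 _
  rw [hA, hB, hz1, hz2]
  have e1 : (Z * (3 * e)) * (p * (C3 * (Z ^ δ / Z) * R) + p⁻¹ * (2 / X) * (C1 * (Z ^ δ * Z) * R)) =
      3 * e * (Z ^ δ * R) * (p * C3 + 2 * (Z ^ 2 / X * p⁻¹) * C1) := by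
    field_simp
  have e2 : Z ^ 2 / X = T ^ 2 := by rw [hZ]; field_simp
  have e3 : T ^ 2 * p⁻¹ ≤ 5 * (1 + u) * T := by
    rw [mul_inv_le_iff₀ hp]; nlinarith
  have hu3 : (1 + u) ≤ (1 + u) ^ 3 := by nlinarith [mul_nonneg hu hu, mul_nonneg hu (mul_nonneg hu hu)]
  have he2 : e * (1 + u) ≤ 8 := (mul_le_mul_of_nonneg_left hu3 he).trans he1
  rw [e1, e2]
  have e4 : p * C3 + 2 * (T ^ 2 * p⁻¹) * C1 ≤ 10 * (C1 + C3) * T * (1 + u) := by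
    nlinarith [mul_nonneg (mul_nonneg hC3.le (by linarith : 0 ≤ T)) (by linarith : 0 ≤ 1 + u),
      mul_le_mul_of_nonneg_right hp1 hC3.le, mul_le_mul_of_nonneg_right e3 hC1.le]
  have hq : 0 ≤ Z ^ δ * R := by positivity
  calc 3 * e * (Z ^ δ * R) * (p * C3 + 2 * (T ^ 2 * p⁻¹) * C1)
      ≤ 3 * e * (Z ^ δ * R) * (10 * (C1 + C3) * T * (1 + u)) := by gcongr
    _ = 30 * (C1 + C3) * T * (Z ^ δ * R) * (e * (1 + u)) := by ring
    _ ≤ 30 * (C1 + C3) * T * (Z ^ δ * R) * 8 := by gcongr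
    _ = _ := by ring

theorem realL {X T u p q A B C3 C1 Z δ R e : ℝ} (hX : 1 ≤ X) (hT : 2 ≤ T) (hu : 0 ≤ u)
    (hC3 : 0 < C3) (hC1 : 0 < C1) (hR : 0 ≤ R)
    (hZ0 : 0 < Z) (hZ : Z ^ 2 = X * T ^ 2) (hA : A = C3 * Z ^ (δ - 1) * R) (hB : B = C1 * Z ^ (δ + 1) * R)
    (hpq : p ≤ q) (hq0 : 0 ≤ q) (hq : q ≤ T * (1 + u)) (he : 0 ≤ e) (he1 : e * (1 + u) ^ 3 ≤ 8) :
    (Z⁻¹ * (3 * e)) * (p * B + q ^ 3 * (2 * X) * A) ≤ 240 * (C1 + C3) * (T * Z ^ δ * R) := by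
  have hX0 : 0 < X := by linarith
  have hz1 : Z ^ (δ - 1) = Z ^ δ / Z := by rw [Real.rpow_sub_one hZ0.ne']
  have hz2 : Z ^ (δ + 1) = Z ^ δ * Z := by rw [Real.rpow_add_one hZ0.ne']
  have hzp : 0 < Z ^ δ := Real.rpow_pos_of_pos hZ0 _
  rw [hA, hB, hz1, hz2]
  have e1 : (Z⁻¹ * (3 * e)) * (p * (C1 * (Z ^ δ * Z) * R) + q ^ 3 * (2 * X) * (C3 * (Z ^ δ / Z) * R)) =
      3 * e * (Z ^ δ * R) * (p * C1 + 2 * (q ^ 3 * (X / Z ^ 2)) * C3) := by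
    field_simp
  have e2 : X / Z ^ 2 = (T ^ 2)⁻¹ := by rw [hZ]; field_simp
  have e3 : q ^ 3 * (T ^ 2)⁻¹ ≤ T * (1 + u) ^ 3 := by
    rw [mul_inv_le_iff₀ (by positivity)]
    calc q ^ 3 ≤ (T * (1 + u)) ^ 3 := pow_le_pow_left₀ hq0 hq 3
      _ = _ := by ring
  have hu3 : (1 + u) ≤ (1 + u) ^ 3 := by nlinarith [mul_nonneg hu hu, mul_nonneg hu (mul_nonneg hu hu)]
  have e5 : p ≤ T * (1 + u) ^ 3 := (hpq.trans hq).trans (mul_le_mul_of_nonneg_left hu3 (by linarith))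
  rw [e1, e2]
  have e4 : p * C1 + 2 * (q ^ 3 * (T ^ 2)⁻¹) * C3 ≤ 10 * (C1 + C3) * T * (1 + u) ^ 3 := by
    have : 0 ≤ T * (1 + u) ^ 3 := by positivity
    nlinarith [mul_le_mul_of_nonneg_right e5 hC1.le, mul_le_mul_of_nonneg_right e3 hC3.le,
      mul_nonneg this hC1.le, mul_nonneg this hC3.le]
  have hq' : 0 ≤ Z ^ δ * R := by positivity
  calc 3 * e * (Z ^ δ * R) * (p * C1 + 2 * (q ^ 3 * (T ^ 2)⁻¹) * C3)
      ≤ 3 * e * (Z ^ δ * R) * (10 * (C1 + C3) * T * (1 + u) ^ 3) := by gcongr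
    _ = 30 * (C1 + C3) * T * (Z ^ δ * R) * (e * (1 + u) ^ 3) := by ring
    _ ≤ 30 * (C1 + C3) * T * (Z ^ δ * R) * 8 := by gcongr
    _ = _ := by ring

theorem stepA {χ : O → O → ℤ} (hχ : IsQuadSym χ) {δ : ℝ} (hδ : 0 < δ) (hδ1 : δ ≤ 1/4) : ∃ C : ℝ, 0 < C ∧
    ∀ X S h E w M, MF χ X S h E w M → ∀ s0 : ℂ, s0.re = 1/2 → ∀ T Z : ℝ, T = |s0.im| + 2 → Z = Real.sqrt X * T →
      ns S (fun m => M m s0) ≤ C * (T * Z ^ δ * RR X Z) := by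
  obtain ⟨C1, hC1, H1⟩ := PP_neg hχ hδ hδ1
  obtain ⟨C2, hC2, H2⟩ := PP_half hχ hδ hδ1
  obtain ⟨C3, hC3, H3⟩ := PP_tail hχ hδ hδ1
  refine ⟨240 * (C1 + C3) + 2 * C2, by positivity, fun X S h E w M F s0 hs0 T Z hT hZ => ?_⟩
  have hX := F.hX
  have hT2 : 2 ≤ T := by rw [hT]; linarith [abs_nonneg s0.im]
  have hsX : 1 ≤ Real.sqrt X := Real.one_le_sqrt.2 hX
  have hZ1 : 1 ≤ Z := by rw [hZ]; nlinarith
  have hZ0 : 0 < Z := by linarith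
  have hZ2 : Z ^ 2 = X * T ^ 2 := by rw [hZ, mul_pow, Real.sq_sqrt (by linarith)]
  have hR := RR_nonneg X Z
  have hzp : 0 < Z ^ δ := Real.rpow_pos_of_pos hZ0 _
  have main : ns S (fun m => (Z : ℂ) ^ (s0 - s0) * Complex.exp ((s0 - s0) ^ 2) * Br χ h E w M Z m s0) ≤
      240 * (C1 + C3) * (T * Z ^ δ * RR X Z) := by
    refine PL_ns (a := -(1/2)) (b := 3/2) (κ := 5)
      (f := fun m s => (Z : ℂ) ^ (s - s0) * Complex.exp ((s - s0) ^ 2) * Br χ h E w M Z m s)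
      (by norm_num) (by norm_num) (by norm_num) ?_ ?_ ?_ ?_ (by rw [hs0]; norm_num) (by rw [hs0]; norm_num)
    · intro m hm z h1 h2
      have : DifferentiableAt ℂ (fun s : ℂ => (Z : ℂ) ^ (s - s0)) z :=
        DifferentiableAt.const_cpow (by fun_prop) (Or.inl (by exact_mod_cast hZ0.ne'))
      exact (this.mul (by fun_prop)).mul (Br_diff F hm (by linarith))
    · intro m hm
      have e1 : EG 0 (fun s => (Z : ℂ) ^ (s - s0)) := by
        have := EG_cpow hZ0 1 0 (-s0)
        simpa [sub_eq_add_neg] using this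
      have e2 : EG 0 (fun s => Complex.exp ((s - s0) ^ 2)) := EG_bdd 3 (fun z a b => by
        refine (norm_exp_sq z s0 (by rw [hs0, abs_le]; constructor <;> linarith)).trans ?_
        have : Real.exp (-|z.im - s0.im| ^ 2) ≤ 1 := Real.exp_le_one_iff.2 (by simp [sq_nonneg])
        linarith)
      have : EG 5 (fun s => (Z : ℂ) ^ (s - s0) * Complex.exp ((s - s0) ^ 2) * Br χ h E w M Z m s) := by
        simpa [mul_comm] using (Br_growth (Z := Z) hχ F hm).mul0 (e1.mul0 e2)
      exact this
    · intro s hs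
      have hu := abs_nonneg (s.im - s0.im)
      refine (ns_smul_le (b := Z⁻¹ * (3 * Real.exp (-|s.im - s0.im| ^ 2))) ?_).trans ?_
      · rw [norm_mul, Complex.norm_cpow_eq_rpow_re_of_pos hZ0]
        have : (s - s0).re = -1 := by simp [hs, hs0]; norm_num
        rw [this, Real.rpow_neg_one]
        exact mul_le_mul_of_nonneg_left (norm_exp_sq s s0 (by rw [hs, hs0]; norm_num [abs_le])) (by positivity)
      · refine (mul_le_mul_of_nonneg_left (Br_left F hs (H3 X Z hX hZ1 S F.hS E F.hE (1 - s) (by simp [hs]; norm_num))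
          (H1 X Z hX hZ1 S F.hS h F.hh s hs)) (by positivity)).trans ?_
        refine realL hX hT2 hu hC3 hC1 hR hZ0 hZ2 rfl rfl ?_ (by positivity) ?_ (Real.exp_pos _).le (exp_poly hu)
        · have h1 := Complex.norm_le_abs_re_add_abs_im (s - 1)
          have h2 : |(s-1).re| ≤ 2 := by rw [abs_le]; constructor <;> simp [hs] <;> norm_num
          have h3 : (s-1).im = s.im := by simp
          rw [h3] at h1
          linarith
        · rw [hT]; exact abs_T
    · intro s hs
      have hu := abs_nonneg (s.im - s0.im)
      refine (ns_smul_le (b := Z * (3 * Real.exp (-|s.im - s0.im| ^ 2))) ?_).trans ?_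
      · rw [norm_mul, Complex.norm_cpow_eq_rpow_re_of_pos hZ0]
        have : (s - s0).re = 1 := by simp [hs, hs0]; norm_num
        rw [this, Real.rpow_one]
        exact mul_le_mul_of_nonneg_left (norm_exp_sq s s0 (by rw [hs, hs0]; norm_num [abs_le])) (by positivity)
      · refine (mul_le_mul_of_nonneg_left (Br_right F hs (H3 X Z hX hZ1 S F.hS h F.hh s hs)
          (H1 X Z hX hZ1 S F.hS E F.hE (1 - s) (by simp [hs]; norm_num))) (by positivity)).trans ?_
        have h1 := Complex.norm_le_abs_re_add_abs_im (s - 1)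
        have h2 : (s-1).re = 1/2 := by simp [hs]; norm_num
        have h3 : (s-1).im = s.im := by simp
        have h4 := Complex.abs_re_le_norm (s - 1)
        have h5 := Complex.abs_im_le_norm (s - 1)
        rw [h3] at h5
        rw [h2, abs_of_pos (by norm_num)] at h4
        rw [h2, h3, abs_of_pos (by norm_num)] at h1
        refine realR hX hT2 hu (by linarith) hC3 hC1 hR hZ0 hZ2 rfl rfl ?_ ?_ (Real.exp_pos _).le (exp_poly hu)
        · have := abs_T (t := s.im) (t0 := s0.im)
          rw [hT]; linarith
        · have := abs_sub_abs_le_abs_sub s0.im s.im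
          rw [abs_sub_comm s0.im s.im] at this
          rw [hT]; nlinarith
  simp only [sub_self, Complex.cpow_zero, one_mul, ne_eq, OfNat.ofNat_ne_zero, not_false_eq_true, zero_pow,
    Complex.exp_zero] at main
  refine (Br_half F hs0 (H2 X Z hX hZ1 S F.hS h F.hh s0 hs0) (H2 X Z hX hZ1 S F.hS E F.hE (1 - s0)
    (by simp [hs0]; norm_num)) main).trans ?_
  have h1 := Complex.norm_le_abs_re_add_abs_im (s0 - 1)
  have h2 : |(s0-1).re| ≤ 2 := by rw [abs_le]; constructor <;> simp [hs0] <;> norm_num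
  have h3 : (s0-1).im = s0.im := by simp
  rw [h3] at h1
  have h4 : ‖s0 - 1‖ ≤ T := by linarith
  have h5 : 0 ≤ C2 * Z ^ δ * RR X Z := by positivity
  nlinarith [mul_le_mul_of_nonneg_right h4 h5]


/-! ### Step B: the bound in the strip -/

theorem Dser_bdd : ∃ C : ℝ, 0 < C ∧ ∀ F : O → ℂ, (∀ n, ‖F n‖ ≤ 4) → ∀ s : ℂ, 3/2 ≤ s.re → ‖Dser F s‖ ≤ C := by
  have hsum : Summable (fun n : O => 4 * Nm n ^ (-(3/2) : ℝ)) := (summable_Nm_rpow (by norm_num)).mul_left 4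
  have hnn : ∀ n : O, 0 ≤ 4 * Nm n ^ (-(3/2) : ℝ) := fun n => by
    have := Real.rpow_nonneg (Nm_nonneg n) (-(3/2)); linarith
  refine ⟨(∑' n : O, 4 * Nm n ^ (-(3/2) : ℝ)) + 1, add_pos_of_nonneg_of_pos (tsum_nonneg hnn) one_pos, fun F hF s hs => ?_⟩
  have hs0 : s ≠ 0 := by rintro rfl; simp at hs; linarith
  have hb : ∀ n : O, ‖F n / (Nm n : ℂ) ^ s‖ ≤ 4 * Nm n ^ (-(3/2) : ℝ) := by
    intro n
    by_cases hn : n = 0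
    · subst hn
      rw [Nm_zero, Complex.ofReal_zero, Complex.zero_cpow hs0]
      have := hnn 0
      rw [Nm_zero] at this
      simpa using this
    · rw [norm_div, norm_Nm_cpow hn, Real.rpow_neg (Nm_nonneg n), div_eq_mul_inv]
      have h1 := one_le_Nm hn
      refine mul_le_mul (hF n) ?_ (inv_nonneg.2 (Real.rpow_nonneg (Nm_nonneg n) _)) (by norm_num)
      refine inv_anti₀ (Real.rpow_pos_of_pos (by linarith) _) ?_
      exact Real.rpow_le_rpow_of_exponent_le h1 hs
  have := tsum_of_norm_bounded hsum.hasSum hb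
  unfold Dser
  linarith

theorem ns_card {S : Finset O} {X : ℝ} (hX : 1 ≤ X) (hS : ∀ m ∈ S, Nm m ≤ X) {v : O → ℂ} {b : ℝ} (hb : 0 ≤ b)
    (hv : ∀ m ∈ S, ‖v m‖ ≤ b) : ns S v ≤ b * (3 * Real.sqrt X) := by
  refine ns_le (by positivity) ?_
  have h1 : S ⊆ Bl X := fun m hm => by simpa using hS m hm
  have h2 : (S.card : ℝ) ≤ 9 * X := le_trans (by exact_mod_cast Finset.card_le_card h1) (card_Bl hX)
  calc ∑ m ∈ S, ‖v m‖ ^ 2 ≤ ∑ m ∈ S, b ^ 2 := Finset.sum_le_sum (fun m hm => pow_le_pow_left₀ (norm_nonneg _) (hv m hm) 2)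
    _ = S.card * b ^ 2 := by rw [Finset.sum_const, nsmul_eq_mul]
    _ ≤ (9 * X) * b ^ 2 := by gcongr
    _ = (b * (3 * Real.sqrt X)) ^ 2 := by rw [mul_pow, mul_pow, Real.sq_sqrt (by linarith)]; ring

theorem RZ_bound {X T δ : ℝ} (hδ : 0 < δ) (hX : 1 ≤ X) (hT : 2 ≤ T) :
    T * (Real.sqrt X * T) ^ δ * RR X (Real.sqrt X * T) ≤ 2 * (T * (X * T) ^ (1/2 + δ)) := by
  have hXT : 0 < X * T := by positivity
  have hs : Real.sqrt X ≤ X := Real.sqrt_le_iff.2 ⟨by linarith, by nlinarith⟩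
  have h1 : (Real.sqrt X * T) ^ δ ≤ (X * T) ^ δ := by
    refine Real.rpow_le_rpow (by positivity) ?_ hδ.le
    gcongr
  have h2 : RR X (Real.sqrt X * T) ≤ 2 * (X * T) ^ (1/2 : ℝ) := by
    unfold RR
    rw [← Real.sqrt_eq_rpow, Real.sqrt_le_left (by positivity), mul_pow, Real.sq_sqrt hXT.le, ← mul_assoc,
      Real.mul_self_sqrt (by linarith)]
    nlinarith
  rw [Real.rpow_add hXT]
  have h3 := mul_le_mul h1 h2 (RR_nonneg _ _) (by positivity)
  have := mul_le_mul_of_nonneg_left h3 (by linarith : 0 ≤ T)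
  linarith

theorem W_mono {X T T' u δ : ℝ} (hδ : 0 < δ) (hδ1 : δ ≤ 1/4) (hX : 1 ≤ X) (hT : 2 ≤ T) (hT' : 0 ≤ T') (hu : 0 ≤ u)
    (h : T' ≤ T * (1 + u)) : T' * (X * T') ^ (1/2 + δ) ≤ (1 + u) ^ 3 * (T * (X * T) ^ (1/2 + δ)) := by
  have h1 : (X * T') ^ (1/2 + δ) ≤ (X * T) ^ (1/2 + δ) * (1 + u) := by
    calc (X * T') ^ (1/2 + δ) ≤ ((X * T) * (1 + u)) ^ (1/2 + δ) := by
          refine Real.rpow_le_rpow (by positivity) ?_ (by positivity)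
          rw [mul_assoc]; gcongr
      _ = (X * T) ^ (1/2 + δ) * (1 + u) ^ (1/2 + δ) := Real.mul_rpow (by positivity) (by positivity)
      _ ≤ (X * T) ^ (1/2 + δ) * (1 + u) ^ (1 : ℝ) := by
          gcongr
          · linarith
          · linarith
      _ = _ := by rw [Real.rpow_one]
  have hp : 0 ≤ (X * T) ^ (1/2 + δ) := by positivity
  calc T' * (X * T') ^ (1/2 + δ) ≤ (T * (1 + u)) * ((X * T) ^ (1/2 + δ) * (1 + u)) :=
        mul_le_mul h h1 (by positivity) (by positivity)
    _ = (1 + u) ^ 2 * (T * (X * T) ^ (1/2 + δ)) := by ring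
    _ ≤ (1 + u) ^ 3 * (T * (X * T) ^ (1/2 + δ)) := by
        have : (1 + u) ^ 2 ≤ (1 + u) ^ 3 := pow_le_pow_right₀ (by linarith) (by norm_num)
        gcongr

theorem stepB {χ : O → O → ℤ} (hχ : IsQuadSym χ) {δ : ℝ} (hδ : 0 < δ) (hδ1 : δ ≤ 1/4) : ∃ C : ℝ, 0 < C ∧
    ∀ X S h E w M, MF χ X S h E w M → (∀ n, ‖h n‖ ≤ 1) → ∀ s0 : ℂ, 1/2 ≤ s0.re → s0.re ≤ 3/2 →
      ∀ T : ℝ, T = |s0.im| + 2 →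
      ns S (fun m => M m s0) ≤ C * (T * (X * T) ^ (1/2 + δ)) := by
  obtain ⟨CA, hCA, HA⟩ := stepA hχ hδ hδ1
  obtain ⟨C0, hC0, H0⟩ := Dser_bdd
  refine ⟨24 * (2 * CA + 3 * C0), by positivity, fun X S h E w M F hh1 s0 hs1 hs2 T hT => ?_⟩
  have hX := F.hX
  have hT2 : 2 ≤ T := by rw [hT]; linarith [abs_nonneg s0.im]
  set W := T * (X * T) ^ (1/2 + δ) with hW
  have hW0 : 0 ≤ W := by positivity
  have main : ns S (fun m => Complex.exp ((s0 - s0) ^ 2) * M m s0) ≤ 24 * (2 * CA + 3 * C0) * W := by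
    refine PL_ns (a := 1/2) (b := 3/2) (κ := 5)
      (f := fun m s => Complex.exp ((s - s0) ^ 2) * M m s)
      (by norm_num) (by norm_num) (by norm_num) ?_ ?_ ?_ ?_ hs1 hs2
    · intro m hm z h1 h2
      exact DifferentiableAt.mul (by fun_prop) (F.diff m hm z)
    · intro m hm
      obtain ⟨K, hK, H⟩ := F.growth m hm
      refine ⟨3 * K, by positivity, fun z a b c => ?_⟩
      have h1 := norm_exp_sq z s0 (by rw [abs_le]; constructor <;> linarith)
      have h2 : Real.exp (-|z.im - s0.im| ^ 2) ≤ 1 := Real.exp_le_one_iff.2 (by simp [sq_nonneg])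
      rw [norm_mul, mul_assoc]
      exact mul_le_mul (by linarith) (H z (by linarith) b c) (norm_nonneg _) (by norm_num)
    · intro s hs
      have hu := abs_nonneg (s.im - s0.im)
      refine (ns_smul_le (norm_exp_sq s s0 (by rw [hs, abs_le]; constructor <;> linarith))).trans ?_
      have h1 := HA X S h E w M F s hs _ _ rfl rfl
      have h2 := RZ_bound (T := |s.im| + 2) hδ hX (by linarith [abs_nonneg s.im])
      have h3 := W_mono (T := T) (T' := |s.im| + 2) (u := |s.im - s0.im|) hδ hδ1 hX hT2 (by positivity) hu
        (by rw [hT, add_comm]; exact abs_T)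
      rw [← hW] at h3
      have h4 : ns S (fun m => M m s) ≤ CA * (2 * ((1 + |s.im - s0.im|) ^ 3 * W)) :=
        h1.trans (mul_le_mul_of_nonneg_left (h2.trans (by linarith)) hCA.le)
      have h5 := mul_le_mul_of_nonneg_right (exp_poly hu) hW0
      calc 3 * Real.exp (-|s.im - s0.im| ^ 2) * ns S (fun m => M m s)
          ≤ 3 * Real.exp (-|s.im - s0.im| ^ 2) * (CA * (2 * ((1 + |s.im - s0.im|) ^ 3 * W))) := by gcongr
        _ = 6 * CA * (Real.exp (-|s.im - s0.im| ^ 2) * (1 + |s.im - s0.im|) ^ 3 * W) := by ring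
        _ ≤ 6 * CA * (8 * W) := by gcongr
        _ ≤ _ := by nlinarith [mul_nonneg hC0.le hW0]
    · intro s hs
      have hu := abs_nonneg (s.im - s0.im)
      refine (ns_smul_le (norm_exp_sq s s0 (by rw [hs, abs_le]; constructor <;> linarith))).trans ?_
      have h1 : ns S (fun m => M m s) ≤ (T * (1 + |s.im - s0.im|) * C0) * (3 * Real.sqrt X) := by
        refine ns_card hX (fun m hm => (F.hS m hm).2) (by positivity) (fun m hm => ?_)
        rw [F.right m hm s (by rw [hs]; norm_num), norm_mul]
        have h1 := Complex.norm_le_abs_re_add_abs_im (s - 1)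
        have h2 : |(s-1).re| ≤ 2 := by rw [abs_le]; constructor <;> simp [hs] <;> norm_num
        have h3 : (s-1).im = s.im := by simp
        rw [h3] at h1
        have h4 := abs_T (t := s.im) (t0 := s0.im)
        rw [← hT] at h4
        refine mul_le_mul (by linarith) (H0 _ (fun n => ?_) s (by rw [hs])) (norm_nonneg _) (by positivity)
        rw [norm_mul]
        have := mul_le_mul (hh1 n) (chi_norm_le hχ (F.hS m hm).1.odd n) (norm_nonneg _) (by norm_num)
        linarith
      have h2 : Real.sqrt X ≤ (X * T) ^ (1/2 + δ) := by
        rw [Real.sqrt_eq_rpow]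
        calc X ^ (1/2 : ℝ) ≤ (X * T) ^ (1/2 : ℝ) := Real.rpow_le_rpow (by linarith) (by nlinarith) (by norm_num)
          _ ≤ _ := Real.rpow_le_rpow_of_exponent_le (by nlinarith) (by linarith)
      have h3 : (1 + |s.im - s0.im|) ≤ (1 + |s.im - s0.im|) ^ 3 := by
        have := pow_le_pow_right₀ (a := 1 + |s.im - s0.im|) (by linarith) (by norm_num : 1 ≤ 3)
        rwa [pow_one] at this
      have h5 := mul_le_mul_of_nonneg_right (exp_poly hu) hW0
      calc 3 * Real.exp (-|s.im - s0.im| ^ 2) * ns S (fun m => M m s)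
          ≤ 3 * Real.exp (-|s.im - s0.im| ^ 2) * ((T * (1 + |s.im - s0.im|) ^ 3 * C0) * (3 * (X * T) ^ (1/2 + δ))) := by
            refine mul_le_mul_of_nonneg_left (h1.trans ?_) (by positivity)
            gcongr
        _ = 9 * C0 * (Real.exp (-|s.im - s0.im| ^ 2) * (1 + |s.im - s0.im|) ^ 3 * W) := by rw [hW]; ring
        _ ≤ 9 * C0 * (8 * W) := by gcongr
        _ ≤ _ := by nlinarith [mul_nonneg hCA.le hW0]
  simpa using main


/-! ### Step C: second moment over dyadic residue classes -/

theorem Dser_mul_left (c : ℂ) (F : O → ℂ) (s : ℂ) : Dser (fun n => c * F n) s = c * Dser F s := by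
  unfold Dser
  rw [← tsum_mul_left]
  exact tsum_congr (fun n => by rw [mul_div_assoc])

theorem MF_of {χ : O → O → ℤ} (hχ : IsQuadSym χ) {L : ℂ → O → ℂ} (hL : IsHeckeL χ L) {u : O} (hu1 : u = 1 ∨ u = ig)
    {X : ℝ} (hX : 1 ≤ X) {c : O} {S : Finset O}
    (hS : ∀ m ∈ S, Sp m ∧ Squarefree m ∧ Nm m ≤ X ∧ X / 2 < Nm m ∧ (4:O) ∣ m - c) :
    ∃ w M, MF χ X S (hu χ u) (Eh (hu χ u) c) w M ∧ ∀ m ∈ S, ∀ s : ℂ, s ≠ 1 → (s - 1) * L s (u * m) = M m s := by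
  have hex : ∀ m : O, ∃ w : ℂ, m ∈ S → ‖w‖ = 1 ∧ TP (fun n => hu χ u n * (χ n m : ℂ))
      (fun n => w * (Eh (hu χ u) m n * (χ n m : ℂ))) (1 / (4 * Real.sqrt (Nm m))) 4 := by
    intro m
    by_cases hm : m ∈ S
    · obtain ⟨w, hw⟩ := TP_of hχ (hS m hm).1 (hS m hm).2.1 (hu_per hχ hu1) (hu_zero χ u) (hu_norm hχ u)
      exact ⟨w, fun _ => hw⟩
    · exact ⟨0, fun h => absurd h hm⟩
  choose w hw using hex
  refine ⟨w, fun m s => if hm : m ∈ S then MM (hw m hm).2 s else 0, ?_, ?_⟩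
  · refine ⟨hX, fun m hm => ⟨(hS m hm).1, (hS m hm).2.2.1⟩, fun m hm => (hS m hm).2.2.2.1,
      fun n => (hu_norm hχ u n).trans (by norm_num), fun n => Eh_norm (hu_norm hχ u) c n, fun m hm => (hw m hm).1,
      ?_, ?_, ?_, ?_⟩
    · intro m hm
      simp only [hm, dif_pos]
      exact MM_diff _
    · intro m hm s hs
      simp only [hm, dif_pos]
      exact MM_right _ hs
    · intro m hm s hs
      simp only [hm, dif_pos]
      rw [MM_left _ hs, Dser_mul_left, Eh_congr (hu_per hχ hu1) (hS m hm).2.2.2.2]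
      rfl
    · intro m hm
      simp only [hm, dif_pos]
      exact MM_growth _
  · intro m hm s hs
    simp only [hm, dif_pos]
    exact L_eq hχ hL (hS m hm).1 _ hs

theorem Tim_le {s : ℂ} {ε : ℝ} (hε : 0 < ε) (h : ε < ‖s - 1‖) : |s.im| + 2 ≤ ‖s - 1‖ * (1 + 2 / ε) := by
  have h1 := Complex.abs_im_le_norm (s - 1)
  have h2 : (s-1).im = s.im := by simp
  rw [h2] at h1
  have h3 : 2 ≤ ‖s - 1‖ * (2 / ε) := by
    rw [mul_div_assoc', le_div_iff₀ hε]; linarith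
  linarith

theorem T_le5 {s : ℂ} (h : 1/2 ≤ s.re) : |s.im| + 2 ≤ 5 * ‖s‖ := by
  have h1 := Complex.abs_im_le_norm s
  have h2 := Complex.re_le_norm s
  linarith

theorem stepC {χ : O → O → ℤ} (hχ : IsQuadSym χ) {L : ℂ → O → ℂ} (hL : IsHeckeL χ L) {ε δ : ℝ} (hε : 0 < ε)
    (hδ : 0 < δ) (hδ1 : δ ≤ 1/4) : ∃ C : ℝ, 0 < C ∧
    ∀ (u : O), (u = 1 ∨ u = ig) → ∀ (X : ℝ), 1 ≤ X → ∀ (c : O) (S : Finset O),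
      (∀ m ∈ S, Sp m ∧ Squarefree m ∧ Nm m ≤ X ∧ X / 2 < Nm m ∧ (4:O) ∣ m - c) →
      ∀ s : ℂ, 1/2 ≤ s.re → s.re ≤ 3/2 → ε < ‖s - 1‖ →
      ∑ m ∈ S, ‖L s (u * m)‖ ^ 2 ≤ C * (X * ‖s‖) ^ (1 + 2 * δ) := by
  obtain ⟨C, hC, H⟩ := stepB hχ hδ hδ1
  refine ⟨(C * (1 + 2 / ε)) ^ 2 * 5 ^ (1 + 2 * δ), by positivity, fun u hu1 X hX c S hS s hs1 hs2 hs3 => ?_⟩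
  obtain ⟨w, M, F, HM⟩ := MF_of hχ hL hu1 hX hS
  have hp : 0 < ‖s - 1‖ := hε.trans hs3
  have hs : s ≠ 1 := by rintro rfl; simp at hp
  have h1 := H X S _ _ w M F (hu_norm hχ u) s hs1 hs2 _ rfl
  set T := |s.im| + 2 with hT
  have hT0 : 0 < T := by positivity
  have hX0 : 0 < X := by linarith
  have h2 : ns S (fun m => M m s) ≤ (C * (1 + 2 / ε)) * (X * T) ^ (1/2 + δ) * ‖s - 1‖ := by
    refine h1.trans ?_
    have := mul_le_mul_of_nonneg_right (Tim_le hε hs3) (by positivity : 0 ≤ C * (X * T) ^ (1/2 + δ))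
    rw [← hT] at this
    linarith
  have h3 : ‖s - 1‖ ^ 2 * ∑ m ∈ S, ‖L s (u * m)‖ ^ 2 = ns S (fun m => M m s) ^ 2 := by
    rw [ns_sq, Finset.mul_sum]
    refine Finset.sum_congr rfl (fun m hm => ?_)
    rw [← HM m hm s hs, norm_mul, mul_pow]
  have h4 := pow_le_pow_left₀ (ns_nonneg _ _) h2 2
  rw [← h3, mul_pow, mul_comm] at h4
  have h5 := le_of_mul_le_mul_right h4 (by positivity)
  refine h5.trans ?_
  rw [mul_pow, mul_assoc]
  refine mul_le_mul_of_nonneg_left ?_ (by positivity)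
  rw [← Real.rpow_natCast, ← Real.rpow_mul (by positivity), ← Real.mul_rpow (by norm_num) (by positivity)]
  rw [show (1/2 + δ) * ((2:ℕ):ℝ) = 1 + 2 * δ by push_cast; ring]
  refine Real.rpow_le_rpow (by positivity) ?_ (by positivity)
  have := T_le5 hs1
  nlinarith


/-! ### Final assembly -/

def SS (X : ℝ) : Finset O := (Bl X).filter (fun m => Sp m ∧ Squarefree m)

theorem mem_SS {X : ℝ} {m : O} : m ∈ SS X ↔ Nm m ≤ X ∧ Sp m ∧ Squarefree m := by
  unfold SS; rw [Finset.mem_filter, mem_Bl]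

theorem stepD {χ : O → O → ℤ} (hχ : IsQuadSym χ) {L : ℂ → O → ℂ} (hL : IsHeckeL χ L) {ε δ : ℝ} (hε : 0 < ε)
    (hδ : 0 < δ) (hδ1 : δ ≤ 1/4) : ∃ C : ℝ, 0 < C ∧
    ∀ (u : O), (u = 1 ∨ u = ig) → ∀ (X : ℝ), 1 ≤ X → 
      ∀ s : ℂ, 1/2 ≤ s.re → s.re ≤ 3/2 → ε < ‖s - 1‖ →
      ∑ m ∈ (SS X).filter (fun m => X / 2 < Nm m), ‖L s (u * m)‖ ^ 2 ≤ C * (X * ‖s‖) ^ (1 + 2 * δ) := by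
  obtain ⟨C, hC, H⟩ := stepC hχ hL hε hδ hδ1
  refine ⟨((Fintype.card (RQ (4:O)) : ℝ) + 1) * C, by positivity, fun u hu1 X hX s h1 h2 h3 => ?_⟩
  rw [← Finset.sum_fiberwise_of_maps_to (s := (SS X).filter (fun m => X / 2 < Nm m)) (t := Finset.univ)
    (g := mkq (4:O)) (fun _ _ => Finset.mem_univ _)]
  have hb : ∀ k ∈ (Finset.univ : Finset (RQ (4:O))),
      ∑ m ∈ ((SS X).filter (fun m => X / 2 < Nm m)).filter (fun m => mkq (4:O) m = k), ‖L s (u * m)‖ ^ 2 ≤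
        C * (X * ‖s‖) ^ (1 + 2 * δ) := by
    intro k _
    refine H u hu1 X hX (ot k) _ (fun m hm => ?_) s h1 h2 h3
    rw [Finset.mem_filter, Finset.mem_filter, mem_SS] at hm
    refine ⟨hm.1.1.2.1, hm.1.1.2.2, hm.1.1.1, hm.1.2, ?_⟩
    rw [← mkq_eq, mkq_ot]; exact hm.2
  refine (Finset.sum_le_card_nsmul _ _ _ hb).trans ?_
  rw [nsmul_eq_mul, Finset.card_univ]
  have : 0 ≤ C * (X * ‖s‖) ^ (1 + 2 * δ) := by positivity
  linarith

theorem stepE {χ : O → O → ℤ} (hχ : IsQuadSym χ) {L : ℂ → O → ℂ} (hL : IsHeckeL χ L) {ε δ : ℝ} (hε : 0 < ε)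
    (hδ : 0 < δ) (hδ1 : δ ≤ 1/4) : ∃ C : ℝ, 0 < C ∧
    ∀ (u : O), (u = 1 ∨ u = ig) → ∀ (X : ℝ), 0 ≤ X → 
      ∀ s : ℂ, 1/2 ≤ s.re → s.re ≤ 3/2 → ε < ‖s - 1‖ →
      ∑ m ∈ SS X, ‖L s (u * m)‖ ^ 2 ≤ C * (X * ‖s‖) ^ (1 + 2 * δ) := by
  obtain ⟨C, hC, H⟩ := stepD hχ hL hε hδ hδ1
  refine ⟨2 * C, by positivity, fun u hu1 X hX s h1 h2 h3 => ?_⟩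
  have key : ∀ n : ℕ, ∀ X : ℝ, 0 ≤ X → X < 2 ^ n →
      ∑ m ∈ SS X, ‖L s (u * m)‖ ^ 2 ≤ 2 * C * (X * ‖s‖) ^ (1 + 2 * δ) := by
    have small : ∀ X : ℝ, 0 ≤ X → X < 1 → ∑ m ∈ SS X, ‖L s (u * m)‖ ^ 2 ≤ 2 * C * (X * ‖s‖) ^ (1 + 2 * δ) := by
      intro X hX0 hX
      have : SS X = ∅ := by
        refine Finset.eq_empty_of_forall_notMem (fun m hm => ?_)
        rw [mem_SS] at hm
        have := one_le_Nm hm.2.1.ne_zero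
        linarith
      rw [this, Finset.sum_empty]
      positivity
    intro n
    induction n with
    | zero => intro X hX0 hX; exact small X hX0 (by simpa using hX)
    | succ n ih =>
      intro X hX0 hX
      by_cases hX1 : X < 1
      · exact small X hX0 hX1
      push Not at hX1
      have i1 := ih (X / 2) (by positivity) (by rw [pow_succ] at hX; linarith)
      have i2 := H u hu1 X hX1 s h1 h2 h3
      rw [← Finset.sum_filter_add_sum_filter_not (SS X) (fun m => X / 2 < Nm m)]
      have e : (SS X).filter (fun m => ¬ X / 2 < Nm m) = SS (X / 2) := by
        ext m
        rw [Finset.mem_filter, mem_SS, mem_SS, not_lt]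
        constructor
        · rintro ⟨a, b⟩; exact ⟨b, a.2⟩
        · rintro ⟨a, b⟩; exact ⟨⟨by linarith, b⟩, a⟩
      rw [e]
      have hhalf : (X / 2 * ‖s‖) ^ (1 + 2 * δ) ≤ (X * ‖s‖) ^ (1 + 2 * δ) / 2 := by
        rw [show X / 2 * ‖s‖ = (X * ‖s‖) * (1 / 2) by ring, Real.mul_rpow (by positivity) (by norm_num)]
        have : (1 / 2 : ℝ) ^ (1 + 2 * δ) ≤ (1 / 2 : ℝ) ^ (1 : ℝ) :=
          Real.rpow_le_rpow_of_exponent_ge (by norm_num) (by norm_num) (by linarith)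
        rw [Real.rpow_one] at this
        have := mul_le_mul_of_nonneg_left this (by positivity : 0 ≤ (X * ‖s‖) ^ (1 + 2 * δ))
        linarith
      have := mul_le_mul_of_nonneg_left hhalf hC.le
      linarith
  obtain ⟨n, hn⟩ := pow_unbounded_of_one_lt X (by norm_num : (1:ℝ) < 2)
  exact key n X hX hn

theorem L_bdd {χ : O → O → ℤ} (hχ : IsQuadSym χ) {L : ℂ → O → ℂ} (hL : IsHeckeL χ L) : ∃ C : ℝ, 0 < C ∧
    ∀ (u : O), (u = 1 ∨ u = ig) → ∀ m : O, Sp m → Squarefree m → ∀ s : ℂ, 3/2 ≤ s.re → ‖L s (u * m)‖ ≤ C := by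
  obtain ⟨C, hC, H⟩ := Dser_bdd
  refine ⟨C, hC, fun u hu1 m sm hm s hs => ?_⟩
  obtain ⟨w, M, F, HM⟩ := MF_of (X := Nm m) (c := m) (S := {m}) hχ hL hu1 (one_le_Nm sm.ne_zero) (by
    intro k hk
    rw [Finset.mem_singleton] at hk
    subst hk
    have := Nm_pos sm.ne_zero
    exact ⟨sm, hm, le_rfl, by linarith, by simp⟩)
  have hs1 : s - 1 ≠ 0 := by
    intro h0
    have := congrArg Complex.re h0
    simp at this; linarith
  have hm' := Finset.mem_singleton_self m
  have h1 := HM m hm' s (sub_ne_zero.1 hs1)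
  rw [F.right m hm' s (by linarith)] at h1
  rw [mul_left_cancel₀ hs1 h1]
  refine H _ (fun n => ?_) s hs
  rw [norm_mul]
  have := mul_le_mul (hu_norm hχ u n) (chi_norm_le hχ sm.odd n) (norm_nonneg _) (by norm_num)
  linarith

theorem stepF {χ : O → O → ℤ} (hχ : IsQuadSym χ) {L : ℂ → O → ℂ} (hL : IsHeckeL χ L) {ε δ : ℝ} (hε : 0 < ε)
    (hδ : 0 < δ) (hδ1 : δ ≤ 1/4) : ∃ C : ℝ, 0 < C ∧
    ∀ (u : O), (u = 1 ∨ u = ig) → ∀ (X : ℝ), 1 ≤ X → 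
      ∀ s : ℂ, 1/2 ≤ s.re → ε < ‖s - 1‖ →
      ∑ m ∈ SS X, ‖L s (u * m)‖ ^ 2 ≤ C * (X * ‖s‖) ^ (1 + 2 * δ) := by
  obtain ⟨C, hC, H⟩ := stepE hχ hL hε hδ hδ1
  obtain ⟨C0, hC0, H0⟩ := L_bdd hχ hL
  refine ⟨C + 9 * C0 ^ 2, by positivity, fun u hu1 X hX s h1 h3 => ?_⟩
  have hp : 0 ≤ (X * ‖s‖) ^ (1 + 2 * δ) := by positivity
  by_cases h2 : s.re ≤ 3/2
  · refine (H u hu1 X (by linarith) s h1 h2 h3).trans ?_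
    gcongr
    linarith [sq_nonneg C0]
  · push Not at h2
    have hs : 1 ≤ ‖s‖ := by linarith [Complex.re_le_norm s]
    have hc : ((SS X).card : ℝ) ≤ 9 * X :=
      le_trans (by exact_mod_cast Finset.card_le_card (Finset.filter_subset _ _)) (card_Bl hX)
    have hXs : X ≤ (X * ‖s‖) ^ (1 + 2 * δ) := by
      calc X ≤ X * ‖s‖ := by nlinarith
        _ = (X * ‖s‖) ^ (1 : ℝ) := (Real.rpow_one _).symm
        _ ≤ _ := Real.rpow_le_rpow_of_exponent_le (by nlinarith) (by linarith)
    have := Finset.sum_le_card_nsmul (SS X) (fun m => ‖L s (u * m)‖ ^ 2) (C0 ^ 2) (fun m hm => by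
      rw [mem_SS] at hm
      exact pow_le_pow_left₀ (norm_nonneg _) (H0 u hu1 m hm.2.1 hm.2.2 s h2.le) 2)
    rw [nsmul_eq_mul] at this
    refine this.trans ?_
    calc ((SS X).card : ℝ) * C0 ^ 2 ≤ (9 * (X * ‖s‖) ^ (1 + 2 * δ)) * C0 ^ 2 := by
          gcongr; linarith
      _ ≤ _ := by nlinarith [mul_nonneg hC.le hp]

theorem Squarefree_neg_ig {m : O} (h : Squarefree m) : Squarefree (-(ig * m)) := by
  have : Associated m (-(ig * m)) := by
    refine (associated_unit_mul_right m ig isUnit_ig).trans ?_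
    exact (Associated.neg_right (Associated.refl _))
  exact this.squarefree_iff.1 h

theorem main_thm (χ : O → O → ℤ) (hχ : IsQuadSym χ) (L : ℂ → O → ℂ) (hL : IsHeckeL χ L) (ε : ℝ) (hε : 0 < ε) :
    ∃ C : ℝ, 0 < C ∧ ∀ (s : ℂ) (X : ℝ), 1 / 2 ≤ s.re → ε < ‖s - 1‖ → 1 ≤ X →
      (∑' m : O, if Squarefree m ∧ IsCoprime m 2 ∧ Nm m ≤ X then ‖L s m‖ ^ 2 else 0) ≤
        C * (X * ‖s‖) ^ (1 + ε) := by
  set δ := min (ε / 2) (1 / 4) with hδd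
  have hδ : 0 < δ := lt_min (by linarith) (by norm_num)
  have hδ1 : δ ≤ 1 / 4 := min_le_right _ _
  have hδ2 : δ ≤ ε / 2 := min_le_left _ _
  obtain ⟨C, hC, H⟩ := stepF hχ hL hε hδ hδ1
  refine ⟨2 * C * 2 ^ ε, by positivity, fun s X h1 h2 hX => ?_⟩
  have hs : 1/2 ≤ ‖s‖ := h1.trans (Complex.re_le_norm s)
  have t1 : (∑' m : O, if Squarefree m ∧ IsCoprime m 2 ∧ Nm m ≤ X then ‖L s m‖ ^ 2 else 0) =
      ∑ m ∈ (Bl X).filter (fun m => Squarefree m ∧ ¬ ωg ∣ m), ‖L s m‖ ^ 2 := by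
    rw [tsum_eq_sum (s := (Bl X).filter (fun m => Squarefree m ∧ ¬ ωg ∣ m))]
    · refine Finset.sum_congr rfl (fun m hm => ?_)
      rw [Finset.mem_filter, mem_Bl] at hm
      rw [if_pos ⟨hm.2.1, (odd_iff_coprime_two m).2 hm.2.2, hm.1⟩]
    · intro m hm
      rw [if_neg]
      rintro ⟨a, b, c⟩
      exact hm (Finset.mem_filter.2 ⟨mem_Bl.2 c, a, (odd_iff_coprime_two m).1 b⟩)
  rw [t1, ← Finset.sum_filter_add_sum_filter_not _ (fun m => Sp m)]
  have b1 : ∑ m ∈ ((Bl X).filter (fun m => Squarefree m ∧ ¬ ωg ∣ m)).filter (fun m => Sp m), ‖L s m‖ ^ 2 ≤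
      C * (X * ‖s‖) ^ (1 + 2 * δ) := by
    refine le_trans ?_ (H 1 (Or.inl rfl) X hX s h1 h2)
    simp only [one_mul]
    refine Finset.sum_le_sum_of_subset_of_nonneg (fun m hm => ?_) (fun _ _ _ => by positivity)
    rw [Finset.mem_filter, Finset.mem_filter, mem_Bl] at hm
    exact mem_SS.2 ⟨hm.1.1, hm.2, hm.1.2.1⟩
  have b2 : ∑ m ∈ ((Bl X).filter (fun m => Squarefree m ∧ ¬ ωg ∣ m)).filter (fun m => ¬ Sp m), ‖L s m‖ ^ 2 ≤
      C * (X * ‖s‖) ^ (1 + 2 * δ) := by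
    refine le_trans ?_ (H ig (Or.inr rfl) X hX s h1 h2)
    have hinv : ∀ m : O, ig * (-(ig * m)) = m := fun m => by
      rw [mul_neg, ← mul_assoc, ig_sq]; ring
    have e : ∑ m ∈ ((Bl X).filter (fun m => Squarefree m ∧ ¬ ωg ∣ m)).filter (fun m => ¬ Sp m), ‖L s m‖ ^ 2 =
        ∑ k ∈ (((Bl X).filter (fun m => Squarefree m ∧ ¬ ωg ∣ m)).filter (fun m => ¬ Sp m)).image
          (fun m => -(ig * m)), ‖L s (ig * k)‖ ^ 2 := by
      rw [Finset.sum_image]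
      · exact Finset.sum_congr rfl (fun m _ => by rw [hinv])
      · intro a _ b _ hab
        have := congrArg (fun z => ig * z) hab
        simpa only [hinv] using this
    rw [e]
    refine Finset.sum_le_sum_of_subset_of_nonneg (fun k hk => ?_) (fun _ _ _ => by positivity)
    obtain ⟨m, hm, rfl⟩ := Finset.mem_image.1 hk
    rw [Finset.mem_filter, Finset.mem_filter, mem_Bl] at hm
    have hN : Nm (-(ig * m)) = Nm m := by
      rw [neg_eq_neg_one_mul, ← ig_sq, Nm_mul, Nm_mul, Nm_mul, Nm_ig]; ring
    refine mem_SS.2 ⟨by rw [hN]; exact hm.1.1, ?_, Squarefree_neg_ig hm.1.2.1⟩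
    exact ((Sp_or m hm.1.2.2).resolve_left hm.2).neg
  have hpow : (X * ‖s‖) ^ (1 + 2 * δ) ≤ 2 ^ ε * (X * ‖s‖) ^ (1 + ε) := by
    have hY : 1/2 ≤ X * ‖s‖ := by nlinarith
    set Y := X * ‖s‖
    have hY0 : 0 < Y := by linarith
    have c1 : 1 ≤ (2 * Y) ^ (ε - 2 * δ) := Real.one_le_rpow (by linarith) (by linarith)
    have c2 : (2:ℝ) ^ (ε - 2 * δ) ≤ 2 ^ ε := Real.rpow_le_rpow_of_exponent_le (by norm_num) (by linarith)
    have c3 : Y ^ (1 + ε) = Y ^ (1 + 2 * δ) * Y ^ (ε - 2 * δ) := by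
      rw [← Real.rpow_add hY0]; congr 1; ring
    rw [Real.mul_rpow (by norm_num) hY0.le] at c1
    calc Y ^ (1 + 2 * δ) ≤ Y ^ (1 + 2 * δ) * (2 ^ (ε - 2 * δ) * Y ^ (ε - 2 * δ)) :=
          le_mul_of_one_le_right (by positivity) c1
      _ ≤ Y ^ (1 + 2 * δ) * (2 ^ ε * Y ^ (ε - 2 * δ)) := by gcongr
      _ = _ := by rw [c3]; ring
  have := mul_le_mul_of_nonneg_left hpow hC.le
  linarith


end SMQ

/-- the second-moment bound of Lemma 2.4 of the paper: for `Re s ≥ 1/2` with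
`|s − 1| > ε`, `∑*_{(m,2)=1, N(m) ≤ X} |L(s, χ_m)|² ≪ (X|s|)^{1+ε}`, the sum being over
square-free `m` coprime to `2`. -/
theorem second_moment_quadratic_Hecke
    (χ : GaussianInt → GaussianInt → ℤ) (hχ : IsQuadSym χ)
    (L : ℂ → GaussianInt → ℂ) (hL : IsHeckeL χ L)
    (ε : ℝ) (hε : 0 < ε) :
    ∃ C : ℝ, 0 < C ∧ ∀ (s : ℂ) (X : ℝ), 1 / 2 ≤ s.re → ε < ‖s - 1‖ → 1 ≤ X →
      (∑' m : GaussianInt,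
          if Squarefree m ∧ IsCoprime m 2 ∧ Nm m ≤ X then ‖L s m‖ ^ 2 else 0) ≤
        C * (X * ‖s‖) ^ (1 + ε) := by
  exact SMQ.main_thm χ hχ L hL ε hε
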